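/- For every d ∈ ℕ there exists a constant C_d > 0, depending only on d, with the following property: let Λ₁, …, Λ_d be Littlewood–Paley sequences on ℝ with σ_{Λ_n} < ∞ for all n = 1,…,d. Then for every p with 1 < p < 2 and every Schwartz function f on ℝ^d, one has ‖S_{ℝ^d}^{(Λ₁,…,Λ_d)}(f)‖_{L^p(ℝ^d)} ≤ C_d (p−1)^{-3d/2} (Π_{n=1}^d σ_{Λ_n}^{1/2}) ‖f‖_{L^p(ℝ^d)}. -/

import Mathlib

open MeasureTheory Real Complex Filter
open scoped ENNReal BigOperators Topology

noncomputable section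

/-- The Fourier transform `f̂(ξ) = ∫ f(x) e^{-i x·ξ} dx` on `ℝ^d`. -/
def FTd {d : ℕ} (f : (Fin d → ℝ) → ℂ) (ξ : Fin d → ℝ) : ℂ :=
  ∫ x : Fin d → ℝ, Complex.exp (-(Complex.I * ((∑ k, x k * ξ k : ℝ) : ℂ))) * f x

/-- The symbol `χ_{[Λ(j-1), Λ j) ∪ (-Λ j, -Λ(j-1)]}` of the rough projection `P_j^{(Λ)}`. -/
def symInd (Λ : ℤ → ℝ) (j : ℤ) (ξ : ℝ) : ℝ :=
  if (Λ (j - 1) ≤ ξ ∧ ξ < Λ j) ∨ (-(Λ j) < ξ ∧ ξ ≤ -(Λ (j - 1))) then 1 else 0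

/-- The `d`-parameter rough Littlewood–Paley piece `(P_{j₁}⊗⋯⊗P_{j_d}) f`, i.e. the
inverse Fourier transform of `f̂` multiplied by the product of the one-variable rough
symbols. -/
def PpiecePi {d : ℕ} (Λs : Fin d → ℤ → ℝ) (j : Fin d → ℤ) (f : (Fin d → ℝ) → ℂ)
    (x : Fin d → ℝ) : ℂ :=
  (((2 * π) ^ d)⁻¹ : ℝ) • ∫ ξ : Fin d → ℝ,
    ((∏ k, symInd (Λs k) (j k) (ξ k) : ℝ) : ℂ) * FTd f ξ *
      Complex.exp (Complex.I * ((∑ k, x k * ξ k : ℝ) : ℂ))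

/-- The `d`-parameter rough Littlewood–Paley square function on `ℝ^d`. -/
def LPsqE {d : ℕ} (Λs : Fin d → ℤ → ℝ) (f : (Fin d → ℝ) → ℂ) (x : Fin d → ℝ) : ℝ :=
  Real.sqrt (∑' j : Fin d → ℤ, ‖PpiecePi Λs j f x‖ ^ 2)

/-- `σ_Λ = sup_{j∈ℤ} #(Λ ∩ [2^{j-1}, 2^j))`, where `Λ` is identified with its range. -/
def sigmaE (Λ : ℤ → ℝ) : ℕ :=
  sSup {m : ℕ | ∃ j : ℤ, m = (Set.range Λ ∩ Set.Ico ((2:ℝ) ^ (j - 1)) ((2:ℝ) ^ j)).ncard}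

open scoped FourierTransform SchwartzMap in
theorem lintegral_enorm_fourier_sq {f : ℝ → ℂ} (hf : Integrable f) (hf2 : MemLp f 2) :
    ∫⁻ ξ, ‖𝓕 f ξ‖ₑ ^ 2 = ∫⁻ x, ‖f x‖ₑ ^ 2 := by
  set F : Lp ℂ 2 (volume : Measure ℝ) := hf2.toLp f
  have hae : ((𝓕 F : Lp ℂ 2 (volume : Measure ℝ)) : ℝ → ℂ) =ᵐ[volume] 𝓕 f := by
    have hcont : Continuous (𝓕 f) :=
      VectorFourier.fourierIntegral_continuous Real.continuous_fourierChar
        (innerSL ℝ).continuous₂ hf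
    refine ae_eq_of_integral_contDiff_smul_eq
      ((Lp.memLp (𝓕 F)).locallyIntegrable (by norm_num)) hcont.locallyIntegrable ?_
    intro g hg hgs
    let G : 𝓢(ℝ, ℂ) := (hgs.comp_left (g := fun r : ℝ => (r : ℂ)) (by simp)).toSchwartzMap
      (Complex.ofRealCLM.contDiff.comp hg)
    have hG : ∀ x, G x = (g x : ℂ) := fun x => rfl
    have h1 := congrArg (fun T => T G) (Lp.fourier_toTemperedDistribution_eq F)
    simp only [TemperedDistribution.fourier_apply, Lp.toTemperedDistribution_apply] at h1
    have h2 : ∫ x, (𝓕 G) x • (F x) = ∫ x, (𝓕 G) x • f x := by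
      refine integral_congr_ae ?_
      filter_upwards [hf2.coeFn_toLp] with x hx
      rw [hx]
    have h3 : ∫ x, 𝓕 (⇑G) x • f x = ∫ x, G x • 𝓕 f x := by
      have := VectorFourier.integral_fourierIntegral_smul_eq_flip (f := ⇑G) (g := f)
        (L := innerₗ ℝ) (μ := volume) (ν := volume)
        (e := Real.fourierChar) Real.continuous_fourierChar continuous_inner G.integrable hf
      rw [flip_innerₗ] at this
      exact this
    have h4 : ∫ x, g x • (𝓕 F : Lp ℂ 2 (volume : Measure ℝ)) x
        = ∫ x, G x • (𝓕 F : Lp ℂ 2 (volume : Measure ℝ)) x := by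
      simp [hG]
    have h5 : ∫ x, g x • 𝓕 f x = ∫ x, G x • 𝓕 f x := by simp [hG]
    rw [h4, h5, ← h3]
    rw [← h1, h2, SchwartzMap.fourier_coe]
  have hn := Lp.norm_fourier_eq F
  have e1 : eLpNorm (𝓕 f) 2 volume = eLpNorm f 2 volume := by
    rw [← eLpNorm_congr_ae hae, ← eLpNorm_congr_ae hf2.coeFn_toLp]
    rw [Lp.norm_def, Lp.norm_def] at hn
    exact (ENNReal.toReal_eq_toReal_iff' (Lp.eLpNorm_ne_top _) (Lp.eLpNorm_ne_top _)).1 hn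
  have := congrArg (fun t => t ^ (2:ℝ)) e1
  simp only [eLpNorm_eq_lintegral_rpow_enorm_toReal (two_ne_zero) ENNReal.ofNat_ne_top,
    ← ENNReal.rpow_mul] at this
  simpa using this

open scoped FourierTransform in
theorem integral_mul_fourierInv_sub {f m : ℝ → ℂ} (hf : Integrable f) (hm : Integrable m) (x : ℝ) :
    ∫ y, f y * 𝓕⁻ m (x - y) = 𝓕⁻ (fun ξ => m ξ * 𝓕 f ξ) x := by
  simp only [Real.fourierInv_eq', Real.fourier_eq', smul_eq_mul]
  simp only [← integral_const_mul]
  rw [integral_integral_swap]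
  · refine integral_congr_ae (ae_of_all _ fun ξ => ?_)
    refine integral_congr_ae (ae_of_all _ fun y => ?_)
    simp only [RCLike.inner_apply, conj_trivial]
    have : cexp (↑(2 * π * ((x - y) * ξ)) * I) =
        cexp (↑(2 * π * (x * ξ)) * I) * cexp (↑(-2 * π * (ξ * y)) * I) := by
      rw [← Complex.exp_add]; congr 1; push_cast; ring
    rw [this]; ring
  · have h := hf.mul_prod hm
    refine h.mono ?_ (ae_of_all _ fun z => ?_)
    · have hc : Continuous fun z : ℝ × ℝ => cexp (↑(2 * π * (inner ℝ z.2 (x - z.1))) * I) := by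
        fun_prop
      have h2 := hc.aestronglyMeasurable.mul h.aestronglyMeasurable (μ := volume.prod volume)
      refine h2.congr (ae_of_all _ fun z => ?_)
      simp only [Pi.mul_apply, Function.uncurry]
      ring
    · simp [Function.uncurry, Complex.norm_exp]

open scoped FourierTransform in
theorem lintegral_sum_enorm_multiplier_le {ι : Type*} (J : Finset ι) {f : ℝ → ℂ} (hf : Integrable f)
    (hf2 : MemLp f 2) (m : ι → ℝ → ℂ) (hm : ∀ j ∈ J, Integrable (m j)) (M : ℝ)
    (hM : ∀ ξ, ∑ j ∈ J, ‖m j ξ‖ ^ 2 ≤ M) :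
    ∫⁻ x, ∑ j ∈ J, ‖∫ y, f y * 𝓕⁻ (m j) (x - y)‖ₑ ^ 2 ≤ ENNReal.ofReal M * ∫⁻ x, ‖f x‖ₑ ^ 2 := by
  have hFc : Continuous (𝓕 f) :=
      VectorFourier.fourierIntegral_continuous Real.continuous_fourierChar
        (innerSL ℝ).continuous₂ hf
  have hFb : ∀ ξ, ‖𝓕 f ξ‖ ≤ ∫ x, ‖f x‖ := fun ξ =>
    VectorFourier.norm_fourierIntegral_le_integral_norm _ _ _ _ _
  have hF2 : MemLp (𝓕 f) 2 := by
    refine ⟨hFc.aestronglyMeasurable, ?_⟩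
    have h2 := hf2.2
    rw [eLpNorm_lt_top_iff_lintegral_rpow_enorm_lt_top two_ne_zero ENNReal.ofNat_ne_top] at h2 ⊢
    have := lintegral_enorm_fourier_sq hf hf2
    simp only [ENNReal.toReal_ofNat, ENNReal.rpow_ofNat] at h2 ⊢
    rwa [this]
  have hh1 : ∀ j ∈ J, Integrable (fun ξ => m j ξ * 𝓕 f ξ) := fun j hj =>
    (hm j hj).mul_bdd (c := ∫ x, ‖f x‖) hFc.aestronglyMeasurable (ae_of_all _ hFb)
  have hmb : ∀ j ∈ J, ∀ ξ, ‖m j ξ‖ ^ 2 ≤ M := fun j hj ξ =>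
    (Finset.single_le_sum (f := fun j => ‖m j ξ‖ ^ 2) (fun i _ => by positivity) hj).trans (hM ξ)
  have hh2 : ∀ j ∈ J, MemLp (fun ξ => m j ξ * 𝓕 f ξ) 2 := by
    intro j hj
    refine MemLp.of_le_mul (c := √M) hF2 (hh1 j hj).aestronglyMeasurable (ae_of_all _ fun ξ => ?_)
    rw [norm_mul]
    gcongr
    exact Real.le_sqrt_of_sq_le (hmb j hj ξ)
  have key : ∀ j ∈ J, ∫⁻ x, ‖∫ y, f y * 𝓕⁻ (m j) (x - y)‖ₑ ^ 2
      = ∫⁻ ξ, ‖m j ξ * 𝓕 f ξ‖ₑ ^ 2 := by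
    intro j hj
    rw [← lintegral_enorm_fourier_sq (hh1 j hj) (hh2 j hj)]
    rw [← lintegral_neg_eq_self (fun ξ => ‖𝓕 (fun ξ => m j ξ * 𝓕 f ξ) ξ‖ₑ ^ 2)]
    refine lintegral_congr fun x => ?_
    rw [integral_mul_fourierInv_sub hf (hm j hj), fourierInv_eq_fourier_neg]
  have hmeas : ∀ j ∈ J, AEMeasurable (fun ξ => ‖m j ξ * 𝓕 f ξ‖ₑ ^ 2) := fun j hj =>
    ((hh1 j hj).aestronglyMeasurable.enorm).pow_const _
  have hmeas' : ∀ j ∈ J, AEMeasurable (fun x => ‖∫ y, f y * 𝓕⁻ (m j) (x - y)‖ₑ ^ 2) := by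
    intro j hj
    have : Continuous (𝓕⁻ (fun ξ => m j ξ * 𝓕 f ξ)) := by
      have : Continuous (𝓕 (fun ξ => m j ξ * 𝓕 f ξ)) :=
        VectorFourier.fourierIntegral_continuous Real.continuous_fourierChar
          (innerSL ℝ).continuous₂ (hh1 j hj)
      have h2 := this.comp continuous_neg
      refine h2.congr fun x => ?_
      rw [fourierInv_eq_fourier_neg]; rfl
    have h3 : (fun x => ‖∫ y, f y * 𝓕⁻ (m j) (x - y)‖ₑ ^ 2)
      = fun x => ‖𝓕⁻ (fun ξ => m j ξ * 𝓕 f ξ) x‖ₑ ^ 2 := by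
      ext x; rw [integral_mul_fourierInv_sub hf (hm j hj)]
    rw [h3]
    exact (this.aestronglyMeasurable.enorm).pow_const _
  rw [lintegral_finsetSum' _ hmeas', Finset.sum_congr rfl key, ← lintegral_finsetSum' _ hmeas,
    ← lintegral_enorm_fourier_sq hf hf2, ← lintegral_const_mul' _ _ ENNReal.ofReal_ne_top]
  refine lintegral_mono fun ξ => ?_
  simp only [enorm_mul, mul_pow]
  rw [← Finset.sum_mul]
  gcongr
  have : ∑ j ∈ J, ‖m j ξ‖ₑ ^ 2 = ENNReal.ofReal (∑ j ∈ J, ‖m j ξ‖ ^ 2) := by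
    rw [ENNReal.ofReal_sum_of_nonneg (fun _ _ => by positivity)]
    refine Finset.sum_congr rfl fun j _ => ?_
    rw [ENNReal.ofReal_pow (norm_nonneg _), ofReal_norm]
  rw [this]
  exact ENNReal.ofReal_le_ofReal (hM ξ)

/-- The Dirichlet kernel `(2π)⁻¹ ∫_{-l}^{l} e^{iξu} dξ` of the line. -/
def dirKer (l u : ℝ) : ℂ :=
  (2 * π : ℂ)⁻¹ * ∫ ξ in (-l)..l, cexp (I * (ξ * u : ℝ))

theorem norm_exp_I_mul_real (t : ℝ) : ‖cexp (I * (t : ℂ))‖ = 1 := by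
  rw [mul_comm]; exact Complex.norm_exp_ofReal_mul_I t

theorem dirKer_eq (l : ℝ) {u : ℝ} (hu : u ≠ 0) :
    dirKer l u = (2 * π * I)⁻¹ * (cexp (I * (l * u : ℝ)) - cexp (I * ((-l) * u : ℝ))) / u := by
  have hc : (I * u : ℂ) ≠ 0 := mul_ne_zero I_ne_zero (by exact_mod_cast hu)
  have h : ∀ ξ : ℝ, cexp (I * (ξ * u : ℝ)) = cexp ((I * u) * ξ) := fun ξ => by
    congr 1; push_cast; ring
  unfold dirKer
  simp only [h]
  rw [integral_exp_mul_complex hc]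
  have hu' : (u : ℂ) ≠ 0 := by exact_mod_cast hu
  have hp : (π : ℂ) ≠ 0 := by exact_mod_cast Real.pi_ne_zero
  field_simp

theorem norm_dirKer_le {l : ℝ} (hl : 0 ≤ l) (u : ℝ) : ‖dirKer l u‖ ≤ l := by
  unfold dirKer
  rw [norm_mul, norm_inv]
  have h1 : ‖∫ ξ in (-l)..l, cexp (I * (ξ * u : ℝ))‖ ≤ 1 * |l - (-l)| :=
    intervalIntegral.norm_integral_le_of_norm_le_const fun ξ _ => (norm_exp_I_mul_real _).le
  have h2 : ‖(2 * π : ℂ)‖ = 2 * π := by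
    simp [abs_of_pos Real.pi_pos]
  rw [h2]
  rw [abs_of_nonneg (by linarith)] at h1
  calc (2 * π)⁻¹ * _ ≤ (2 * π)⁻¹ * (1 * (l - -l)) := by gcongr
    _ = l * π⁻¹ := by field_simp; ring
    _ ≤ l * 1 := by
      gcongr
      exact inv_le_one_of_one_le₀ (by linarith [Real.pi_gt_three])
    _ = l := mul_one l

theorem norm_exp_I_sub_le (a b : ℝ) : ‖cexp (I * a) - cexp (I * b)‖ ≤ |a - b| := by
  have h : cexp (I * a) - cexp (I * b) = cexp (I * b) * (cexp (I * ((a - b : ℝ) : ℂ)) - 1) := by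
    rw [mul_sub, ← Complex.exp_add, mul_one]; congr 2; push_cast; ring
  rw [h, norm_mul, norm_exp_I_mul_real, one_mul]
  exact Real.norm_exp_I_mul_ofReal_sub_one_le

theorem norm_dirKer_sub_le {l : ℝ} (hl : 0 ≤ l) (u v : ℝ) :
    ‖dirKer l u - dirKer l v‖ ≤ l ^ 2 * |u - v| := by
  unfold dirKer
  have hi : ∀ w : ℝ, IntervalIntegrable (fun ξ : ℝ => cexp (I * (ξ * w : ℝ))) volume (-l) l :=
    fun w => (by fun_prop : Continuous fun ξ : ℝ => cexp (I * (ξ * w : ℝ))).intervalIntegrable _ _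
  rw [← mul_sub, ← intervalIntegral.integral_sub (hi u) (hi v), norm_mul, norm_inv]
  have h1 : ‖∫ ξ in (-l)..l, (cexp (I * (ξ * u : ℝ)) - cexp (I * (ξ * v : ℝ)))‖
      ≤ (l * |u - v|) * |l - (-l)| := by
    refine intervalIntegral.norm_integral_le_of_norm_le_const fun ξ hξ => ?_
    refine (norm_exp_I_sub_le _ _).trans ?_
    rw [← mul_sub, abs_mul]
    gcongr
    rw [Set.uIoc_of_le (by linarith)] at hξ
    exact abs_le.2 ⟨hξ.1.le, hξ.2⟩
  have h2 : ‖(2 * π : ℂ)‖ = 2 * π := by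
    simp [abs_of_pos Real.pi_pos]
  rw [h2]
  rw [abs_of_nonneg (by linarith : (0:ℝ) ≤ l - -l)] at h1
  calc (2 * π)⁻¹ * _ ≤ (2 * π)⁻¹ * ((l * |u - v|) * (l - -l)) := by gcongr
    _ = (l ^ 2 * |u - v|) * π⁻¹ := by field_simp; ring
    _ ≤ (l ^ 2 * |u - v|) * 1 := by
      gcongr
      exact inv_le_one_of_one_le₀ (by linarith [Real.pi_gt_three])
    _ = _ := mul_one _

theorem continuous_dirKer {l : ℝ} (hl : 0 ≤ l) : Continuous (dirKer l) := by
  have : LipschitzWith (⟨l ^ 2, by positivity⟩ : NNReal) (dirKer l) :=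
    LipschitzWith.of_dist_le_mul fun u v => by
      rw [dist_eq_norm, Real.dist_eq]; exact norm_dirKer_sub_le hl u v
  exact this.continuous

open scoped FourierTransform in
theorem fourierInv_indicator_Icc {l : ℝ} (hl : 0 ≤ l) (u : ℝ) :
    𝓕⁻ (Set.indicator (Set.Icc (-(l / (2 * π))) (l / (2 * π))) (fun _ => (1 : ℂ))) u
      = dirKer l u := by
  rw [Real.fourierInv_eq']
  simp only [RCLike.inner_apply, conj_trivial, smul_eq_mul]
  have h : ∀ v : ℝ, cexp (↑(2 * π * (u * v)) * I) *
      (Set.Icc (-(l / (2 * π))) (l / (2 * π))).indicator (fun _ => (1 : ℂ)) v =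
      (Set.Icc (-(l / (2 * π))) (l / (2 * π))).indicator
        (fun v : ℝ => cexp (I * ((2 * π * v) * u : ℝ))) v := by
    intro v
    by_cases hv : v ∈ Set.Icc (-(l / (2 * π))) (l / (2 * π))
    · simp only [hv, Set.indicator_of_mem, mul_one]; congr 1; push_cast; ring
    · simp [hv]
  simp only [h]
  rw [integral_indicator measurableSet_Icc, integral_Icc_eq_integral_Ioc,
    ← intervalIntegral.integral_of_le (by
      have : 0 ≤ l / (2 * π) := by positivity
      linarith)]
  rw [intervalIntegral.integral_comp_mul_left (fun v : ℝ => cexp (I * (v * u : ℝ)))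
    (by positivity : (2 * π : ℝ) ≠ 0)]
  unfold dirKer
  have e1 : 2 * π * (l / (2 * π)) = l := by field_simp
  rw [mul_neg, e1, Complex.real_smul]
  push_cast; rfl

open scoped FourierTransform in
theorem fourierInv_indicator_Iic_exp {ε : ℝ} (hε : 0 < ε) (u : ℝ) :
    𝓕⁻ (Set.indicator (Set.Iic 0) (fun ξ : ℝ => 2 * π * I * cexp ((2 * π * ε : ℝ) * ξ))) u
      = 1 / ((u : ℂ) - I * ε) := by
  rw [Real.fourierInv_eq']
  simp only [RCLike.inner_apply, conj_trivial, smul_eq_mul]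
  have h : ∀ v : ℝ, cexp (↑(2 * π * (u * v)) * I) *
      (Set.Iic 0).indicator (fun ξ : ℝ => 2 * π * I * cexp ((2 * π * ε : ℝ) * ξ)) v =
      (Set.Iic (0:ℝ)).indicator
        (fun v : ℝ => 2 * π * I * cexp ((2 * π * (I * u + ε)) * v)) v := by
    intro v
    by_cases hv : v ∈ Set.Iic (0:ℝ)
    · simp only [hv, Set.indicator_of_mem]
      rw [mul_left_comm, ← Complex.exp_add]; congr 2; push_cast; ring
    · simp [hv]
  simp only [h]
  have hre : 0 < (2 * π * (I * u + ε) : ℂ).re := by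
    simp; positivity
  rw [integral_indicator measurableSet_Iic, integral_const_mul, integral_exp_mul_complex_Iic hre]
  have h0 : (I * u + ε : ℂ) ≠ 0 := by
    intro h0; rw [h0] at hre; simp at hre
  have h1 : (u - I * ε : ℂ) ≠ 0 := by
    intro h1; apply h0
    have : (I * u + ε : ℂ) = I * (u - I * ε) := by ring_nf; rw [I_sq]; ring
    rw [this, h1, mul_zero]
  have hp : (π : ℂ) ≠ 0 := by exact_mod_cast Real.pi_ne_zero
  simp only [ofReal_zero, mul_zero, Complex.exp_zero]
  field_simp
  ring_nf; rw [I_sq]; ring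

theorem lintegral_enorm_cauchyKer_conv_le {f : ℝ → ℂ} (hf : Integrable f) (hf2 : MemLp f 2)
    {ε : ℝ} (hε : 0 < ε) :
    ∫⁻ x : ℝ, ‖∫ y, f y * (1 / (((x - y : ℝ) : ℂ) - I * ε))‖ₑ ^ 2
      ≤ ENNReal.ofReal ((2 * π) ^ 2) * ∫⁻ x, ‖f x‖ₑ ^ 2 := by
  have key := lintegral_sum_enorm_multiplier_le (Finset.univ : Finset Unit) hf hf2
    (fun _ => Set.indicator (Set.Iic 0) (fun ξ : ℝ => 2 * π * I * cexp ((2 * π * ε : ℝ) * ξ)))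
    ?_ ((2 * π) ^ 2) ?_
  · simpa only [Finset.univ_unique, Finset.sum_singleton, fourierInv_indicator_Iic_exp hε] using key
  · intro _ _
    rw [integrable_indicator_iff measurableSet_Iic]
    have : IntegrableOn (fun ξ : ℝ => cexp ((2 * π * ε : ℝ) * ξ)) (Set.Iic 0) :=
      integrableOn_exp_mul_complex_Iic (by simp; positivity) 0
    exact this.const_mul _
  · intro ξ
    simp only [Finset.univ_unique, Finset.sum_singleton]
    gcongr
    by_cases hv : ξ ∈ Set.Iic (0:ℝ)
    · rw [Set.indicator_of_mem hv]
      simp only [norm_mul, Complex.norm_exp]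
      simp [abs_of_pos Real.pi_pos]
      have : 2 * π * ε * ξ ≤ 0 := mul_nonpos_of_nonneg_of_nonpos (by positivity) hv
      have h3 := Real.exp_le_one_iff.2 this
      nlinarith [Real.pi_pos]
    · rw [Set.indicator_of_notMem hv]; simp; positivity

/-- Quantitative lacunarity of the finite family `(lam j)_{j ∈ J}`. -/
structure LacBound {ι : Type*} (J : Finset ι) (lam : ι → ℝ) (N : ℝ) : Prop where
  one_le : 1 ≤ N
  pos : ∀ j, 0 < lam j
  low : ∀ R > 0, ∑ j ∈ J with lam j ≤ R, lam j ≤ N * R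
  high : ∀ R > 0, ∑ j ∈ J with R ≤ lam j, (lam j)⁻¹ ≤ N / R

theorem LacBound.mono {ι : Type*} {J J' : Finset ι} {lam : ι → ℝ} {N : ℝ} (h : LacBound J lam N)
    (hJ : J' ⊆ J) : LacBound J' lam N where
  one_le := h.one_le
  pos := h.pos
  low R hR := (Finset.sum_le_sum_of_subset_of_nonneg (Finset.filter_subset_filter _ hJ)
    fun j _ _ => (h.pos j).le).trans (h.low R hR)
  high R hR := (Finset.sum_le_sum_of_subset_of_nonneg (Finset.filter_subset_filter _ hJ)
    fun j _ _ => (inv_pos.2 (h.pos j)).le).trans (h.high R hR)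

theorem LacBound.scale {ι : Type*} {J : Finset ι} {lam : ι → ℝ} {N : ℝ} (h : LacBound J lam N)
    {r : ℝ} (hr : 0 < r) : LacBound J (fun j => lam j * r) N where
  one_le := h.one_le
  pos j := mul_pos (h.pos j) hr
  low R hR := by
    have := h.low (R / r) (by positivity)
    rw [← Finset.sum_mul]
    simp only [le_div_iff₀ hr] at this
    calc _ ≤ N * (R / r) * r := by gcongr
      _ = N * R := by field_simp
  high R hR := by
    have := h.high (R / r) (by positivity)
    simp only [mul_inv]
    rw [← Finset.sum_mul]
    simp only [div_le_iff₀ hr] at this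
    calc _ ≤ N / (R / r) * r⁻¹ := by gcongr
      _ = N / R := by field_simp

/-- One step of the Riesz product estimate: integration by parts against an oscillating factor. -/
theorem integral_riesz_step {Φ D : ℝ → ℝ} {K B : ℝ} (hΦ0 : ∀ y, 0 ≤ Φ y) (hΦB : ∀ y, Φ y ≤ B)
    (hD : ∀ y, HasDerivAt Φ (D y) y) (hDK : ∀ y, |D y| ≤ K * Φ y)
    (hDc : Continuous D) (hK : 0 ≤ K)
    {V v : ℝ → ℝ} {M : ℝ} (hV : ∀ y, HasDerivAt V (v y) y) (hVM : ∀ y, |V y| ≤ M)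
    {c : ℝ} (hv : ∀ y, |v y| ≤ c) (hvc : Continuous v) :
    ∫ y, (1 + y ^ 2)⁻¹ * (Φ y * (1 + v y + c ^ 2))
      ≤ (1 + c ^ 2 + M * (1 + K)) * ∫ y, (1 + y ^ 2)⁻¹ * Φ y := by
  have hΦc : Continuous Φ := continuous_iff_continuousAt.2 fun y => (hD y).continuousAt
  have hVc : Continuous V := continuous_iff_continuousAt.2 fun y => (hV y).continuousAt
  have hM : 0 ≤ M := (abs_nonneg _).trans (hVM 0)
  have hw : ∀ y : ℝ, HasDerivAt (fun y : ℝ => (1 + y ^ 2)⁻¹) (-(2 * y) / (1 + y ^ 2) ^ 2) y := by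
    intro y
    have h1 : HasDerivAt (fun y : ℝ => 1 + y ^ 2) (2 * y) y := by
      simpa using (hasDerivAt_pow 2 y).const_add 1
    exact h1.inv (by positivity)
  have hwi : Integrable (fun y : ℝ => (1 + y ^ 2)⁻¹) := integrable_inv_one_add_sq
  have hu : ∀ y, HasDerivAt (fun y => (1 + y ^ 2)⁻¹ * Φ y)
      (-(2 * y) / (1 + y ^ 2) ^ 2 * Φ y + (1 + y ^ 2)⁻¹ * D y) y := fun y => (hw y).mul (hD y)
  have hwΦ : Integrable (fun y : ℝ => (1 + y ^ 2)⁻¹ * Φ y) :=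
    hwi.mul_bdd (c := B) hΦc.aestronglyMeasurable (ae_of_all _ fun y => by
      rw [Real.norm_eq_abs, abs_of_nonneg (hΦ0 y)]; exact hΦB y)
  have hwd : ∀ y : ℝ, |-(2 * y) / (1 + y ^ 2) ^ 2| ≤ (1 + y ^ 2)⁻¹ := by
    intro y
    rw [abs_div, abs_neg, abs_of_pos (by positivity : 0 < (1 + y ^ 2) ^ 2),
        div_le_iff₀ (by positivity)]
    have : (1 + y ^ 2)⁻¹ * (1 + y ^ 2) ^ 2 = 1 + y ^ 2 := by field_simp
    rw [this, abs_mul, abs_two]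
    nlinarith [sq_nonneg (|y| - 1), sq_abs y]
  have hub : ∀ y, |-(2 * y) / (1 + y ^ 2) ^ 2 * Φ y + (1 + y ^ 2)⁻¹ * D y|
      ≤ (1 + K) * ((1 + y ^ 2)⁻¹ * Φ y) := by
    intro y
    refine (abs_add_le _ _).trans ?_
    rw [abs_mul, abs_mul, abs_of_nonneg (hΦ0 y), abs_of_pos (by positivity : 0 < (1 + y ^ 2)⁻¹)]
    have h1 := mul_le_mul_of_nonneg_right (hwd y) (hΦ0 y)
    have h2 := mul_le_mul_of_nonneg_left (hDK y) (by positivity : 0 ≤ (1 + y ^ 2)⁻¹)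
    linarith
  have hpc : Continuous fun y : ℝ => -(2 * y) / (1 + y ^ 2) ^ 2 * Φ y + (1 + y ^ 2)⁻¹ * D y := by
    have : ∀ y : ℝ, (1 + y ^ 2) ≠ 0 := fun y => by positivity
    have h2 : ∀ y : ℝ, (1 + y ^ 2) ^ 2 ≠ 0 := fun y => by positivity
    fun_prop (disch := assumption)
  have hu'i : Integrable (fun y : ℝ => -(2 * y) / (1 + y ^ 2) ^ 2 * Φ y + (1 + y ^ 2)⁻¹ * D y) :=
    (hwΦ.const_mul (1 + K)).mono' hpc.aestronglyMeasurable (ae_of_all _ hub)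
  have i1 : Integrable (fun y => ((1 + y ^ 2)⁻¹ * Φ y) * v y) :=
    hwΦ.mul_bdd (c := c) hvc.aestronglyMeasurable (ae_of_all _ hv)
  have i2 : Integrable (fun y : ℝ =>
      (-(2 * y) / (1 + y ^ 2) ^ 2 * Φ y + (1 + y ^ 2)⁻¹ * D y) * V y) :=
    hu'i.mul_bdd (c := M) hVc.aestronglyMeasurable (ae_of_all _ hVM)
  have i3 : Integrable (fun y => ((1 + y ^ 2)⁻¹ * Φ y) * V y) :=
    hwΦ.mul_bdd (c := M) hVc.aestronglyMeasurable (ae_of_all _ hVM)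
  have ibp := integral_mul_deriv_eq_deriv_mul_of_integrable (fun y _ => hu y)
      (fun y _ => hV y) i1 i2 i3
  have hbd : ∫ y, ((1 + y ^ 2)⁻¹ * Φ y) * v y ≤ M * (1 + K) * ∫ y, (1 + y ^ 2)⁻¹ * Φ y := by
    rw [ibp, ← integral_neg, ← integral_const_mul]
    refine integral_mono i2.neg (hwΦ.const_mul _) fun y => ?_
    refine (neg_le_abs _).trans ?_
    rw [abs_mul]
    have := mul_le_mul (hub y) (hVM y) (abs_nonneg _) (by have := hΦ0 y; positivity)
    linarith
  have e : ∀ y, (1 + y ^ 2)⁻¹ * (Φ y * (1 + v y + c ^ 2)) =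
      (1 + c ^ 2) * ((1 + y ^ 2)⁻¹ * Φ y) + ((1 + y ^ 2)⁻¹ * Φ y) * v y := fun y => by ring
  simp only [e]
  rw [integral_add (hwΦ.const_mul _) i1, integral_const_mul]
  linarith

theorem exists_riesz_majorant {ι : Type*} [DecidableEq ι] (J : Finset ι) (a : ι → ℂ) (θ : ι → ℝ)
    (hθ : ∀ j, 0 < |θ j|) :
    (∀ j ∈ J, ‖a j‖ ≤ 1) → ∃ Φ D : ℝ → ℝ, ∃ B : ℝ, (∀ y, 0 ≤ Φ y) ∧ (∀ y, Φ y ≤ B) ∧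
      (∀ y, HasDerivAt Φ (D y) y) ∧ (∀ y, |D y| ≤ (2 * ∑ i ∈ J, |θ i| * ‖a i‖) * Φ y) ∧
      Continuous D ∧ (∀ y : ℝ, Real.exp (∑ j ∈ J, (a j * cexp (I * (θ j * y : ℝ))).re) ≤ Φ y) ∧
      ∫ y, (1 + y ^ 2)⁻¹ * Φ y ≤ π * Real.exp (∑ j ∈ J, (‖a j‖ ^ 2 + ‖a j‖ / |θ j| *
        (1 + 2 * ∑ i ∈ J with |θ i| ≤ |θ j|, |θ i| * ‖a i‖))) := by
  induction J using Finset.induction_on_max_value (fun j => |θ j|) with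
  | empty =>
    intro _
    refine ⟨fun _ => 1, fun _ => 0, 1, by simp, by simp, fun y => hasDerivAt_const _ _, by simp,
      continuous_const, by simp, ?_⟩
    simp [integral_univ_inv_one_add_sq]
  | insert j J hj hmax ih =>
    intro ha
    obtain ⟨Φ, D, B, h0, hB, hD, hDK, hDc, hexp, hintg⟩ :=
      ih fun i hi => ha i (Finset.mem_insert_of_mem hi)
    set K := 2 * ∑ i ∈ J, |θ i| * ‖a i‖ with hK
    have hK0 : 0 ≤ K := by positivity
    set v : ℝ → ℝ := fun y => (a j * cexp (I * (θ j * y : ℝ))).re with hv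
    set V : ℝ → ℝ := fun y => (a j / (I * θ j) * cexp (I * (θ j * y : ℝ))).re with hV
    set c := ‖a j‖ with hc
    have hc1 : c ≤ 1 := ha j (Finset.mem_insert_self _ _)
    have hc0 : 0 ≤ c := norm_nonneg _
    have hθ0 : (θ j : ℂ) ≠ 0 := by
      have := abs_pos.1 (hθ j); exact_mod_cast this
    have hVv : ∀ y, HasDerivAt V (v y) y := by
      intro y
      have h1 : HasDerivAt (fun y : ℝ => (I * (θ j * y : ℝ) : ℂ)) (I * θ j) y := by
        have h2 := (Complex.ofRealCLM.hasDerivAt (x := y)).const_mul (I * θ j : ℂ)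
        simp at h2
        refine h2.congr_deriv rfl |>.congr_of_eventuallyEq ?_
        exact Eventually.of_forall fun z => by push_cast; ring
      have h2 := (h1.cexp.const_mul (a j / (I * θ j)))
      have h3 := Complex.reCLM.hasFDerivAt.comp_hasDerivAt y h2
      refine h3.congr_deriv ?_
      simp only [hv, Complex.reCLM_apply]
      congr 1
      have := I_ne_zero
      field_simp
    have hvb : ∀ y, |v y| ≤ c := fun y => by
      refine (Complex.abs_re_le_norm _).trans ?_
      rw [norm_mul, norm_exp_I_mul_real, mul_one]
    have hVb : ∀ y, |V y| ≤ c / |θ j| := fun y => by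
      refine (Complex.abs_re_le_norm _).trans ?_
      rw [norm_mul, norm_exp_I_mul_real, mul_one, norm_div, norm_mul, Complex.norm_I, one_mul,
        Complex.norm_real, Real.norm_eq_abs]
    have hvc : Continuous v := by fun_prop
    have hVb' : ∀ y, HasDerivAt v ((a j * (I * θ j) * cexp (I * (θ j * y : ℝ))).re) y := by
      intro y
      have h1 : HasDerivAt (fun y : ℝ => (I * (θ j * y : ℝ) : ℂ)) (I * θ j) y := by
        have h2 := (Complex.ofRealCLM.hasDerivAt (x := y)).const_mul (I * θ j : ℂ)
        simp at h2
        refine h2.congr_deriv rfl |>.congr_of_eventuallyEq ?_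
        exact Eventually.of_forall fun z => by push_cast; ring
      have h2 := (h1.cexp.const_mul (a j))
      have h3 := Complex.reCLM.hasFDerivAt.comp_hasDerivAt y h2
      refine h3.congr_deriv ?_
      simp only [Complex.reCLM_apply]
      congr 1
      ring
    set v' : ℝ → ℝ := fun y => (a j * (I * θ j) * cexp (I * (θ j * y : ℝ))).re with hv'
    have hv'b : ∀ y, |v' y| ≤ |θ j| * c := fun y => by
      refine (Complex.abs_re_le_norm _).trans ?_
      rw [norm_mul, norm_exp_I_mul_real, mul_one, norm_mul, norm_mul, Complex.norm_I, one_mul,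
        Complex.norm_real, Real.norm_eq_abs, mul_comm]
    have hv'c : Continuous v' := by fun_prop
    have hφ : ∀ y, 1 / 2 ≤ 1 + v y + c ^ 2 := fun y => by
      have := (abs_le.1 (hvb y)).1
      nlinarith [sq_nonneg (c - 1 / 2)]
    have hφ3 : ∀ y, 1 + v y + c ^ 2 ≤ 3 := fun y => by
      have := (abs_le.1 (hvb y)).2
      nlinarith
    have hΦc : Continuous Φ := continuous_iff_continuousAt.2 fun y => (hD y).continuousAt
    refine ⟨fun y => Φ y * (1 + v y + c ^ 2), fun y => D y * (1 + v y + c ^ 2) + Φ y * v' y, B * 3,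
      fun y => mul_nonneg (h0 y) (by linarith [hφ y]), fun y => ?_, fun y => ?_, fun y => ?_,
      by fun_prop, fun y => ?_, ?_⟩
    · exact mul_le_mul (hB y) (hφ3 y) (by linarith [hφ y]) ((h0 y).trans (hB y))
    · refine (hD y).mul ?_
      exact ((hVb' y).const_add 1).add_const _
    · rw [Finset.sum_insert hj]
      refine (abs_add_le _ _).trans ?_
      rw [abs_mul, abs_mul, abs_of_nonneg (h0 y), abs_of_nonneg (by linarith [hφ y] : 0 ≤
          1 + v y + c ^ 2)]
      have e1 := mul_le_mul_of_nonneg_right (hDK y) (by linarith [hφ y] : 0 ≤ 1 + v y + c ^ 2)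
      have e2 := mul_le_mul_of_nonneg_left (hv'b y) (h0 y)
      have e3 : Φ y * (|θ j| * c) ≤ Φ y * (|θ j| * c) * (2 * (1 + v y + c ^ 2)) := by
        refine le_mul_of_one_le_right (mul_nonneg (h0 y) (by positivity)) (by linarith [hφ y])
      calc _ ≤ K * Φ y * (1 + v y + c ^ 2) + Φ y * (|θ j| * c) * (2 *
          (1 + v y + c ^ 2)) := by linarith
        _ = _ := by rw [hK]; ring
    · rw [Finset.sum_insert hj, add_comm, Real.exp_add]
      refine mul_le_mul (hexp y) ?_ (Real.exp_nonneg _) (h0 y)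
      have h1 := Real.abs_exp_sub_one_sub_id_le ((hvb y).trans hc1)
      have h2 := (abs_le.1 h1).2
      have h3 : v y ^ 2 ≤ c ^ 2 := sq_le_sq' (by linarith [(abs_le.1 (hvb y)).1])
          (abs_le.1 (hvb y)).2
      change Real.exp (v y) ≤ _
      linarith
    · have step := integral_riesz_step h0 hB hD hDK hDc hK0 hVv hVb hvb hvc
      have hI0 : 0 ≤ ∫ y, (1 + y ^ 2)⁻¹ * Φ y := integral_nonneg fun y => by
        have := h0 y; positivity
      refine step.trans ?_
      have hx : 1 + c ^ 2 + c / |θ j| * (1 + K) ≤ Real.exp (c ^ 2 + c / |θ j| * (1 + K)) := by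
        have := Real.add_one_le_exp (c ^ 2 + c / |θ j| * (1 + K)); linarith
      refine (mul_le_mul hx hintg hI0 (Real.exp_nonneg _)).trans ?_
      rw [mul_left_comm, ← Real.exp_add]
      gcongr
      rw [Finset.sum_insert hj]
      have hfil : K ≤ 2 * ∑ i ∈ insert j J with |θ i| ≤ |θ j|, |θ i| * ‖a i‖ := by
        rw [hK]
        gcongr
        intro i hi
        exact Finset.mem_filter.2 ⟨Finset.mem_insert_of_mem hi, hmax i hi⟩
      gcongr
      exact Finset.subset_insert _ _

theorem riesz_exponent_le {ι : Type*} {J : Finset ι} {a : ι → ℂ} {θ : ι → ℝ} {N : ℝ}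
    (h : LacBound J (fun j => |θ j|) N) (hθ : ∀ j ∈ J, 1 ≤ |θ j|) :
    ∑ j ∈ J, (‖a j‖ ^ 2 + ‖a j‖ / |θ j| *
        (1 + 2 * ∑ i ∈ J with |θ i| ≤ |θ j|, |θ i| * ‖a i‖)) ≤ 5 * N * ∑ j ∈ J, ‖a j‖ ^ 2 + 1 := by
  have hN := h.one_le
  have hN0 : 0 < N := by linarith
  have hA : 0 ≤ ∑ j ∈ J, ‖a j‖ ^ 2 := by positivity
  have h1 : ∑ j ∈ J, ‖a j‖ / |θ j| ≤ N * ∑ j ∈ J, ‖a j‖ ^ 2 + 1 := by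
    have hh := h.high 1 one_pos
    rw [Finset.filter_true_of_mem hθ, div_one] at hh
    have : ∀ j ∈ J, ‖a j‖ / |θ j| ≤ N * ‖a j‖ ^ 2 + N⁻¹ * |θ j|⁻¹ := by
      intro j hj
      have h2 := hθ j hj
      have h3 : |θ j|⁻¹ ≤ 1 := inv_le_one_of_one_le₀ h2
      have h4 : 0 < |θ j|⁻¹ := by positivity
      rw [div_eq_mul_inv]
      set t := |θ j|⁻¹
      have h5 : t * t ≤ t := by nlinarith
      have h6 : N⁻¹ * t ^ 2 ≤ N⁻¹ * t := by
        gcongr; nlinarith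
      have h7 : 0 ≤ N⁻¹ * (N * ‖a j‖ - t) ^ 2 := by positivity
      have h8 : N⁻¹ * (N * ‖a j‖ - t) ^ 2 = N * ‖a j‖ ^ 2 - 2 * (‖a j‖ * t) + N⁻¹ * t ^ 2 := by
        field_simp; ring
      have h9 : 0 ≤ ‖a j‖ * t := by positivity
      linarith
    refine (Finset.sum_le_sum this).trans ?_
    rw [Finset.sum_add_distrib, ← Finset.mul_sum, ← Finset.mul_sum]
    have : N⁻¹ * ∑ j ∈ J, |θ j|⁻¹ ≤ N⁻¹ * N := by gcongr
    rw [inv_mul_cancel₀ hN0.ne'] at this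
    linarith
  have h2 : ∑ j ∈ J, ‖a j‖ / |θ j| * ∑ i ∈ J with |θ i| ≤ |θ j|, |θ i| * ‖a i‖
      ≤ N * ∑ j ∈ J, ‖a j‖ ^ 2 := by
    have : ∀ j ∈ J, ‖a j‖ / |θ j| * ∑ i ∈ J with |θ i| ≤ |θ j|, |θ i| * ‖a i‖ ≤
        (∑ i ∈ J with |θ i| ≤ |θ j|, |θ i| * (‖a i‖ ^ 2 / |θ j| / 2)) + N * ‖a j‖ ^ 2 / 2 := by
      intro j hj
      have hj0 := h.pos j
      have hl := h.low |θ j| hj0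
      have e : N * ‖a j‖ ^ 2 / 2 = (‖a j‖ ^ 2 / |θ j| / 2) * (N * |θ j|) := by field_simp
      rw [e]
      refine le_trans ?_ (add_le_add_right (mul_le_mul_of_nonneg_left hl (by positivity)) _)
      rw [Finset.mul_sum, Finset.mul_sum, ← Finset.sum_add_distrib]
      refine Finset.sum_le_sum fun i _ => ?_
      have : |θ i| * (‖a i‖ ^ 2 / |θ j| / 2) + ‖a j‖ ^ 2 / |θ j| / 2 * |θ i| -
        ‖a j‖ / |θ j| * (|θ i| * ‖a i‖) = |θ i| / |θ j| / 2 * (‖a i‖ - ‖a j‖) ^ 2 := by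
        field_simp; ring
      have h3 : 0 ≤ |θ i| / |θ j| / 2 * (‖a i‖ - ‖a j‖) ^ 2 := by positivity
      linarith
    refine (Finset.sum_le_sum this).trans ?_
    rw [Finset.sum_add_distrib, ← Finset.sum_div, ← Finset.mul_sum]
    have h3 : ∑ j ∈ J, ∑ i ∈ J with |θ i| ≤ |θ j|, |θ i| * (‖a i‖ ^ 2 / |θ j| / 2)
        ≤ ∑ i ∈ J, N * ‖a i‖ ^ 2 / 2 := by
      simp only [Finset.sum_filter]
      rw [Finset.sum_comm]
      refine Finset.sum_le_sum fun i _ => ?_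
      rw [← Finset.sum_filter]
      have hi0 := h.pos i
      have := mul_le_mul_of_nonneg_left (h.high |θ i| hi0)
        (by positivity : 0 ≤ |θ i| * ‖a i‖ ^ 2 / 2)
      have e : |θ i| * ‖a i‖ ^ 2 / 2 * (N / |θ i|) = N * ‖a i‖ ^ 2 / 2 := by field_simp
      rw [e, Finset.mul_sum] at this
      refine le_trans (le_of_eq ?_) this
      refine Finset.sum_congr rfl fun k _ => ?_
      ring
    rw [← Finset.sum_div, ← Finset.mul_sum] at h3
    linarith
  have e : ∑ j ∈ J, (‖a j‖ ^ 2 + ‖a j‖ / |θ j| *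
        (1 + 2 * ∑ i ∈ J with |θ i| ≤ |θ j|, |θ i| * ‖a i‖)) =
      ∑ j ∈ J, ‖a j‖ ^ 2 + ∑ j ∈ J, ‖a j‖ / |θ j| +
        2 * ∑ j ∈ J, ‖a j‖ / |θ j| * ∑ i ∈ J with |θ i| ≤ |θ j|, |θ i| * ‖a i‖ := by
    rw [Finset.mul_sum, ← Finset.sum_add_distrib, ← Finset.sum_add_distrib]
    refine Finset.sum_congr rfl fun j _ => ?_
    ring
  rw [e]
  nlinarith

/-- A lacunary trigonometric polynomial. -/
def trigPoly {ι : Type*} (J : Finset ι) (a : ι → ℂ) (θ : ι → ℝ) (y : ℝ) : ℂ :=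
  ∑ j ∈ J, a j * cexp (I * (θ j * y : ℝ))

theorem continuous_trigPoly {ι : Type*} (J : Finset ι) (a : ι → ℂ) (θ : ι → ℝ) :
    Continuous (trigPoly J a θ) := by
  unfold trigPoly; fun_prop

theorem norm_trigPoly_le {ι : Type*} (J : Finset ι) (a : ι → ℂ) (θ : ι → ℝ) (y : ℝ) :
    ‖trigPoly J a θ y‖ ≤ ∑ j ∈ J, ‖a j‖ := by
  refine (norm_sum_le _ _).trans (Finset.sum_le_sum fun j _ => ?_)
  rw [norm_mul, norm_exp_I_mul_real, mul_one]

theorem integrable_inv_one_add_sq_mul {g : ℝ → ℝ} (hg : Continuous g) {B : ℝ}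
    (hB : ∀ y, |g y| ≤ B) : Integrable (fun y : ℝ => (1 + y ^ 2)⁻¹ * g y) :=
  integrable_inv_one_add_sq.mul_bdd (c := B) hg.aestronglyMeasurable (ae_of_all _ hB)

theorem integral_exp_re_trigPoly_le {ι : Type*} {J : Finset ι} (a : ι → ℂ) {θ : ι → ℝ} {N : ℝ}
    (h : LacBound J (fun j => |θ j|) N) (hθ : ∀ j ∈ J, 1 ≤ |θ j|) :
    ∫ y, (1 + y ^ 2)⁻¹ * Real.exp ((trigPoly J a θ y).re) ≤
      π * Real.exp (5 * N * ∑ j ∈ J, ‖a j‖ ^ 2 + 1) := by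
  classical
  set J1 := J.filter fun j => ‖a j‖ ≤ 1
  obtain ⟨Φ, D, B, h0, hB, hD, -, -, hexp, hintg⟩ :=
    exists_riesz_majorant J1 a θ h.pos fun j hj => (Finset.mem_filter.1 hj).2
  have hE := riesz_exponent_le (a := a) (h.mono (Finset.filter_subset _ J : J1 ⊆ J))
    (fun j hj => hθ j (Finset.mem_filter.1 hj).1)
  have hΦc : Continuous Φ := continuous_iff_continuousAt.2 fun y => (hD y).continuousAt
  have hA2 : ∀ y, (trigPoly J a θ y).re ≤ (∑ j ∈ J1, (a j * cexp (I * (θ j * y : ℝ))).re) +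
      ∑ j ∈ J with ¬ ‖a j‖ ≤ 1, ‖a j‖ ^ 2 := by
    intro y
    unfold trigPoly
    rw [Complex.re_sum, ← Finset.sum_filter_add_sum_filter_not J (fun j => ‖a j‖ ≤ 1)]
    refine add_le_add_right (Finset.sum_le_sum fun j hj => ?_) _
    have h1 := (Finset.mem_filter.1 hj).2
    refine (Complex.re_le_norm _).trans ?_
    rw [norm_mul, norm_exp_I_mul_real, mul_one]
    nlinarith
  set A2 := ∑ j ∈ J with ¬ ‖a j‖ ≤ 1, ‖a j‖ ^ 2 with hA2def
  have hA20 : 0 ≤ A2 := by positivity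
  have hb : ∀ y, |Real.exp ((trigPoly J a θ y).re)| ≤ Real.exp (∑ j ∈ J, ‖a j‖) := fun y => by
    rw [abs_of_pos (Real.exp_pos _)]
    exact Real.exp_le_exp.2 ((Complex.re_le_norm _).trans (norm_trigPoly_le _ _ _ _))
  have hle : ∫ y, (1 + y ^ 2)⁻¹ * Real.exp ((trigPoly J a θ y).re) ≤
      Real.exp A2 * ∫ y, (1 + y ^ 2)⁻¹ * Φ y := by
    rw [← integral_const_mul]
    refine integral_mono (integrable_inv_one_add_sq_mul
      (Real.continuous_exp.comp (Complex.continuous_re.comp (continuous_trigPoly J a θ))) hb)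
      ((integrable_inv_one_add_sq_mul hΦc (B := B) fun y => by
        rw [abs_of_nonneg (h0 y)]; exact hB y).const_mul _) fun y => ?_
    have : Real.exp ((trigPoly J a θ y).re) ≤ Real.exp A2 * Φ y := by
      refine (Real.exp_le_exp.2 (hA2 y)).trans ?_
      rw [Real.exp_add, mul_comm]
      gcongr
      exact hexp y
    have h3 := mul_le_mul_of_nonneg_left this (by positivity : 0 ≤ (1 + y ^ 2)⁻¹)
    simp only
    linarith
  refine hle.trans ((mul_le_mul_of_nonneg_left (hintg.trans
    (mul_le_mul_of_nonneg_left (Real.exp_le_exp.2 hE) Real.pi_pos.le))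
        (Real.exp_nonneg _)).trans ?_)
  rw [mul_left_comm, ← Real.exp_add]
  refine mul_le_mul_of_nonneg_left (Real.exp_le_exp.2 ?_) Real.pi_pos.le
  rw [← Finset.sum_filter_add_sum_filter_not J (fun j => ‖a j‖ ≤ 1)]
  rw [← hA2def]
  have h1 := h.one_le
  have h2 : 0 ≤ 5 * N * ∑ j ∈ J with ‖a j‖ ≤ 1, ‖a j‖ ^ 2 := by positivity
  have h3 : 0 ≤ (N - 1) * A2 := mul_nonneg (by linarith) hA20
  linarith

theorem integral_exp_norm_trigPoly_le {ι : Type*} {J : Finset ι} (a : ι → ℂ) {θ : ι → ℝ} {N : ℝ}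
    (h : LacBound J (fun j => |θ j|) N) (hθ : ∀ j ∈ J, 1 ≤ |θ j|) :
    ∫ y, (1 + y ^ 2)⁻¹ * Real.exp ‖trigPoly J a θ y‖ ≤
      2 * π * Real.exp (20 * N * ∑ j ∈ J, ‖a j‖ ^ 2 + 1) := by
  have hmul : ∀ (u : ℂ) (y : ℝ), trigPoly J (fun j => u * a j) θ y = u * trigPoly J a θ y := by
    intro u y; unfold trigPoly; rw [Finset.mul_sum]; simp only [mul_assoc]
  have key : ∀ u : ℂ, ‖u‖ = 2 → ∫ y, (1 + y ^ 2)⁻¹ * Real.exp ((u * trigPoly J a θ y).re) ≤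
      π * Real.exp (20 * N * ∑ j ∈ J, ‖a j‖ ^ 2 + 1) := by
    intro u hu
    have := integral_exp_re_trigPoly_le (fun j => u * a j) h hθ
    simp only [hmul, norm_mul, hu, mul_pow, ← Finset.mul_sum] at this
    refine this.trans (le_of_eq ?_)
    ring_nf
  have hintg : ∀ u : ℂ, ‖u‖ = 2 →
      Integrable fun y : ℝ => (1 + y ^ 2)⁻¹ * Real.exp ((u * trigPoly J a θ y).re) := by
    intro u hu
    refine integrable_inv_one_add_sq_mul (B := Real.exp (2 * ∑ j ∈ J, ‖a j‖)) ?_ fun y => ?_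
    · have := continuous_trigPoly J a θ; fun_prop
    · rw [abs_of_pos (Real.exp_pos _)]
      refine Real.exp_le_exp.2 ((Complex.re_le_norm _).trans ?_)
      rw [norm_mul, hu]
      gcongr
      exact norm_trigPoly_le _ _ _ _
  have hpt : ∀ z : ℂ, Real.exp ‖z‖ ≤ (1 / 2) * (Real.exp ((2 * z).re) + Real.exp ((-2 * z).re) +
      Real.exp ((2 * I * z).re) + Real.exp ((-2 * I * z).re)) := by
    intro z
    have h1 := Complex.norm_le_abs_re_add_abs_im z
    have e1 : (2 * z).re = 2 * z.re := by simp
    have e2 : (-2 * z).re = -(2 * z.re) := by simp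
    have e3 : (2 * I * z).re = -(2 * z.im) := by simp
    have e4 : (-2 * I * z).re = 2 * z.im := by simp
    have hab : ∀ t : ℝ, Real.exp (2 * |t|) ≤ Real.exp (2 * t) + Real.exp (-(2 * t)) := by
      intro t
      rcases abs_cases t with ⟨h, _⟩ | ⟨h, _⟩ <;> rw [h]
      · linarith [Real.exp_pos (-(2 * t))]
      · rw [mul_neg]; linarith [Real.exp_pos (2 * t)]
    have h2 : Real.exp ‖z‖ ≤ Real.exp |z.re| * Real.exp |z.im| := by
      rw [← Real.exp_add]; exact Real.exp_le_exp.2 h1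
    have h3 : ∀ t : ℝ, Real.exp (2 * t) = Real.exp t ^ 2 := fun t => by
      rw [← Real.exp_nat_mul]; norm_num
    have h4 := hab z.re
    have h5 := hab z.im
    rw [h3] at h4 h5
    rw [e1, e2, e3, e4]
    nlinarith [sq_nonneg (Real.exp |z.re| - Real.exp |z.im|), h3 z.re, h3 z.im]
  have n2 : ‖(2 : ℂ)‖ = 2 := by simp
  have n3 : ‖(-2 : ℂ)‖ = 2 := by simp
  have n4 : ‖(2 * I : ℂ)‖ = 2 := by simp
  have n5 : ‖(-2 * I : ℂ)‖ = 2 := by simp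
  have i1 := hintg _ n2
  have i2 := hintg _ n3
  have i3 := hintg _ n4
  have i4 := hintg _ n5
  have hle : ∫ y, (1 + y ^ 2)⁻¹ * Real.exp ‖trigPoly J a θ y‖ ≤
      ∫ y, (1 / 2) * (((((1 + y ^ 2)⁻¹ * Real.exp ((2 * trigPoly J a θ y).re)) +
        (1 + y ^ 2)⁻¹ * Real.exp ((-2 * trigPoly J a θ y).re)) +
        (1 + y ^ 2)⁻¹ * Real.exp ((2 * I * trigPoly J a θ y).re)) +
        (1 + y ^ 2)⁻¹ * Real.exp ((-2 * I * trigPoly J a θ y).re)) := by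
    refine integral_mono_of_nonneg (ae_of_all _ fun y => by positivity)
      ((((i1.add i2).add i3).add i4).const_mul _) (ae_of_all _ fun y => ?_)
    have := mul_le_mul_of_nonneg_left (hpt (trigPoly J a θ y)) (by positivity : 0 ≤ (1 + y ^ 2)⁻¹)
    simp only
    linarith
  refine hle.trans ?_
  have i12 : Integrable fun y : ℝ => (1 + y ^ 2)⁻¹ * Real.exp ((2 * trigPoly J a θ y).re) +
        (1 + y ^ 2)⁻¹ * Real.exp ((-2 * trigPoly J a θ y).re) := i1.add i2
  have i123 : Integrable fun y : ℝ => (1 + y ^ 2)⁻¹ * Real.exp ((2 * trigPoly J a θ y).re) +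
        (1 + y ^ 2)⁻¹ * Real.exp ((-2 * trigPoly J a θ y).re) +
        (1 + y ^ 2)⁻¹ * Real.exp ((2 * I * trigPoly J a θ y).re) := i12.add i3
  rw [integral_const_mul, integral_add i123 i4, integral_add i12 i3, integral_add i1 i2]
  have := key _ n2
  have := key _ n3
  have := key _ n4
  have := key _ n5
  linarith

theorem integral_norm_trigPoly_rpow_le {ι : Type*} {J : Finset ι} (a : ι → ℂ) {θ : ι → ℝ} {N : ℝ}
    (h : LacBound J (fun j => |θ j|) N) (hθ : ∀ j ∈ J, 1 ≤ |θ j|) {q : ℝ} (hq : 1 ≤ q) :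
    ∫ y in Set.Icc (-1 : ℝ) 1, ‖trigPoly J a θ y‖ ^ q ≤
      (Real.exp 25 * √(q * N * ∑ j ∈ J, ‖a j‖ ^ 2)) ^ q := by
  have hN := h.one_le
  set A := ∑ j ∈ J, ‖a j‖ ^ 2 with hA
  have hA0 : 0 ≤ A := by positivity
  rcases hA0.eq_or_lt with h0 | hApos
  · have : ∀ y, trigPoly J a θ y = 0 := by
      intro y
      refine Finset.sum_eq_zero fun j hj => ?_
      have := (Finset.sum_eq_zero_iff_of_nonneg (fun j _ => by positivity)).1 (hA ▸ h0.symm) j hj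
      have h2 : a j = 0 := by simpa using this
      rw [h2, zero_mul]
    simp only [this, norm_zero, Real.zero_rpow (by linarith : q ≠ 0), integral_zero]
    positivity
  set τ := √(q / (N * A)) with hτ
  have hτ0 : 0 < τ := Real.sqrt_pos.2 (by positivity)
  have hmul : ∀ y, trigPoly J (fun j => τ * a j) θ y = τ * trigPoly J a θ y := by
    intro y; unfold trigPoly; rw [Finset.mul_sum]; simp only [mul_assoc]
  have h1 := integral_exp_norm_trigPoly_le (fun j => (τ : ℂ) * a j) h hθ
  have hnτ : ‖(τ : ℂ)‖ = τ := by rw [Complex.norm_real, Real.norm_eq_abs, abs_of_pos hτ0]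
  have e1 : 20 * N * ∑ j ∈ J, ‖(τ : ℂ) * a j‖ ^ 2 + 1 = 20 * q + 1 := by
    simp only [norm_mul, mul_pow, hnτ, ← Finset.mul_sum]
    rw [hτ, Real.sq_sqrt (by positivity), ← hA]
    field_simp
  rw [e1] at h1
  simp only [hmul, norm_mul, hnτ] at h1
  have hcont := (continuous_trigPoly J a θ).norm
  have hintg : Integrable fun y : ℝ => (1 + y ^ 2)⁻¹ * Real.exp (τ * ‖trigPoly J a θ y‖) :=
    integrable_inv_one_add_sq_mul (B := Real.exp (τ * ∑ j ∈ J, ‖a j‖)) (by fun_prop) fun y => by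
      rw [abs_of_pos (Real.exp_pos _)]
      refine Real.exp_le_exp.2 ?_
      gcongr
      exact norm_trigPoly_le _ _ _ _
  have hpt : ∀ t : ℝ, 0 ≤ t → t ^ q ≤ (q ^ q * Real.exp (-q)) * Real.exp t := by
    intro t ht
    have h2 : t / q ≤ Real.exp (t / q - 1) := by
      have := Real.add_one_le_exp (t / q - 1); linarith
    have h3 := Real.rpow_le_rpow (by positivity) h2 (by linarith : 0 ≤ q)
    rw [Real.div_rpow ht (by linarith), ← Real.exp_mul, div_le_iff₀ (by positivity)] at h3
    refine h3.trans (le_of_eq ?_)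
    rw [mul_assoc, ← Real.exp_add, mul_comm]
    congr 2
    field_simp
    ring
  have hcq : Continuous fun y => ‖trigPoly J a θ y‖ ^ q :=
    hcont.rpow_const fun y => Or.inr (by linarith)
  have h4 : τ ^ q * ∫ y in Set.Icc (-1 : ℝ) 1, ‖trigPoly J a θ y‖ ^ q ≤
      ∫ y in Set.Icc (-1 : ℝ) 1, (q ^ q * Real.exp (-q) * 2) *
        ((1 + y ^ 2)⁻¹ * Real.exp (τ * ‖trigPoly J a θ y‖)) := by
    rw [← integral_const_mul]
    refine setIntegral_mono_on ((hcq.const_mul _ |>.continuousOn).integrableOn_compact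
        isCompact_Icc)
      (hintg.const_mul _).integrableOn measurableSet_Icc fun y hy => ?_
    rw [← Real.mul_rpow hτ0.le (norm_nonneg _)]
    refine (hpt _ (by positivity)).trans ?_
    have h5 : 1 ≤ 2 * (1 + y ^ 2)⁻¹ := by
      have : y ^ 2 ≤ 1 := by nlinarith [hy.1, hy.2]
      rw [← div_eq_mul_inv, le_div_iff₀ (by positivity)]; linarith
    have h6 : 0 ≤ q ^ q * Real.exp (-q) * Real.exp (τ * ‖trigPoly J a θ y‖) := by positivity
    nlinarith [mul_le_mul_of_nonneg_left h5 h6]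
  have h7 : ∫ y in Set.Icc (-1 : ℝ) 1, (q ^ q * Real.exp (-q) * 2) *
        ((1 + y ^ 2)⁻¹ * Real.exp (τ * ‖trigPoly J a θ y‖)) ≤
        (q ^ q * Real.exp (-q) * 2) * (2 * π * Real.exp (20 * q + 1)) := by
    rw [integral_const_mul]
    refine mul_le_mul_of_nonneg_left ?_ (by positivity)
    exact (setIntegral_le_integral hintg (ae_of_all _ fun y => by positivity)).trans h1
  have h8 : (q ^ q * Real.exp (-q) * 2) * (2 * π * Real.exp (20 * q + 1)) ≤
      (Real.exp 25 * q) ^ q := by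
    rw [Real.mul_rpow (Real.exp_nonneg _) (by linarith), ← Real.exp_mul]
    have h9 : 4 * π ≤ Real.exp 4 := by
      have := Real.add_one_le_exp 1
      have h10 : Real.exp 4 = Real.exp 1 ^ 4 := by rw [← Real.exp_nat_mul]; norm_num
      have h11 : (2:ℝ) ^ 4 ≤ Real.exp 1 ^ 4 := by gcongr; linarith
      rw [h10]; linarith [Real.pi_lt_four]
    have h10 : Real.exp (-q) * (Real.exp 4 * Real.exp (20 * q + 1)) ≤ Real.exp (25 * q) := by
      rw [← Real.exp_add, ← Real.exp_add]
      exact Real.exp_le_exp.2 (by linarith)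
    have h11 : Real.exp (-q) * (4 * π * Real.exp (20 * q + 1)) ≤ Real.exp (25 * q) := by
      refine le_trans ?_ h10
      gcongr
    have h12 := mul_le_mul_of_nonneg_left h11 (by positivity : 0 ≤ q ^ q)
    linarith
  have h9 := h4.trans (h7.trans h8)
  rw [← le_div_iff₀' (by positivity), ← Real.div_rpow (by positivity) hτ0.le] at h9
  refine h9.trans (le_of_eq ?_)
  congr 1
  rw [hτ, mul_div_assoc]
  congr 1
  rw [Real.sqrt_div (by linarith)]
  have h13 : q = √q * √q := (Real.mul_self_sqrt (by linarith)).symm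
  rw [mul_assoc, Real.sqrt_mul (by linarith : 0 ≤ q)]
  have h14 : 0 < √q := Real.sqrt_pos.2 (by linarith)
  have h15 : 0 < √(N * A) := Real.sqrt_pos.2 (by positivity)
  rw [div_div_eq_mul_div, div_eq_iff h14.ne']
  nlinarith

/-- Dual form of Zygmund's inequality on the unit interval. -/
theorem sum_sq_norm_coeff_le {ι : Type*} {J : Finset ι} {θ : ι → ℝ} {N : ℝ}
    (h : LacBound J (fun j => |θ j|) N) (hθ : ∀ j ∈ J, 1 ≤ |θ j|) {s : ℝ} (hs : 1 < s) (hs2 : s < 2)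
    {b : ℝ → ℂ} (hb : MemLp b (ENNReal.ofReal s) (volume.restrict (Set.Icc (-1) 1)))
    {β : ℝ} (hβ : 0 ≤ β) (hbβ : ∫ y in Set.Icc (-1 : ℝ) 1, ‖b y‖ ^ s ≤ β ^ s) :
    ∑ j ∈ J, ‖∫ y in Set.Icc (-1 : ℝ) 1, b y * cexp (I * (θ j * y : ℝ))‖ ^ 2 ≤
      2 * Real.exp 50 * (N / (s - 1)) * β ^ 2 := by
  have hN := h.one_le
  set μ := (volume : Measure ℝ).restrict (Set.Icc (-1 : ℝ) 1) with hμ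
  have : IsFiniteMeasure μ := ⟨by simp [hμ]⟩
  set B : ι → ℂ := fun j => ∫ y, b y * cexp (I * (θ j * y : ℝ)) ∂μ with hB
  set a : ι → ℂ := fun j => (starRingEnd ℂ) (B j) with ha
  set S := ∑ j ∈ J, ‖B j‖ ^ 2 with hS
  have hS0 : 0 ≤ S := by positivity
  have hna : ∑ j ∈ J, ‖a j‖ ^ 2 = S := by simp [ha, hS]
  have hb1 : Integrable b μ := hb.integrable (by simpa using hs.le)
  have hc := continuous_trigPoly J a θ
  have hSe : (S : ℂ) = ∫ y, b y * trigPoly J a θ y ∂μ := by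
    unfold trigPoly
    simp only [Finset.mul_sum]
    rw [integral_finsetSum]
    · rw [hS, Complex.ofReal_sum]
      refine Finset.sum_congr rfl fun j _ => ?_
      rw [Complex.ofReal_pow, ← Complex.conj_mul', ← integral_const_mul]
      refine integral_congr_ae (ae_of_all _ fun y => ?_)
      exact mul_left_comm (a j) (b y) (cexp (I * (θ j * y : ℝ)))
    · intro j _
      refine hb1.mul_bdd (c := ‖a j‖) (by fun_prop) (ae_of_all _ fun y => ?_)
      rw [norm_mul, norm_exp_I_mul_real, mul_one]
  set q := s / (s - 1) with hq
  have hs1 : 0 < s - 1 := by linarith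
  have hsq : s.HolderConjugate q := (Real.HolderConjugate.conjExponent hs)
  have hq1 : 1 ≤ q := by rw [hq, le_div_iff₀ hs1]; linarith
  have hF : MemLp (trigPoly J a θ) (ENNReal.ofReal q) μ :=
    MemLp.of_bound hc.aestronglyMeasurable _ (ae_of_all _ fun y => norm_trigPoly_le _ _ _ y)
  have hH := integral_mul_norm_le_Lp_mul_Lq hsq hb hF
  have h1 : S ≤ ∫ y, ‖b y‖ * ‖trigPoly J a θ y‖ ∂μ := by
    have : S = ‖(S : ℂ)‖ := by rw [Complex.norm_real, Real.norm_eq_abs, abs_of_nonneg hS0]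
    rw [this, hSe]
    refine (norm_integral_le_integral_norm _).trans (le_of_eq ?_)
    simp only [norm_mul]
  have h2 := integral_norm_trigPoly_rpow_le a h hθ hq1
  rw [hna] at h2
  have h3 : (∫ y, ‖b y‖ ^ s ∂μ) ^ (1 / s) ≤ β := by
    refine (Real.rpow_le_rpow (by positivity) hbβ (by positivity)).trans (le_of_eq ?_)
    rw [← Real.rpow_mul hβ, mul_one_div_cancel (by linarith), Real.rpow_one]
  have h4 : (∫ y, ‖trigPoly J a θ y‖ ^ q ∂μ) ^ (1 / q) ≤ Real.exp 25 * √(q * N * S) := by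
    refine (Real.rpow_le_rpow (by positivity) h2 (by positivity)).trans (le_of_eq ?_)
    rw [← Real.rpow_mul (by positivity), mul_one_div_cancel (by linarith), Real.rpow_one]
  have h5 : S ≤ β * (Real.exp 25 * √(q * N * S)) :=
    h1.trans (hH.trans (mul_le_mul h3 h4 (by positivity) hβ))
  have h6 : S ^ 2 ≤ β ^ 2 * (Real.exp 50 * (q * N * S)) := by
    have := pow_le_pow_left₀ hS0 h5 2
    rw [mul_pow, mul_pow, Real.sq_sqrt (by positivity), ← Real.exp_nat_mul] at this
    norm_num at this
    exact this
  have h7 : S ≤ β ^ 2 * (Real.exp 50 * (q * N)) := by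
    rcases hS0.eq_or_lt with h0 | h0
    · rw [← h0]; positivity
    · refine le_of_mul_le_mul_right ?_ h0
      calc S * S = S ^ 2 := by ring
        _ ≤ _ := h6
        _ = _ := by ring
  have h8 : q ≤ 2 / (s - 1) := by rw [hq]; gcongr
  calc S ≤ β ^ 2 * (Real.exp 50 * (q * N)) := h7
    _ ≤ β ^ 2 * (Real.exp 50 * (2 / (s - 1) * N)) := by gcongr
    _ = _ := by ring

theorem setIntegral_Icc_comp_affine {E : Type*} [NormedAddCommGroup E] [NormedSpace ℝ E]
    (g : ℝ → E) (c : ℝ) {r : ℝ} (hr : 0 < r) :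
    ∫ u in Set.Icc (-1 : ℝ) 1, g (c + r * u) = r⁻¹ • ∫ y in Set.Icc (c - r) (c + r), g y := by
  rw [integral_Icc_eq_integral_Ioc, integral_Icc_eq_integral_Ioc,
    ← intervalIntegral.integral_of_le (by norm_num),
        ← intervalIntegral.integral_of_le (by linarith),
    intervalIntegral.integral_comp_add_mul _ hr.ne']
  congr 2 <;> ring

/-- Dual form of Zygmund's inequality on an interval of half-length `r`. -/
theorem sum_sq_norm_coeff_Icc_le {ι : Type*} {J : Finset ι} {θ : ι → ℝ} {N : ℝ}
    (h : LacBound J (fun j => |θ j|) N) {s : ℝ} (hs : 1 < s) (hs2 : s < 2) {c r : ℝ} (hr : 0 < r)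
    (hθ : ∀ j ∈ J, 1 ≤ |θ j| * r) {b : ℝ → ℂ} (hbm : Measurable b) {K : ℝ} (hbK : ∀ y ∈ Set.Icc
        (c - r) (c + r), ‖b y‖ ≤ K)
    {β : ℝ} (hβ : 0 ≤ β) (hbβ : ∫ y in Set.Icc (c - r) (c + r), ‖b y‖ ^ s ≤ β ^ s * r) :
    ∑ j ∈ J, ‖∫ y in Set.Icc (c - r) (c + r), b y * cexp (I * (θ j * y : ℝ))‖ ^ 2 ≤
      2 * Real.exp 50 * (N / (s - 1)) * β ^ 2 * r ^ 2 := by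
  have hscale : LacBound J (fun j => |θ j * r|) N := by
    have := h.scale hr
    simpa only [abs_mul, abs_of_pos hr] using this
  have hmemb : ∀ u ∈ Set.Icc (-1 : ℝ) 1, c + r * u ∈ Set.Icc (c - r) (c + r) := fun u hu =>
    ⟨by nlinarith [hu.1], by nlinarith [hu.2]⟩
  have hm : MemLp (fun u => b (c + r * u)) (ENNReal.ofReal s)
      (volume.restrict (Set.Icc (-1) 1)) := by
    have : IsFiniteMeasure ((volume : Measure ℝ).restrict (Set.Icc (-1 : ℝ) 1)) := ⟨by simp⟩
    refine MemLp.of_bound (C := K) ?_ ?_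
    · exact (hbm.comp (by fun_prop : Measurable fun u => c + r * u)).aestronglyMeasurable
    · exact (ae_restrict_iff' measurableSet_Icc).2 (ae_of_all _ fun u hu => hbK _ (hmemb u hu))
  have key := sum_sq_norm_coeff_le hscale (fun j hj => by
    rw [abs_mul, abs_of_pos hr]; exact hθ j hj) hs hs2 hm hβ (by
    rw [setIntegral_Icc_comp_affine (fun y => ‖b y‖ ^ s) c hr, smul_eq_mul, inv_mul_le_iff₀ hr]
    linarith)
  have e : ∀ j, ‖∫ y in Set.Icc (c - r) (c + r), b y * cexp (I * (θ j * y : ℝ))‖ ^ 2 =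
      r ^ 2 * ‖∫ u in Set.Icc (-1 : ℝ) 1, b (c + r * u) * cexp (I * (θ j * r * u : ℝ))‖ ^ 2 := by
    intro j
    have e1 : ∀ u : ℝ, b (c + r * u) * cexp (I * (θ j * r * u : ℝ)) =
        cexp (I * ((-(θ j * c) : ℝ) : ℂ)) *
          (fun y : ℝ => b y * cexp (I * (θ j * y : ℝ))) (c + r * u) := by
      intro u
      have : cexp (I * (θ j * r * u : ℝ)) = cexp (I * ((-(θ j * c) : ℝ) : ℂ)) *
          cexp (I * ((θ j * (c + r * u) : ℝ) : ℂ)) := by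
        rw [← Complex.exp_add]; congr 1; push_cast; ring
      rw [this]; exact mul_left_comm (b (c + r * u)) _ _
    simp only [e1]
    rw [integral_const_mul, norm_mul, norm_exp_I_mul_real, one_mul]
    rw [setIntegral_Icc_comp_affine (fun y : ℝ => b y * cexp (I * (θ j * y : ℝ))) c hr, norm_smul,
      norm_inv, Real.norm_eq_abs, abs_of_pos hr]
    field_simp
  simp only [e]
  rw [← Finset.mul_sum]
  nlinarith [mul_le_mul_of_nonneg_left key (sq_nonneg r)]

section

/-- The Fourier coefficient of `b` on the interval of centre `c` and half-length `r`. -/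
def locCoef (b : ℝ → ℂ) (c r θ : ℝ) : ℂ :=
  ∫ y in Set.Icc (c - r) (c + r), b y * cexp (I * (θ * y : ℝ))

/-- The average over an interval of the Cauchy kernel at height `1 / l`. -/
def cauchyAvg (c r l x : ℝ) : ℂ :=
  (2 * r : ℂ)⁻¹ * ∫ y in Set.Icc (c - r) (c + r), 1 / (((x - y : ℝ) : ℂ) - I * (l⁻¹ : ℝ))

/-- The modulated Cauchy kernel compensating the Dirichlet kernel acting on `b`. -/
def dirComp (b : ℝ → ℂ) (c r l x : ℝ) : ℂ :=
  (2 * π * I)⁻¹ * (cexp (I * (l * x : ℝ)) * locCoef b c r (-l) -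
    cexp (I * ((-l) * x : ℝ)) * locCoef b c r l) * cauchyAvg c r l x

/-- The Dirichlet kernel acting on `b`, minus its compensator. -/
def dirErr (b : ℝ → ℂ) (c r l x : ℝ) : ℂ :=
  (∫ y in Set.Icc (c - r) (c + r), b y * dirKer l (x - y)) - dirComp b c r l x

/-- A bounded measurable function with vanishing mean on an interval and size controls. -/
structure IsLPAtom (b : ℝ → ℂ) (c r s β : ℝ) : Prop where
  meas : Measurable b
  bdd : ∃ K, ∀ y, ‖b y‖ ≤ K
  hr : 0 < r
  hβ : 0 ≤ β
  mean : ∫ y in Set.Icc (c - r) (c + r), b y = 0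
  l1 : ∫ y in Set.Icc (c - r) (c + r), ‖b y‖ ≤ β * r
  ls : ∫ y in Set.Icc (c - r) (c + r), ‖b y‖ ^ s ≤ β ^ s * r

variable {b : ℝ → ℂ} {c r s β : ℝ}

theorem IsLPAtom.integrableOn (hb : IsLPAtom b c r s β) : IntegrableOn b (Set.Icc (c - r)
    (c + r)) := by
  obtain ⟨K, hK⟩ := hb.bdd
  exact Measure.integrableOn_of_bounded (by simp) hb.meas.aestronglyMeasurable
    (ae_of_all _ hK)

theorem norm_setIntegral_mul_le_of_mean_zero (hb : IsLPAtom b c r s β) {k : ℝ → ℂ} (hk :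
    Measurable k)
    {M : ℝ} {k0 : ℂ} (hM : ∀ y ∈ Set.Icc (c - r) (c + r), ‖k y - k0‖ ≤ M) :
    ‖∫ y in Set.Icc (c - r) (c + r), b y * k y‖ ≤ β * r * M := by
  have hi := hb.integrableOn
  have hr := hb.hr
  have hM0 : 0 ≤ M := (norm_nonneg _).trans (hM c ⟨by linarith, by linarith⟩)
  have i1 : IntegrableOn (fun y => b y * (k y - k0)) (Set.Icc (c - r) (c + r)) := by
    refine Integrable.mul_bdd (c := M) hi (hk.sub_const _).aestronglyMeasurable ?_
    exact (ae_restrict_iff' measurableSet_Icc).2 (ae_of_all _ hM)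
  have e : ∫ y in Set.Icc (c - r) (c + r), b y * k y =
      ∫ y in Set.Icc (c - r) (c + r), b y * (k y - k0) := by
    have e1 : ∀ y, b y * k y = b y * (k y - k0) + b y * k0 := fun y => by ring
    simp only [e1]
    rw [integral_add i1 (hi.mul_const k0), integral_mul_const, hb.mean, zero_mul, add_zero]
  rw [e]
  refine (norm_integral_le_integral_norm _).trans ?_
  calc ∫ y in Set.Icc (c - r) (c + r), ‖b y * (k y - k0)‖
      ≤ ∫ y in Set.Icc (c - r) (c + r), ‖b y‖ * M := by
        refine setIntegral_mono_on i1.norm (hi.norm.mul_const M) measurableSet_Icc fun y hy => ?_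
        rw [norm_mul]; exact mul_le_mul_of_nonneg_left (hM y hy) (norm_nonneg _)
    _ = (∫ y in Set.Icc (c - r) (c + r), ‖b y‖) * M := integral_mul_const _ _
    _ ≤ _ := mul_le_mul_of_nonneg_right hb.l1 hM0

theorem abs_sub_le_of_mem_Icc {y : ℝ} (hy : y ∈ Set.Icc (c - r) (c + r)) : |y - c| ≤ r :=
  abs_le.2 ⟨by linarith [hy.1], by linarith [hy.2]⟩

theorem norm_locCoef_le (hb : IsLPAtom b c r s β) (θ : ℝ) :
    ‖locCoef b c r θ‖ ≤ β * r * (|θ| * r) := by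
  refine norm_setIntegral_mul_le_of_mean_zero hb (k0 := cexp (I * (θ * c : ℝ))) (by fun_prop)
    fun y hy => ?_
  refine (norm_exp_I_sub_le _ _).trans ?_
  rw [← mul_sub, abs_mul]
  gcongr
  exact abs_sub_le_of_mem_Icc hy

theorem norm_sub_I_mul_ge (u e : ℝ) : |u| ≤ ‖(u : ℂ) - I * e‖ ∧ |e| ≤ ‖(u : ℂ) - I * e‖ := by
  constructor
  · have := Complex.abs_re_le_norm ((u : ℂ) - I * e); simpa using this
  · have := Complex.abs_im_le_norm ((u : ℂ) - I * e); simpa using this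

theorem norm_cauchyAvg_sub_le (hr : 0 < r) (l x : ℝ) {k0 : ℂ} {M : ℝ} (hl : 0 < l)
    (hM : ∀ y ∈ Set.Icc (c - r) (c + r), ‖1 / (((x - y : ℝ) : ℂ) - I * (l⁻¹ : ℝ)) - k0‖ ≤ M) :
    ‖cauchyAvg c r l x - k0‖ ≤ M := by
  have hne : ∀ y : ℝ, (((x - y : ℝ) : ℂ) - I * (l⁻¹ : ℝ)) ≠ 0 := fun y h => by
    have := (norm_sub_I_mul_ge (x - y) l⁻¹).2
    rw [h, norm_zero, abs_of_pos (by positivity)] at this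
    have : 0 < l⁻¹ := by positivity
    linarith
  have hcont : Continuous fun y : ℝ => 1 / (((x - y : ℝ) : ℂ) - I * (l⁻¹ : ℝ)) := by
    refine Continuous.div continuous_const (by fun_prop) hne
  have hr' : (r : ℂ) ≠ 0 := by exact_mod_cast hr.ne'
  have e : cauchyAvg c r l x - k0 = (2 * r : ℂ)⁻¹ *
      ∫ y in Set.Icc (c - r) (c + r), (1 / (((x - y : ℝ) : ℂ) - I * (l⁻¹ : ℝ)) - k0) := by
    rw [integral_sub hcont.integrableOn_Icc (by simp)]
    unfold cauchyAvg
    rw [mul_sub]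
    congr 1
    have : (volume : Measure ℝ).real (Set.Icc (c - r) (c + r)) = 2 * r := by
      rw [Real.volume_real_Icc_of_le (by linarith)]; ring
    rw [setIntegral_const, this, Complex.real_smul]
    push_cast
    field_simp
  rw [e, norm_mul]
  have h1 : ‖∫ y in Set.Icc (c - r) (c + r), (1 / (((x - y : ℝ) : ℂ) - I * (l⁻¹ : ℝ)) - k0)‖
      ≤ M * (volume : Measure ℝ).real (Set.Icc (c - r) (c + r)) :=
    norm_setIntegral_le_of_norm_le_const (by simp) fun y hy => hM y hy
  have : (volume : Measure ℝ).real (Set.Icc (c - r) (c + r)) = 2 * r := by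
    rw [Real.volume_real_Icc_of_le (by linarith)]; ring
  rw [this] at h1
  have h2 : ‖(2 * r : ℂ)⁻¹‖ = (2 * r)⁻¹ := by simp [abs_of_pos hr]
  rw [h2, inv_mul_le_iff₀ (by positivity)]
  linarith

theorem norm_cauchyAvg_le (hr : 0 < r) {l : ℝ} (hl : 0 < l) (x : ℝ) : ‖cauchyAvg c r l x‖ ≤ l := by
  have := norm_cauchyAvg_sub_le (c := c) hr l x (k0 := 0) (M := l) hl fun y _ => by
    rw [sub_zero, norm_div, norm_one, div_le_iff₀]
    · have := (norm_sub_I_mul_ge (x - y) l⁻¹).2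
      rw [abs_of_pos (by positivity)] at this
      calc 1 = l * l⁻¹ := by field_simp
        _ ≤ _ := by gcongr
    · have := (norm_sub_I_mul_ge (x - y) l⁻¹).2
      rw [abs_of_pos (by positivity)] at this
      exact lt_of_lt_of_le (by positivity) this
  simpa using this

theorem abs_sub_ge_of_far {x y : ℝ} (hx : 3 * r ≤ |x - c|)
    (hy : y ∈ Set.Icc (c - r) (c + r)) : 2 / 3 * |x - c| ≤ |x - y| := by
  have h1 := abs_sub_le_of_mem_Icc hy
  have h2 : |x - c| ≤ |x - y| + |y - c| := abs_sub_le x y c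
  linarith

theorem norm_cauchyAvg_sub_inv_le (hr : 0 < r) {l : ℝ} (hl : 0 < l) {x : ℝ}
    (hx : 3 * r ≤ |x - c|) :
    ‖cauchyAvg c r l x - 1 / ((x - c : ℝ) : ℂ)‖ ≤ 3 / 2 * (r + l⁻¹) / |x - c| ^ 2 := by
  refine norm_cauchyAvg_sub_le hr l x hl fun y hy => ?_
  have hX : 0 < |x - c| := by linarith
  have h1 := abs_sub_ge_of_far hx hy
  have h2 := (norm_sub_I_mul_ge (x - y) l⁻¹).1
  have h3 : 0 < ‖((x - y : ℝ) : ℂ) - I * (l⁻¹ : ℝ)‖ := by linarith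
  have hc : ((x - c : ℝ) : ℂ) ≠ 0 := by
    have := abs_pos.1 hX; exact_mod_cast this
  rw [div_sub_div _ _ (norm_pos_iff.1 h3) hc, norm_div, norm_mul, Complex.norm_real,
    Real.norm_eq_abs]
  have h4 : ‖1 * ((x - c : ℝ) : ℂ) - (((x - y : ℝ) : ℂ) - I * (l⁻¹ : ℝ)) * 1‖ ≤ r + l⁻¹ := by
    have : 1 * ((x - c : ℝ) : ℂ) - (((x - y : ℝ) : ℂ) - I * (l⁻¹ : ℝ)) * 1 =
        ((y - c : ℝ) : ℂ) + I * (l⁻¹ : ℝ) := by push_cast; ring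
    rw [this]
    refine (norm_add_le _ _).trans ?_
    rw [Complex.norm_real, norm_mul, Complex.norm_I, one_mul, Complex.norm_real, Real.norm_eq_abs,
      Real.norm_eq_abs, abs_of_pos (by positivity : 0 < l⁻¹)]
    linarith [abs_sub_le_of_mem_Icc hy]
  have hl' : 0 < l⁻¹ := by positivity
  rw [div_le_div_iff₀ (by positivity) (by positivity)]
  calc _ ≤ (r + l⁻¹) * |x - c| ^ 2 := by gcongr
    _ = 3 / 2 * (r + l⁻¹) * (2 / 3 * |x - c| * |x - c|) := by ring
    _ ≤ _ := by gcongr; exact h1.trans h2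

theorem norm_inv_sub_inv_le (hr : 0 < r) {x y : ℝ} (hx : 3 * r ≤ |x - c|)
    (hy : y ∈ Set.Icc (c - r) (c + r)) :
    ‖1 / ((x - y : ℝ) : ℂ) - 1 / ((x - c : ℝ) : ℂ)‖ ≤ 3 / 2 * r / |x - c| ^ 2 := by
  have hX : 0 < |x - c| := by linarith
  have h1 := abs_sub_ge_of_far hx hy
  have h3 : 0 < |x - y| := by linarith
  have hc : ((x - c : ℝ) : ℂ) ≠ 0 := by
    have := abs_pos.1 hX; exact_mod_cast this
  have hy' : ((x - y : ℝ) : ℂ) ≠ 0 := by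
    have := abs_pos.1 h3; exact_mod_cast this
  rw [div_sub_div _ _ hy' hc, norm_div, norm_mul, Complex.norm_real, Complex.norm_real,
    Real.norm_eq_abs, Real.norm_eq_abs]
  have h4 : ‖1 * ((x - c : ℝ) : ℂ) - ((x - y : ℝ) : ℂ) * 1‖ ≤ r := by
    have : 1 * ((x - c : ℝ) : ℂ) - ((x - y : ℝ) : ℂ) * 1 = ((y - c : ℝ) : ℂ) := by push_cast; ring
    rw [this, Complex.norm_real, Real.norm_eq_abs]
    exact abs_sub_le_of_mem_Icc hy
  rw [div_le_div_iff₀ (by positivity) (by positivity)]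
  calc _ ≤ r * |x - c| ^ 2 := by gcongr
    _ = 3 / 2 * r * (2 / 3 * |x - c| * |x - c|) := by ring
    _ ≤ _ := by gcongr

/-- `b` times the increment of the Hilbert kernel. -/
def hilbInc (b : ℝ → ℂ) (c x y : ℝ) : ℂ := b y * (1 / ((x - y : ℝ) : ℂ) - 1 / ((x - c : ℝ) : ℂ))

theorem measurable_hilbInc (hb : Measurable b) (c x : ℝ) : Measurable (hilbInc b c x) := by
  unfold hilbInc; fun_prop

theorem norm_hilbInc_le (hr : 0 < r) {x y : ℝ} (hx : 3 * r ≤ |x - c|)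
    (hy : y ∈ Set.Icc (c - r) (c + r)) :
    ‖hilbInc b c x y‖ ≤ ‖b y‖ * (3 / 2 * r / |x - c| ^ 2) := by
  unfold hilbInc
  rw [norm_mul]
  exact mul_le_mul_of_nonneg_left (norm_inv_sub_inv_le hr hx hy) (norm_nonneg _)

theorem dirErr_eq (hb : IsLPAtom b c r s β) (l : ℝ) {x : ℝ} (hx : 3 * r ≤ |x - c|) :
    dirErr b c r l x = (2 * π * I)⁻¹ *
      (cexp (I * (l * x : ℝ)) * (locCoef (hilbInc b c x) c r (-l) -
        (cauchyAvg c r l x - 1 / ((x - c : ℝ) : ℂ)) * locCoef b c r (-l)) -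
      cexp (I * ((-l) * x : ℝ)) * (locCoef (hilbInc b c x) c r l -
        (cauchyAvg c r l x - 1 / ((x - c : ℝ) : ℂ)) * locCoef b c r l)) := by
  have hr := hb.hr
  have hi := hb.integrableOn
  have hcoef : ∀ θ : ℝ, locCoef (hilbInc b c x) c r θ + 1 / ((x - c : ℝ) : ℂ) * locCoef b c r θ =
      ∫ y in Set.Icc (c - r) (c + r), b y * cexp (I * (θ * y : ℝ)) * (1 / ((x - y : ℝ) : ℂ)) := by
    intro θ
    have i0 : IntegrableOn (fun y => b y * cexp (I * (θ * y : ℝ))) (Set.Icc (c - r) (c + r)) :=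
      Integrable.mul_bdd (c := 1) hi (by fun_prop) (ae_of_all _ fun y => (norm_exp_I_mul_real _).le)
    have i1 : IntegrableOn (fun y => hilbInc b c x y * cexp (I * (θ * y : ℝ)))
        (Set.Icc (c - r) (c + r)) := by
      refine Integrable.mul_bdd (c := 1) ?_ (by fun_prop)
        (ae_of_all _ fun y => (norm_exp_I_mul_real _).le)
      refine Integrable.mono' (hi.norm.mul_const (3 / 2 * r / |x - c| ^ 2))
        (measurable_hilbInc hb.meas c x).aestronglyMeasurable ?_
      exact (ae_restrict_iff' measurableSet_Icc).2 (ae_of_all _ fun y hy => norm_hilbInc_le hr hx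
          hy)
    unfold locCoef
    rw [← integral_const_mul, ← integral_add i1 (i0.const_mul _)]
    refine integral_congr_ae (ae_of_all _ fun y => ?_)
    simp only [hilbInc]; ring
  have i2 : ∀ θ : ℝ, IntegrableOn
      (fun y => b y * cexp (I * (θ * y : ℝ)) * (1 / ((x - y : ℝ) : ℂ))) (Set.Icc (c - r)
          (c + r)) := by
    intro θ
    refine Integrable.mul_bdd (c := (2 * r)⁻¹) (Integrable.mul_bdd (c := 1) hi (by fun_prop)
      (ae_of_all _ fun y => (norm_exp_I_mul_real _).le))
      (by measurability : Measurable fun y : ℝ => 1 / ((x - y : ℝ) : ℂ)).aestronglyMeasurable ?_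
    refine (ae_restrict_iff' measurableSet_Icc).2 (ae_of_all _ fun y hy => ?_)
    have h1 := abs_sub_ge_of_far hx hy
    rw [norm_div, norm_one, Complex.norm_real, Real.norm_eq_abs, one_div]
    gcongr
    linarith
  have hker : ∫ y in Set.Icc (c - r) (c + r), b y * dirKer l (x - y) = (2 * π * I)⁻¹ *
      (cexp (I * (l * x : ℝ)) * (locCoef (hilbInc b c x) c r (-l) +
        1 / ((x - c : ℝ) : ℂ) * locCoef b c r (-l)) -
      cexp (I * ((-l) * x : ℝ)) * (locCoef (hilbInc b c x) c r l +
        1 / ((x - c : ℝ) : ℂ) * locCoef b c r l)) := by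
    rw [hcoef, hcoef, ← integral_const_mul, ← integral_const_mul,
      ← integral_sub ((i2 _).const_mul _) ((i2 _).const_mul _), ← integral_const_mul]
    refine setIntegral_congr_fun measurableSet_Icc fun y hy => ?_
    have h1 := abs_sub_ge_of_far hx hy
    have h3 : x - y ≠ 0 := abs_pos.1 (by linarith)
    have e1 : cexp (I * (l * (x - y) : ℝ)) =
        cexp (I * (l * x : ℝ)) * cexp (I * ((-l) * y : ℝ)) := by
      rw [← Complex.exp_add]; congr 1; push_cast; ring
    have e2 : cexp (I * ((-l) * (x - y) : ℝ)) =
        cexp (I * ((-l) * x : ℝ)) * cexp (I * (l * y : ℝ)) := by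
      rw [← Complex.exp_add]; congr 1; push_cast; ring
    rw [dirKer_eq l h3, e1, e2, div_eq_mul_inv, one_div]
    generalize cexp (I * (l * x : ℝ)) = A1
    generalize cexp (I * ((-l) * x : ℝ)) = A2
    generalize cexp (I * (l * y : ℝ)) = A3
    generalize cexp (I * ((-l) * y : ℝ)) = A4
    ring
  unfold dirErr
  rw [hker, dirComp]
  ring

end

section

variable {b : ℝ → ℂ} {c r s β : ℝ}

theorem norm_two_pi_I_inv : ‖(2 * π * I : ℂ)⁻¹‖ = (2 * π)⁻¹ := by
  simp [abs_of_pos Real.pi_pos]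

theorem norm_exp_mul_sub_exp_mul_le (l x : ℝ) (u v : ℂ) :
    ‖(2 * π * I : ℂ)⁻¹ * (cexp (I * (l * x : ℝ)) * u - cexp (I * ((-l) * x : ℝ)) * v)‖ ≤
      (2 * π)⁻¹ * (‖u‖ + ‖v‖) := by
  rw [norm_mul, norm_two_pi_I_inv]
  gcongr
  refine (norm_sub_le _ _).trans ?_
  rw [norm_mul, norm_mul, norm_exp_I_mul_real, norm_exp_I_mul_real, one_mul, one_mul]

theorem norm_dirComp_le (hb : IsLPAtom b c r s β) {l : ℝ} (hl : 0 < l) (x : ℝ) :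
    ‖dirComp b c r l x‖ ≤ β * l ^ 2 * r ^ 2 := by
  unfold dirComp
  rw [norm_mul]
  have h1 := norm_exp_mul_sub_exp_mul_le l x (locCoef b c r (-l)) (locCoef b c r l)
  have h2 := norm_locCoef_le hb l
  have h3 := norm_locCoef_le hb (-l)
  rw [abs_neg] at h3
  rw [abs_of_pos hl] at h2 h3
  have h4 := norm_cauchyAvg_le (c := c) hb.hr hl x
  have hp : (2 * π)⁻¹ ≤ 1 / 2 := by
    rw [inv_le_comm₀ (by positivity) (by norm_num)]
    linarith [Real.pi_gt_three]
  have hβ := hb.hβ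
  have hr := hb.hr
  calc _ ≤ (1 / 2 * (β * r * (l * r) + β * r * (l * r))) * l := by
        refine mul_le_mul (h1.trans ?_) h4 (norm_nonneg _) (by positivity)
        gcongr
    _ = _ := by ring

theorem norm_dirErr_le_of_low (hb : IsLPAtom b c r s β) {l : ℝ} (hl : 0 < l) (x : ℝ) :
    ‖dirErr b c r l x‖ ≤ 2 * (β * l ^ 2 * r ^ 2) := by
  unfold dirErr
  refine (norm_sub_le _ _).trans ?_
  have h1 := norm_dirComp_le hb hl x
  have h2 := norm_setIntegral_mul_le_of_mean_zero hb (k := fun y => dirKer l (x - y))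
    (k0 := dirKer l (x - c)) (M := l ^ 2 * r)
    ((continuous_dirKer hl.le).measurable.comp (by fun_prop)) fun y hy => by
      refine (norm_dirKer_sub_le hl.le _ _).trans ?_
      have := abs_sub_le_of_mem_Icc hy
      rw [show x - y - (x - c) = -(y - c) by ring, abs_neg]
      gcongr
  nlinarith [h1, h2]

theorem norm_dirErr_le_of_far (hb : IsLPAtom b c r s β) (l : ℝ) {x : ℝ} (hx : 3 * r ≤ |x - c|) :
    ‖dirErr b c r l x‖ ≤ (2 * π)⁻¹ *
      ((‖locCoef (hilbInc b c x) c r (-l)‖ + ‖locCoef (hilbInc b c x) c r l‖) +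
        ‖cauchyAvg c r l x - 1 / ((x - c : ℝ) : ℂ)‖ *
          (‖locCoef b c r (-l)‖ + ‖locCoef b c r l‖)) := by
  rw [dirErr_eq hb l hx]
  refine (norm_exp_mul_sub_exp_mul_le l x _ _).trans ?_
  refine mul_le_mul_of_nonneg_left ?_ (by positivity)
  refine (add_le_add (norm_sub_le _ _) (norm_sub_le _ _)).trans (le_of_eq ?_)
  rw [norm_mul, norm_mul]; ring

theorem norm_locCoef_hilbInc_le (hb : IsLPAtom b c r s β) (θ : ℝ) {x : ℝ}
    (hx : 3 * r ≤ |x - c|) :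
    ‖locCoef (hilbInc b c x) c r θ‖ ≤ β * r * (3 / 2 * r / |x - c| ^ 2) := by
  have e : locCoef (hilbInc b c x) c r θ = ∫ y in Set.Icc (c - r) (c + r),
      b y * ((1 / ((x - y : ℝ) : ℂ) - 1 / ((x - c : ℝ) : ℂ)) * cexp (I * (θ * y : ℝ))) := by
    unfold locCoef hilbInc
    simp only [mul_assoc]
  rw [e]
  refine norm_setIntegral_mul_le_of_mean_zero hb (k0 := 0)
    (k := fun y => (1 / ((x - y : ℝ) : ℂ) - 1 / ((x - c : ℝ) : ℂ)) * cexp (I * (θ * y : ℝ)))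
    (by measurability) fun y hy => ?_
  rw [sub_zero, norm_mul, norm_exp_I_mul_real, mul_one]
  exact norm_inv_sub_inv_le hb.hr hx hy

theorem sq_norm_dirErr_le_of_low (hb : IsLPAtom b c r s β) {l : ℝ} (hl : 0 < l) (hlr : l * r ≤ 1)
    {x : ℝ} (hx : 3 * r ≤ |x - c|) :
    ‖dirErr b c r l x‖ ^ 2 ≤ 4 * β ^ 2 * r ^ 4 / |x - c| ^ 3 * l := by
  have hr := hb.hr
  have hβ := hb.hβ
  have hX : 0 < |x - c| := by linarith
  set X := |x - c| with hXdef
  rcases le_total (l * X) 1 with h | h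
  · have h1 := norm_dirErr_le_of_low hb hl x
    calc _ ≤ (2 * (β * l ^ 2 * r ^ 2)) ^ 2 := by gcongr
      _ = 4 * β ^ 2 * r ^ 4 / X ^ 3 * l * (l * X) ^ 3 := by field_simp; ring
      _ ≤ 4 * β ^ 2 * r ^ 4 / X ^ 3 * l * 1 := by
        gcongr
        exact pow_le_one₀ (by positivity) h
      _ = _ := by ring
  · have h1 := norm_dirErr_le_of_far hb l hx
    have h2 := norm_cauchyAvg_sub_inv_le hr hl hx
    have h3 := norm_locCoef_hilbInc_le hb l hx
    have h4 := norm_locCoef_hilbInc_le hb (-l) hx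
    have h5 := norm_locCoef_le hb l
    have h6 := norm_locCoef_le hb (-l)
    rw [abs_neg] at h6
    rw [abs_of_pos hl] at h5 h6
    rw [← hXdef] at h2 h3 h4
    have hp : (2 * π)⁻¹ ≤ 1 / 6 := by
      rw [inv_le_comm₀ (by positivity) (by norm_num)]
      linarith [Real.pi_gt_three]
    have key : ‖dirErr b c r l x‖ ≤ 2 * β * r ^ 2 / X ^ 2 := by
      refine h1.trans ?_
      calc _ ≤ 1 / 6 * ((β * r * (3 / 2 * r / X ^ 2) + β * r * (3 / 2 * r / X ^ 2)) +
            (3 / 2 * (r + l⁻¹) / X ^ 2) * (β * r * (l * r) + β * r * (l * r))) := by gcongr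
        _ = 1 / 2 * (β * r ^ 2 / X ^ 2) * (2 + l * r) := by field_simp; ring
        _ ≤ 1 / 2 * (β * r ^ 2 / X ^ 2) * 4 := by gcongr; linarith
        _ = _ := by ring
    calc _ ≤ (2 * β * r ^ 2 / X ^ 2) ^ 2 := by gcongr
      _ = 4 * β ^ 2 * r ^ 4 / X ^ 4 * 1 := by field_simp; ring
      _ ≤ 4 * β ^ 2 * r ^ 4 / X ^ 4 * (l * X) := by gcongr
      _ = _ := by field_simp

theorem sq_norm_dirErr_le_of_high (hb : IsLPAtom b c r s β) {l : ℝ} (hl : 0 < l) (hlr : 1 ≤ l * r)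
    {x : ℝ} (hx : 3 * r ≤ |x - c|) :
    ‖dirErr b c r l x‖ ^ 2 ≤ 1 / 9 *
      (‖locCoef (hilbInc b c x) c r (-l)‖ ^ 2 + ‖locCoef (hilbInc b c x) c r l‖ ^ 2 +
        9 * r ^ 2 / |x - c| ^ 4 *
          (‖locCoef b c r (-l)‖ ^ 2 + ‖locCoef b c r l‖ ^ 2)) := by
  have hr := hb.hr
  have hX : 0 < |x - c| := by linarith
  have h1 := norm_dirErr_le_of_far hb l hx
  have h2 := norm_cauchyAvg_sub_inv_le hr hl hx
  set X := |x - c| with hXdef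
  have hp : (2 * π)⁻¹ ≤ 1 / 6 := by
    rw [inv_le_comm₀ (by positivity) (by norm_num)]
    linarith [Real.pi_gt_three]
  have h3 : 3 / 2 * (r + l⁻¹) / X ^ 2 ≤ 3 * r / X ^ 2 := by
    have : l⁻¹ ≤ r := by rwa [inv_le_iff_one_le_mul₀' hl]
    rw [show 3 * r = 3 / 2 * (r + r) by ring]
    gcongr
  set u := ‖locCoef (hilbInc b c x) c r (-l)‖
  set v := ‖locCoef (hilbInc b c x) c r l‖
  set w := ‖locCoef b c r (-l)‖
  set z := ‖locCoef b c r l‖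
  have h4 : ‖dirErr b c r l x‖ ≤ 1 / 6 * ((u + v) + 3 * r / X ^ 2 * (w + z)) := by
    refine h1.trans ?_
    gcongr
    exact h2.trans h3
  calc _ ≤ (1 / 6 * ((u + v) + 3 * r / X ^ 2 * (w + z))) ^ 2 := by gcongr
    _ ≤ 1 / 9 * (u ^ 2 + v ^ 2 + (3 * r / X ^ 2) ^ 2 * (w ^ 2 + z ^ 2)) := by
      generalize 3 * r / X ^ 2 = δ
      nlinarith [sq_nonneg (u - v), sq_nonneg (u - δ * w), sq_nonneg (u - δ * z),
        sq_nonneg (v - δ * w), sq_nonneg (v - δ * z), sq_nonneg (δ * w - δ * z)]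
    _ = _ := by congr 2; field_simp; ring

theorem sum_sq_norm_locCoef_le_of_high {ι : Type*} {J : Finset ι} {lam : ι → ℝ} {N : ℝ}
    (h : LacBound J lam N) (hs : 1 < s) (hs2 : s < 2) (hb : Measurable b) {K : ℝ} (hr : 0 < r)
    (hK : ∀ y ∈ Set.Icc (c - r) (c + r), ‖b y‖ ≤ K) (hβ : 0 ≤ β)
    (hbβ : ∫ y in Set.Icc (c - r) (c + r), ‖b y‖ ^ s ≤ β ^ s * r)
    (hhigh : ∀ j ∈ J, 1 ≤ lam j * r) :
    ∑ j ∈ J, (‖locCoef b c r (-lam j)‖ ^ 2 + ‖locCoef b c r (lam j)‖ ^ 2) ≤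
      4 * Real.exp 50 * (N / (s - 1)) * β ^ 2 * r ^ 2 := by
  rw [Finset.sum_add_distrib]
  have a1 : (fun j => |lam j|) = lam := funext fun j => abs_of_pos (h.pos j)
  have a2 : (fun j => |-lam j|) = lam := funext fun j => by rw [abs_neg, abs_of_pos (h.pos j)]
  have h1 := sum_sq_norm_coeff_Icc_le (θ := lam) (by rwa [a1]) hs hs2 hr
    (fun j hj => by rw [abs_of_pos (h.pos j)]; exact hhigh j hj) hb hK hβ hbβ
  have h2 := sum_sq_norm_coeff_Icc_le (θ := fun j => -lam j) (by rwa [a2]) hs hs2 hr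
    (fun j hj => by rw [abs_neg, abs_of_pos (h.pos j)]; exact hhigh j hj) hb hK hβ hbβ
  unfold locCoef
  calc _ ≤ 2 * Real.exp 50 * (N / (s - 1)) * β ^ 2 * r ^ 2 + 2 * Real.exp 50 *
      (N / (s - 1)) * β ^ 2 * r ^ 2 :=
        add_le_add h2 h1
    _ = _ := by ring

theorem setIntegral_norm_rpow_le_of_le_mul (hb : IsLPAtom b c r s β) {q : ℝ} (hq : 0 ≤ q)
    (hs : 0 ≤ s) {g : ℝ → ℂ} (hg : Measurable g)
    (hgb : ∀ y ∈ Set.Icc (c - r) (c + r), ‖g y‖ ≤ ‖b y‖ * q) :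
    ∫ y in Set.Icc (c - r) (c + r), ‖g y‖ ^ s ≤ (β * q) ^ s * r := by
  obtain ⟨K, hK⟩ := hb.bdd
  have hmb : Measurable fun y => ‖b y‖ ^ s := hb.meas.norm.pow_const s
  have hmg : Measurable fun y => ‖g y‖ ^ s := hg.norm.pow_const s
  have i1 : IntegrableOn (fun y => ‖b y‖ ^ s) (Set.Icc (c - r) (c + r)) := by
    refine Measure.integrableOn_of_bounded (M := K ^ s) (by simp)
      hmb.aestronglyMeasurable (ae_of_all _ fun y => ?_)
    rw [Real.norm_of_nonneg (by positivity)]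
    exact Real.rpow_le_rpow (norm_nonneg _) (hK y) hs
  have hle : ∀ y ∈ Set.Icc (c - r) (c + r), ‖g y‖ ^ s ≤ ‖b y‖ ^ s * q ^ s := fun y hy => by
    rw [← Real.mul_rpow (norm_nonneg _) hq]
    exact Real.rpow_le_rpow (norm_nonneg _) (hgb y hy) hs
  have i2 : IntegrableOn (fun y => ‖g y‖ ^ s) (Set.Icc (c - r) (c + r)) := by
    refine Integrable.mono' (i1.mul_const (q ^ s)) hmg.aestronglyMeasurable ?_
    refine (ae_restrict_iff' measurableSet_Icc).2 (ae_of_all _ fun y hy => ?_)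
    rw [Real.norm_of_nonneg (by positivity)]
    exact hle y hy
  calc ∫ y in Set.Icc (c - r) (c + r), ‖g y‖ ^ s
      ≤ ∫ y in Set.Icc (c - r) (c + r), ‖b y‖ ^ s * q ^ s :=
        setIntegral_mono_on i2 (i1.mul_const _) measurableSet_Icc hle
    _ = (∫ y in Set.Icc (c - r) (c + r), ‖b y‖ ^ s) * q ^ s := integral_mul_const _ _
    _ ≤ β ^ s * r * q ^ s := mul_le_mul_of_nonneg_right hb.ls (by positivity)
    _ = _ := by rw [Real.mul_rpow hb.hβ hq]; ring

theorem sum_sq_norm_dirErr_le {ι : Type*} {J : Finset ι} {lam : ι → ℝ} {N : ℝ}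
    (h : LacBound J lam N) (hs : 1 < s) (hs2 : s < 2) (hb : IsLPAtom b c r s β) {x : ℝ}
    (hx : 3 * r ≤ |x - c|) :
    ∑ j ∈ J, ‖dirErr b c r (lam j) x‖ ^ 2 ≤
      (4 + 2 * Real.exp 50) * (N / (s - 1)) * β ^ 2 * (r / |x - c|) ^ 3 := by
  classical
  have hr := hb.hr
  have hβ := hb.hβ
  have hX : 0 < |x - c| := by linarith
  have hs1 : 0 < s - 1 := by linarith
  have hN : 0 < N := by linarith [h.one_le]
  rw [← Finset.sum_filter_add_sum_filter_not J (fun j => lam j ≤ r⁻¹)]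
  have hlow : ∑ j ∈ J with lam j ≤ r⁻¹, ‖dirErr b c r (lam j) x‖ ^ 2 ≤
      4 * (N / (s - 1)) * β ^ 2 * (r / |x - c|) ^ 3 := by
    calc _ ≤ ∑ j ∈ J with lam j ≤ r⁻¹, 4 * β ^ 2 * r ^ 4 / |x - c| ^ 3 * lam j := by
          refine Finset.sum_le_sum fun j hj => ?_
          refine sq_norm_dirErr_le_of_low hb (h.pos j) ?_ hx
          have := (Finset.mem_filter.1 hj).2
          calc lam j * r ≤ r⁻¹ * r := by gcongr
            _ = 1 := by field_simp
      _ = 4 * β ^ 2 * r ^ 4 / |x - c| ^ 3 * ∑ j ∈ J with lam j ≤ r⁻¹, lam j := by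
          rw [Finset.mul_sum]
      _ ≤ 4 * β ^ 2 * r ^ 4 / |x - c| ^ 3 * (N * r⁻¹) := by
          gcongr
          exact h.low _ (by positivity)
      _ = 4 * N * β ^ 2 * (r / |x - c|) ^ 3 := by field_simp
      _ ≤ _ := by
          gcongr
          rw [le_div_iff₀ hs1]
          nlinarith
  obtain ⟨K, hK⟩ := hb.bdd
  set X := |x - c| with hXdef
  set J' := {j ∈ J | ¬ lam j ≤ r⁻¹} with hJ'
  have hh' : ∀ j ∈ J', 1 ≤ lam j * r := fun j hj => by
    have := (Finset.mem_filter.1 hj).2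
    push Not at this
    calc 1 = r⁻¹ * r := by field_simp
      _ ≤ _ := by gcongr
  have hL : LacBound J' lam N := h.mono (Finset.filter_subset _ _)
  have e1 := sum_sq_norm_locCoef_le_of_high hL hs hs2 hb.meas hr (fun y _ => hK y) hβ hb.ls hh'
  have hq : 0 ≤ 3 / 2 * r / X ^ 2 := by positivity
  have e2 := sum_sq_norm_locCoef_le_of_high (b := hilbInc b c x) (c := c)
    (β := β * (3 / 2 * r / X ^ 2)) (K := K * (3 / 2 * r / X ^ 2)) hL hs hs2
    (measurable_hilbInc hb.meas c x) hr
    (fun y hy => (norm_hilbInc_le hr hx hy).trans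
      (mul_le_mul_of_nonneg_right (hK y) hq)) (by positivity)
    (setIntegral_norm_rpow_le_of_le_mul hb hq (by linarith) (measurable_hilbInc hb.meas c x)
      fun y hy => norm_hilbInc_le hr hx hy) hh'
  have hhigh : ∑ j ∈ J', ‖dirErr b c r (lam j) x‖ ^ 2 ≤
      2 * Real.exp 50 * (N / (s - 1)) * β ^ 2 * (r / X) ^ 3 := by
    calc _ ≤ ∑ j ∈ J', 1 / 9 * ((‖locCoef (hilbInc b c x) c r (-lam j)‖ ^ 2 +
            ‖locCoef (hilbInc b c x) c r (lam j)‖ ^ 2) + 9 * r ^ 2 / X ^ 4 *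
            (‖locCoef b c r (-lam j)‖ ^ 2 + ‖locCoef b c r (lam j)‖ ^ 2)) :=
          Finset.sum_le_sum fun j hj => sq_norm_dirErr_le_of_high hb (h.pos j) (hh' j hj) hx
      _ = 1 / 9 * (∑ j ∈ J', (‖locCoef (hilbInc b c x) c r (-lam j)‖ ^ 2 +
            ‖locCoef (hilbInc b c x) c r (lam j)‖ ^ 2) + 9 * r ^ 2 / X ^ 4 *
            ∑ j ∈ J', (‖locCoef b c r (-lam j)‖ ^ 2 + ‖locCoef b c r (lam j)‖ ^ 2)) := by
          rw [← Finset.mul_sum, Finset.sum_add_distrib, ← Finset.mul_sum]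
      _ ≤ 1 / 9 * (4 * Real.exp 50 * (N / (s - 1)) * (β * (3 / 2 * r / X ^ 2)) ^ 2 * r ^ 2 +
            9 * r ^ 2 / X ^ 4 * (4 * Real.exp 50 * (N / (s - 1)) * β ^ 2 * r ^ 2)) := by gcongr
      _ = 2 * Real.exp 50 * (N / (s - 1)) * β ^ 2 * (r / X) ^ 3 * (5 / 2 * (r / X)) := by
          field_simp; ring
      _ ≤ 2 * Real.exp 50 * (N / (s - 1)) * β ^ 2 * (r / X) ^ 3 * 1 := by
          gcongr
          have : r / X ≤ 1 / 3 := by rw [div_le_iff₀ hX]; linarith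
          linarith
      _ = _ := by ring
  calc _ ≤ _ := add_le_add hlow hhigh
    _ = _ := by ring

theorem sum_sq_norm_locCoef_le {ι : Type*} {J : Finset ι} {lam : ι → ℝ} {N : ℝ}
    (h : LacBound J lam N) (hs : 1 < s) (hs2 : s < 2) (hb : IsLPAtom b c r s β) :
    ∑ j ∈ J, (‖locCoef b c r (-lam j)‖ ^ 2 + ‖locCoef b c r (lam j)‖ ^ 2) ≤
      (2 + 4 * Real.exp 50) * (N / (s - 1)) * β ^ 2 * r ^ 2 := by
  classical
  have hr := hb.hr
  have hβ := hb.hβ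
  have hs1 : 0 < s - 1 := by linarith
  have hN : 0 < N := by linarith [h.one_le]
  obtain ⟨K, hK⟩ := hb.bdd
  rw [← Finset.sum_filter_add_sum_filter_not J (fun j => lam j ≤ r⁻¹)]
  have hlow : ∑ j ∈ J with lam j ≤ r⁻¹,
      (‖locCoef b c r (-lam j)‖ ^ 2 + ‖locCoef b c r (lam j)‖ ^ 2) ≤
      2 * (N / (s - 1)) * β ^ 2 * r ^ 2 := by
    calc _ ≤ ∑ j ∈ J with lam j ≤ r⁻¹, 2 * β ^ 2 * r ^ 3 * lam j := by
          refine Finset.sum_le_sum fun j hj => ?_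
          have hj' := (Finset.mem_filter.1 hj).2
          have hp := h.pos j
          have h5 := norm_locCoef_le hb (lam j)
          have h6 := norm_locCoef_le hb (-lam j)
          rw [abs_neg] at h6
          rw [abs_of_pos hp] at h5 h6
          calc _ ≤ (β * r * (lam j * r)) ^ 2 + (β * r * (lam j * r)) ^ 2 := by gcongr
            _ = 2 * β ^ 2 * r ^ 3 * lam j * (lam j * r) := by ring
            _ ≤ 2 * β ^ 2 * r ^ 3 * lam j * (r⁻¹ * r) := by gcongr
            _ = _ := by field_simp
      _ = 2 * β ^ 2 * r ^ 3 * ∑ j ∈ J with lam j ≤ r⁻¹, lam j := by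
          rw [Finset.mul_sum]
      _ ≤ 2 * β ^ 2 * r ^ 3 * (N * r⁻¹) := by
          gcongr
          exact h.low _ (by positivity)
      _ = 2 * N * β ^ 2 * r ^ 2 := by field_simp
      _ ≤ _ := by
          gcongr
          rw [le_div_iff₀ hs1]
          nlinarith
  have e1 := sum_sq_norm_locCoef_le_of_high (h.mono (Finset.filter_subset (fun j => ¬ lam j ≤
      r⁻¹) J))
    hs hs2 hb.meas hr (fun y _ => hK y) hβ hb.ls (fun j hj => by
      have := (Finset.mem_filter.1 hj).2
      push Not at this
      calc 1 = r⁻¹ * r := by field_simp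
        _ ≤ _ := by gcongr)
  calc _ ≤ _ := add_le_add hlow e1
    _ = _ := by ring

end

/-- The half-open interval with centre `q.1` and half-length `q.2`. -/
def czIco (q : ℝ × ℝ) : Set ℝ := Set.Ico (q.1 - q.2) (q.1 + q.2)

theorem measurableSet_czIco (q : ℝ × ℝ) : MeasurableSet (czIco q) := measurableSet_Ico

theorem volume_real_czIco {q : ℝ × ℝ} (hq : 0 < q.2) : (volume : Measure ℝ).real (czIco q) =
    2 * q.2 := by
  unfold czIco
  rw [Real.volume_real_Ico_of_le (by linarith)]; ring

theorem exists_dyadic_stopping {h : ℝ → ℝ} (hc : Continuous h) (h0 : ∀ x, 0 ≤ h x) {a : ℝ}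
    (M : ℕ) : ∀ I : ℝ × ℝ, 0 < I.2 → ∫ y in czIco I, h y ≤ a * (2 * I.2) →
    ∃ Q : Finset (ℝ × ℝ), (∀ q ∈ Q, 0 < q.2 ∧ czIco q ⊆ czIco I ∧
        a * (2 * q.2) ≤ ∫ y in czIco q, h y ∧ ∫ y in czIco q, h y ≤ 2 * a * (2 * q.2)) ∧
      (Q : Set (ℝ × ℝ)).PairwiseDisjoint czIco ∧
      ∀ x ∈ czIco I, (∀ q ∈ Q, x ∉ czIco q) →
        ∃ c, x ∈ czIco (c, I.2 / 2 ^ M) ∧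
          ∫ y in czIco (c, I.2 / 2 ^ M), h y ≤ a * (2 * (I.2 / 2 ^ M)) := by
  induction M with
  | zero =>
    intro I hI ha
    refine ⟨∅, by simp, by simp, fun x hx _ => ⟨I.1, ?_⟩⟩
    simpa using ⟨hx, ha⟩
  | succ M ih =>
    intro I hI ha
    have half : ∀ H : ℝ × ℝ, H.2 = I.2 / 2 → czIco H ⊆ czIco I →
        ∃ Q : Finset (ℝ × ℝ), (∀ q ∈ Q, 0 < q.2 ∧ czIco q ⊆ czIco H ∧
          a * (2 * q.2) ≤ ∫ y in czIco q, h y ∧ ∫ y in czIco q, h y ≤ 2 * a * (2 * q.2)) ∧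
        (Q : Set (ℝ × ℝ)).PairwiseDisjoint czIco ∧
        ∀ x ∈ czIco H, (∀ q ∈ Q, x ∉ czIco q) →
          ∃ c, x ∈ czIco (c, I.2 / 2 ^ (M + 1)) ∧
            ∫ y in czIco (c, I.2 / 2 ^ (M + 1)), h y ≤ a * (2 * (I.2 / 2 ^ (M + 1))) := by
      intro H hH hsub
      rcases le_or_gt (∫ y in czIco H, h y) (a * (2 * H.2)) with hle | hgt
      · obtain ⟨Q, h1, h2, h3⟩ := ih H (by linarith) hle
        have e : H.2 / 2 ^ M = I.2 / 2 ^ (M + 1) := by rw [hH, pow_succ']; field_simp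
        rw [e] at h3
        exact ⟨Q, h1, h2, h3⟩
      · refine ⟨{H}, ?_, by simp, fun x hx hn => absurd hx (hn H (by simp))⟩
        intro q hq
        rw [Finset.mem_singleton] at hq
        subst hq
        refine ⟨by linarith, subset_rfl, hgt.le, ?_⟩
        calc ∫ y in czIco q, h y ≤ ∫ y in czIco I, h y :=
              setIntegral_mono_set (hc.integrableOn_Icc.mono_set Set.Ico_subset_Icc_self)
                (ae_of_all _ h0) hsub.eventuallyLE
          _ ≤ _ := ha
          _ = _ := by rw [hH]; ring
    have s1 : czIco (I.1 - I.2 / 2, I.2 / 2) ⊆ czIco I := by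
      refine Set.Ico_subset_Ico ?_ ?_ <;> simp only <;> linarith
    have s2 : czIco (I.1 + I.2 / 2, I.2 / 2) ⊆ czIco I := by
      refine Set.Ico_subset_Ico ?_ ?_ <;> simp only <;> linarith
    have hd : Disjoint (czIco (I.1 - I.2 / 2, I.2 / 2)) (czIco (I.1 + I.2 / 2, I.2 / 2)) := by
      refine Set.disjoint_left.2 fun x hx hx' => ?_
      have h1 := hx.2
      have h2 := hx'.1
      simp only at h1 h2
      linarith
    obtain ⟨Q1, a1, b1, c1⟩ := half (I.1 - I.2 / 2, I.2 / 2) rfl s1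
    obtain ⟨Q2, a2, b2, c2⟩ := half (I.1 + I.2 / 2, I.2 / 2) rfl s2
    classical
    refine ⟨Q1 ∪ Q2, ?_, ?_, ?_⟩
    · intro q hq
      rcases Finset.mem_union.1 hq with hq | hq
      · obtain ⟨u, v, w⟩ := a1 q hq
        exact ⟨u, v.trans s1, w⟩
      · obtain ⟨u, v, w⟩ := a2 q hq
        exact ⟨u, v.trans s2, w⟩
    · rw [Finset.coe_union]
      refine Set.PairwiseDisjoint.union b1 b2 fun q hq q' hq' _ => ?_
      exact hd.mono (a1 q hq).2.1 (a2 q' hq').2.1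
    · intro x hx hn
      rcases lt_or_ge x I.1 with hlt | hge
      · refine c1 x ⟨?_, ?_⟩ fun q hq => hn q (Finset.mem_union_left _ hq)
        · simp only; linarith [hx.1]
        · simp only; linarith
      · refine c2 x ⟨?_, ?_⟩ fun q hq => hn q (Finset.mem_union_right _ hq)
        · simp only; linarith
        · simp only; linarith [hx.2]

theorem exists_calderon_zygmund_intervals {h : ℝ → ℝ} (hc : Continuous h)
    (hcs : HasCompactSupport h)
    (h0 : ∀ x, 0 ≤ h x) {a : ℝ} (ha : 0 < a) :
    ∃ Q : Finset (ℝ × ℝ), (∀ q ∈ Q, 0 < q.2 ∧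
        a * (2 * q.2) ≤ ∫ y in czIco q, h y ∧ ∫ y in czIco q, h y ≤ 2 * a * (2 * q.2)) ∧
      (Q : Set (ℝ × ℝ)).PairwiseDisjoint czIco ∧
      ∀ x, (∀ q ∈ Q, x ∉ czIco q) → h x ≤ 2 * a := by
  obtain ⟨R0, hR0⟩ := hcs.isCompact.isBounded.subset_ball (0 : ℝ)
  have hintg : Integrable h := hc.integrable_of_hasCompactSupport hcs
  set R := max (max R0 1) ((∫ y, h y) / (2 * a)) with hR
  have hR1 : 1 ≤ R := (le_max_right _ _).trans (le_max_left _ _)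
  have hRR : R0 ≤ R := (le_max_left _ _).trans (le_max_left _ _)
  have hroot : ∫ y in czIco (0, R), h y ≤ a * (2 * R) := by
    calc _ ≤ ∫ y, h y := setIntegral_le_integral hintg (ae_of_all _ h0)
      _ = (∫ y, h y) / (2 * a) * (2 * a) := by field_simp
      _ ≤ R * (2 * a) := by gcongr; exact le_max_right _ _
      _ = _ := by ring
  have huc : UniformContinuous h := hcs.uniformContinuous_of_continuous hc
  obtain ⟨δ, hδ, hδ'⟩ := Metric.uniformContinuous_iff.1 huc a ha
  obtain ⟨M, hM⟩ := exists_nat_gt (2 * R / δ)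
  have hM2 : 2 * (R / 2 ^ M) < δ := by
    have : (M : ℝ) < 2 ^ M := by exact_mod_cast Nat.lt_two_pow_self
    rw [← mul_div_assoc, div_lt_iff₀ (by positivity)]
    rw [div_lt_iff₀ hδ] at hM
    nlinarith
  obtain ⟨Q, q1, q2, q3⟩ := exists_dyadic_stopping hc h0 (a := a) M (0, R)
      (by simp only; linarith) hroot
  refine ⟨Q, fun q hq => ⟨(q1 q hq).1, (q1 q hq).2.2⟩, q2, fun x hx => ?_⟩
  by_cases hxR : x ∈ czIco (0, R)
  · obtain ⟨c, hxc, hle⟩ := q3 x hxR hx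
    simp only at hxc hle
    by_contra! hcon
    set ρ := R / 2 ^ M with hρ
    have hρ0 : 0 < ρ := by positivity
    have hlow : ∀ y ∈ czIco (c, ρ), h x - a ≤ h y := fun y hy => by
      have : dist x y < δ := by
        rw [Real.dist_eq, abs_lt]
        have h1 := hxc.1
        have h2 := hxc.2
        have h3 := hy.1
        have h4 := hy.2
        simp only at h1 h2 h3 h4
        constructor <;> linarith
      have h5 := hδ' this
      rw [Real.dist_eq, abs_lt] at h5
      linarith [h5.2]
    have : (h x - a) * (2 * ρ) ≤ ∫ y in czIco (c, ρ), h y := by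
      have hi : ∫ y in czIco (c, ρ), (h x - a) = (h x - a) * (2 * ρ) := by
        rw [setIntegral_const, volume_real_czIco hρ0, smul_eq_mul, mul_comm]
      rw [← hi]
      refine setIntegral_mono_on ?_ hintg.integrableOn (measurableSet_czIco _) hlow
      exact integrableOn_const (by simp [czIco])
    nlinarith
  · have : h x = 0 := by
      by_contra hne
      have := hR0 (subset_tsupport h hne)
      rw [Metric.mem_ball, Real.dist_eq, sub_zero, abs_lt] at this
      exact hxR ⟨by simp only; linarith [this.1], by simp only; linarith [this.2]⟩
    rw [this]; positivity

section

/-- A Calderón–Zygmund family of intervals for `‖f‖ ^ s` at level `α ^ s`. -/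
structure IsCZFamily (f : ℝ → ℂ) (s α : ℝ) (Q : Finset (ℝ × ℝ)) : Prop where
  cont : Continuous f
  supp : HasCompactSupport f
  one_lt : 1 < s
  lt_two : s < 2
  hα : 0 < α
  pos : ∀ q ∈ Q, 0 < q.2
  lower : ∀ q ∈ Q, α ^ s * (2 * q.2) ≤ ∫ y in czIco q, ‖f y‖ ^ s
  upper : ∀ q ∈ Q, ∫ y in czIco q, ‖f y‖ ^ s ≤ 2 * α ^ s * (2 * q.2)
  disj : (Q : Set (ℝ × ℝ)).PairwiseDisjoint czIco
  off : ∀ x, (∀ q ∈ Q, x ∉ czIco q) → ‖f x‖ ^ s ≤ 2 * α ^ s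

theorem HasCompactSupport.norm_rpow {f : ℝ → ℂ} (hf : HasCompactSupport f) {s : ℝ} (hs : 0 < s) :
    HasCompactSupport fun x => ‖f x‖ ^ s :=
  hf.comp_left (g := fun z : ℂ => ‖z‖ ^ s) (by simp [hs.ne'])

theorem Continuous.norm_rpow' {f : ℝ → ℂ} (hf : Continuous f) {s : ℝ} (hs : 0 < s) :
    Continuous fun x => ‖f x‖ ^ s :=
  hf.norm.rpow_const fun _ => Or.inr hs.le

theorem exists_isCZFamily {f : ℝ → ℂ} (hc : Continuous f) (hf : HasCompactSupport f) {s α : ℝ}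
    (hs : 1 < s) (hs2 : s < 2) (hα : 0 < α) : ∃ Q, IsCZFamily f s α Q := by
  obtain ⟨Q, h1, h2, h3⟩ := exists_calderon_zygmund_intervals (h := fun x => ‖f x‖ ^ s)
    (a := α ^ s) (hc.norm_rpow' (by linarith))
    (HasCompactSupport.norm_rpow hf (by linarith)) (fun x => by positivity) (by positivity)
  exact ⟨Q, hc, hf, hs, hs2, hα, fun q hq => (h1 q hq).1, fun q hq => (h1 q hq).2.1,
    fun q hq => (h1 q hq).2.2, h2, h3⟩

/-- The average of `f` on an interval. -/
def czAvg (f : ℝ → ℂ) (q : ℝ × ℝ) : ℂ := (2 * q.2 : ℂ)⁻¹ * ∫ y in czIco q, f y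

/-- The good part in the Calderón–Zygmund decomposition. -/
def czGood (f : ℝ → ℂ) (Q : Finset (ℝ × ℝ)) (x : ℝ) : ℂ :=
  f x - ∑ q ∈ Q, (czIco q).indicator (fun y => f y - czAvg f q) x

theorem le_add_rpow_mul {u t s : ℝ} (hu : 0 ≤ u) (ht : 0 < t) (hs : 1 ≤ s) :
    u ≤ t + u ^ s * t ^ (1 - s) := by
  rcases le_or_gt u t with h | h
  · have : 0 ≤ u ^ s * t ^ (1 - s) := by positivity
    linarith
  · have hu' : 0 < u := ht.trans h
    have : u = u ^ s * u ^ (1 - s) := by rw [← Real.rpow_add hu']; simp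
    have h2 : u ^ (1 - s) ≤ t ^ (1 - s) :=
      Real.rpow_le_rpow_of_nonpos ht h.le (by linarith)
    calc u = u ^ s * u ^ (1 - s) := this
      _ ≤ u ^ s * t ^ (1 - s) := by gcongr
      _ ≤ _ := by linarith

theorem add_rpow_le_mul {u v s : ℝ} (hu : 0 ≤ u) (hv : 0 ≤ v) (hs0 : 1 ≤ s) (hs2 : s ≤ 2) :
    (u + v) ^ s ≤ 2 * (u ^ s + v ^ s) := by
  have h := NNReal.rpow_add_le_mul_rpow_add_rpow ⟨u, hu⟩ ⟨v, hv⟩ hs0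
  have h' : (u + v) ^ s ≤ 2 ^ (s - 1) * (u ^ s + v ^ s) := by exact_mod_cast h
  refine h'.trans ?_
  have h2 : (2 : ℝ) ^ (s - 1) ≤ 2 := by
    calc (2 : ℝ) ^ (s - 1) ≤ 2 ^ (1 : ℝ) :=
          Real.rpow_le_rpow_of_exponent_le (by norm_num) (by linarith)
      _ = 2 := Real.rpow_one 2
  gcongr

variable {f : ℝ → ℂ} {s α : ℝ} {Q : Finset (ℝ × ℝ)}

namespace IsCZFamily

theorem integrable_rpow (h : IsCZFamily f s α Q) : Integrable fun y => ‖f y‖ ^ s :=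
  (h.cont.norm_rpow' (by linarith [h.one_lt])).integrable_of_hasCompactSupport
    (HasCompactSupport.norm_rpow h.supp (by linarith [h.one_lt]))

theorem integrable (h : IsCZFamily f s α Q) : Integrable f :=
  h.cont.integrable_of_hasCompactSupport h.supp

theorem setIntegral_norm_le (h : IsCZFamily f s α Q) {q : ℝ × ℝ} (hq : q ∈ Q) :
    ∫ y in czIco q, ‖f y‖ ≤ 6 * α * q.2 := by
  have hα := h.hα
  have h2 := h.pos q hq
  have hi : ∫ y in czIco q, (α + ‖f y‖ ^ s * α ^ (1 - s)) =
      α * (2 * q.2) + (∫ y in czIco q, ‖f y‖ ^ s) * α ^ (1 - s) := by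
    have hc : IntegrableOn (fun _ => α) (czIco q) := integrableOn_const (by simp [czIco])
    rw [integral_add hc (h.integrable_rpow.integrableOn.mul_const _),
      integral_mul_const, setIntegral_const, volume_real_czIco h2, smul_eq_mul, mul_comm α]
  calc _ ≤ ∫ y in czIco q, (α + ‖f y‖ ^ s * α ^ (1 - s)) := by
        refine integral_mono h.integrable.norm.integrableOn
          ((integrableOn_const (by simp [czIco])).add (h.integrable_rpow.integrableOn.mul_const _))
          fun y => le_add_rpow_mul (norm_nonneg _) hα h.one_lt.le
    _ ≤ α * (2 * q.2) + 2 * α ^ s * (2 * q.2) * α ^ (1 - s) := by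
        rw [hi]; gcongr; exact h.upper q hq
    _ = α * (2 * q.2) + 4 * (α ^ s * α ^ (1 - s)) * q.2 := by ring
    _ = _ := by rw [← Real.rpow_add hα]; simp; ring

theorem norm_czAvg_le (h : IsCZFamily f s α Q) {q : ℝ × ℝ} (hq : q ∈ Q) :
    ‖czAvg f q‖ ≤ 3 * α := by
  have h2 := h.pos q hq
  have : ‖(2 * q.2 : ℂ)⁻¹‖ = (2 * q.2)⁻¹ := by simp [abs_of_pos h2]
  unfold czAvg
  rw [norm_mul, this, inv_mul_le_iff₀ (by positivity)]
  refine (norm_integral_le_integral_norm _).trans ((h.setIntegral_norm_le hq).trans (le_of_eq ?_))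
  ring

theorem isLPAtom (h : IsCZFamily f s α Q) {q : ℝ × ℝ} (hq : q ∈ Q) :
    IsLPAtom (fun y => f y - czAvg f q) q.1 q.2 s (132 * α) := by
  have hα := h.hα
  have h2 := h.pos q hq
  have hs := h.one_lt
  have hs2 := h.lt_two
  obtain ⟨K, hK⟩ := h.supp.exists_bound_of_continuous h.cont
  have hm := h.norm_czAvg_le hq
  have hfi := h.integrable.integrableOn (s := czIco q)
  have hci : IntegrableOn (fun _ => czAvg f q) (czIco q) := integrableOn_const (by simp [czIco])
  have hcont : Continuous fun y => f y - czAvg f q := h.cont.sub continuous_const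
  refine ⟨hcont.measurable, ⟨K + 3 * α, fun y => ?_⟩, h2, by positivity, ?_, ?_, ?_⟩
  · exact (norm_sub_le _ _).trans (add_le_add (hK y) hm)
  · rw [integral_Icc_eq_integral_Ico]
    change ∫ y in czIco q, (f y - czAvg f q) = 0
    rw [integral_sub hfi hci, setIntegral_const, volume_real_czIco h2, czAvg, Complex.real_smul]
    have : (q.2 : ℂ) ≠ 0 := by exact_mod_cast h2.ne'
    push_cast
    field_simp
    simp
  · rw [integral_Icc_eq_integral_Ico]
    change ∫ y in czIco q, ‖f y - czAvg f q‖ ≤ _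
    calc _ ≤ ∫ y in czIco q, (‖f y‖ + ‖czAvg f q‖) :=
          integral_mono (hfi.sub hci).norm (hfi.norm.add hci.norm) fun y => norm_sub_le _ _
      _ = (∫ y in czIco q, ‖f y‖) + 2 * q.2 * ‖czAvg f q‖ := by
          rw [integral_add hfi.norm hci.norm, setIntegral_const, volume_real_czIco h2, smul_eq_mul]
      _ ≤ 6 * α * q.2 + 2 * q.2 * (3 * α) := by
          gcongr
          exact h.setIntegral_norm_le hq
      _ ≤ _ := by nlinarith
  · rw [integral_Icc_eq_integral_Ico]
    change ∫ y in czIco q, ‖f y - czAvg f q‖ ^ s ≤ _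
    have i1 : IntegrableOn (fun y => ‖f y - czAvg f q‖ ^ s) (czIco q) :=
      (hcont.norm_rpow' (by linarith)).integrableOn_Icc.mono_set Set.Ico_subset_Icc_self
    have i2 : IntegrableOn (fun _ => ‖czAvg f q‖ ^ s) (czIco q) :=
      integrableOn_const (by simp [czIco])
    have i3 := h.integrable_rpow.integrableOn (s := czIco q)
    calc _ ≤ ∫ y in czIco q, 2 * (‖f y‖ ^ s + ‖czAvg f q‖ ^ s) := by
          refine integral_mono i1 ((i3.add i2).const_mul 2) fun y => ?_
          refine le_trans ?_ (add_rpow_le_mul (norm_nonneg _) (norm_nonneg _) hs.le hs2.le)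
          exact Real.rpow_le_rpow (norm_nonneg _) (norm_sub_le _ _) (by linarith)
      _ = 2 * ((∫ y in czIco q, ‖f y‖ ^ s) + 2 * q.2 * ‖czAvg f q‖ ^ s) := by
          rw [integral_const_mul, integral_add i3 i2, setIntegral_const, volume_real_czIco h2,
            smul_eq_mul]
      _ ≤ 2 * (2 * α ^ s * (2 * q.2) + 2 * q.2 * (9 * α ^ s)) := by
          gcongr
          · exact h.upper q hq
          · calc ‖czAvg f q‖ ^ s ≤ (3 * α) ^ s := Real.rpow_le_rpow (norm_nonneg _) hm (by linarith)
              _ = 3 ^ s * α ^ s := Real.mul_rpow (by norm_num) hα.le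
              _ ≤ 3 ^ (2 : ℝ) * α ^ s := by gcongr; norm_num
              _ = _ := by norm_num
      _ = 44 * α ^ s * q.2 := by ring
      _ ≤ 132 ^ s * α ^ s * q.2 := by
          gcongr
          calc (44 : ℝ) ≤ 132 ^ (1 : ℝ) := by norm_num
            _ ≤ _ := Real.rpow_le_rpow_of_exponent_le (by norm_num) hs.le
      _ = _ := by rw [Real.mul_rpow (by norm_num) hα.le]

theorem sum_indicator_eq (h : IsCZFamily f s α Q)
    (b : ℝ × ℝ → ℝ → ℂ) {q : ℝ × ℝ} (hq : q ∈ Q) {x : ℝ}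
    (hx : x ∈ czIco q) : ∑ q ∈ Q, (czIco q).indicator (b q) x = b q x := by
  rw [Finset.sum_eq_single q, Set.indicator_of_mem hx]
  · intro q' hq' hne
    exact Set.indicator_of_notMem (fun hx' => Set.disjoint_left.1 (h.disj hq' hq hne) hx' hx) _
  · exact fun hn => absurd hq hn

theorem sum_le (h : IsCZFamily f s α Q) :
    α ^ s * ∑ q ∈ Q, 2 * q.2 ≤ ∫ y, ‖f y‖ ^ s := by
  rw [Finset.mul_sum]
  calc _ ≤ ∑ q ∈ Q, ∫ y in czIco q, ‖f y‖ ^ s := Finset.sum_le_sum fun q hq => h.lower q hq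
    _ = ∫ y in ⋃ q ∈ Q, czIco q, ‖f y‖ ^ s := by
        rw [integral_biUnion_finset Q (fun q _ => measurableSet_czIco q) h.disj
          fun q _ => h.integrable_rpow.integrableOn]
    _ ≤ _ := setIntegral_le_integral h.integrable_rpow (ae_of_all _ fun y => by positivity)

theorem sq_norm_czGood_le (h : IsCZFamily f s α Q) (x : ℝ) : ‖czGood f Q x‖ ^ 2 ≤
    2 * α ^ (2 - s) * ‖f x‖ ^ s + ∑ q ∈ Q, (czIco q).indicator (fun _ => 9 * α ^ 2) x := by
  have hα := h.hα
  have hs := h.one_lt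
  have hs2 := h.lt_two
  have hsum : 0 ≤ ∑ q ∈ Q, (czIco q).indicator (fun _ => 9 * α ^ 2) x :=
    Finset.sum_nonneg fun q _ => Set.indicator_nonneg (fun _ _ => by positivity) _
  by_cases hx : ∃ q ∈ Q, x ∈ czIco q
  · obtain ⟨q, hq, hxq⟩ := hx
    have h1 : czGood f Q x = czAvg f q := by
      unfold czGood
      rw [h.sum_indicator_eq (fun q y => f y - czAvg f q) hq hxq]; ring
    have h2 : 9 * α ^ 2 ≤ ∑ q ∈ Q, (czIco q).indicator (fun _ => 9 * α ^ 2) x := by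
      have := Finset.single_le_sum (f := fun q => (czIco q).indicator (fun _ => 9 * α ^ 2) x)
        (fun q _ => Set.indicator_nonneg (fun _ _ => by positivity) _) hq
      simpa only [Set.indicator_of_mem hxq] using this
    have h3 : ‖czAvg f q‖ ^ 2 ≤ 9 * α ^ 2 := by
      calc _ ≤ (3 * α) ^ 2 := by gcongr; exact h.norm_czAvg_le hq
        _ = _ := by ring
    have h4 : 0 ≤ 2 * α ^ (2 - s) * ‖f x‖ ^ s := by positivity
    rw [h1]; linarith
  · push Not at hx
    have h1 : czGood f Q x = f x := by
      unfold czGood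
      rw [Finset.sum_eq_zero fun q hq => Set.indicator_of_notMem (hx q hq) _, sub_zero]
    have h2 := h.off x hx
    have h5 : ‖f x‖ ≤ 2 ^ (1 / s) * α := by
      have : (‖f x‖ ^ s) ^ (1 / s) ≤ (2 * α ^ s) ^ (1 / s) :=
        Real.rpow_le_rpow (by positivity) h2 (by positivity)
      rwa [Real.mul_rpow (by norm_num) (by positivity), ← Real.rpow_mul (norm_nonneg _),
        ← Real.rpow_mul hα.le, mul_one_div_cancel (by linarith), Real.rpow_one,
            Real.rpow_one] at this
    have h6 : ‖f x‖ ^ 2 ≤ 2 * α ^ (2 - s) * ‖f x‖ ^ s := by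
      have : ‖f x‖ ^ 2 = ‖f x‖ ^ (2 - s) * ‖f x‖ ^ s := by
        rw [← Real.rpow_add_of_nonneg (norm_nonneg _) (by linarith) (by linarith)]
        rw [show 2 - s + s = ((2 : ℕ) : ℝ) by norm_num, Real.rpow_natCast]
      rw [this]
      gcongr
      calc ‖f x‖ ^ (2 - s) ≤ (2 ^ (1 / s) * α) ^ (2 - s) :=
            Real.rpow_le_rpow (norm_nonneg _) h5 (by linarith)
        _ = 2 ^ (1 / s * (2 - s)) * α ^ (2 - s) := by
            rw [Real.mul_rpow (by positivity) hα.le, ← Real.rpow_mul (by norm_num)]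
        _ ≤ 2 ^ (1 : ℝ) * α ^ (2 - s) := by
            gcongr
            · norm_num
            · rw [one_div, inv_mul_le_iff₀ (by linarith)]; linarith
        _ = _ := by rw [Real.rpow_one]
    rw [h1]; linarith

theorem integrable_indicator_sub (h : IsCZFamily f s α Q) (q : ℝ × ℝ) (z : ℂ) :
    Integrable ((czIco q).indicator (fun y => f y - z)) := by
  rw [integrable_indicator_iff (measurableSet_czIco q)]
  exact h.integrable.integrableOn.sub (integrableOn_const (by simp [czIco]))

theorem integrable_czGood (h : IsCZFamily f s α Q) : Integrable (czGood f Q) := by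
  unfold czGood
  exact h.integrable.sub (integrable_finsetSum _ fun q _ => h.integrable_indicator_sub q _)

theorem integrable_majorant (h : IsCZFamily f s α Q) : Integrable fun x =>
    2 * α ^ (2 - s) * ‖f x‖ ^ s + ∑ q ∈ Q, (czIco q).indicator (fun _ => 9 * α ^ 2) x := by
  refine (h.integrable_rpow.const_mul _).add (integrable_finsetSum _ fun q _ => ?_)
  rw [integrable_indicator_iff (measurableSet_czIco q)]
  exact integrableOn_const (by simp [czIco])

theorem memLp_czGood (h : IsCZFamily f s α Q) : MemLp (czGood f Q) 2 := by
  have hm := h.integrable_czGood.aestronglyMeasurable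
  rw [memLp_two_iff_integrable_sq_norm hm]
  refine h.integrable_majorant.mono' (by fun_prop) (ae_of_all _ fun x => ?_)
  rw [Real.norm_of_nonneg (by positivity)]
  exact h.sq_norm_czGood_le x

theorem lintegral_sq_czGood_le (h : IsCZFamily f s α Q) : ∫⁻ x, ‖czGood f Q x‖ₑ ^ 2 ≤
    ENNReal.ofReal (11 * α ^ (2 - s) * ∫ y, ‖f y‖ ^ s) := by
  have hα := h.hα
  calc ∫⁻ x, ‖czGood f Q x‖ₑ ^ 2 ≤ ∫⁻ x, ENNReal.ofReal (2 * α ^ (2 - s) * ‖f x‖ ^ s +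
        ∑ q ∈ Q, (czIco q).indicator (fun _ => 9 * α ^ 2) x) := by
        refine lintegral_mono fun x => ?_
        rw [← ofReal_norm, ← ENNReal.ofReal_pow (norm_nonneg _)]
        exact ENNReal.ofReal_le_ofReal (h.sq_norm_czGood_le x)
    _ = ENNReal.ofReal (∫ x, (2 * α ^ (2 - s) * ‖f x‖ ^ s +
        ∑ q ∈ Q, (czIco q).indicator (fun _ => 9 * α ^ 2) x)) := by
        rw [ofReal_integral_eq_lintegral_ofReal h.integrable_majorant
          (ae_of_all _ fun x => (sq_nonneg _).trans (h.sq_norm_czGood_le x))]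
    _ ≤ _ := by
        refine ENNReal.ofReal_le_ofReal ?_
        rw [integral_add (h.integrable_rpow.const_mul _) (integrable_finsetSum _ fun q _ => by
          rw [integrable_indicator_iff (measurableSet_czIco q)]
          exact integrableOn_const (by simp [czIco])), integral_const_mul, integral_finsetSum _
            (fun q _ => by
              rw [integrable_indicator_iff (measurableSet_czIco q)]
              exact integrableOn_const (by simp [czIco]))]
        have e : ∑ q ∈ Q, ∫ x, (czIco q).indicator (fun _ => 9 * α ^ 2) x =
            9 * α ^ (2 - s) * (α ^ s * ∑ q ∈ Q, 2 * q.2) := by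
          rw [Finset.mul_sum, Finset.mul_sum]
          refine Finset.sum_congr rfl fun q hq => ?_
          rw [integral_indicator (measurableSet_czIco q), setIntegral_const,
            volume_real_czIco (h.pos q hq), smul_eq_mul]
          have : α ^ 2 = α ^ (2 - s) * α ^ s := by
            rw [← Real.rpow_add hα, show 2 - s + s = ((2 : ℕ) : ℝ) by norm_num, Real.rpow_natCast]
          rw [this]; ring
        rw [e]
        have h9 : 9 * α ^ (2 - s) * (α ^ s * ∑ q ∈ Q, 2 * q.2) ≤
            9 * α ^ (2 - s) * ∫ y, ‖f y‖ ^ s := by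
          gcongr
          exact h.sum_le
        linarith

end IsCZFamily

end

section

/-- An absolute constant bounding the lacunary coefficient sums of atoms. -/
def atomConst : ℝ := 132 ^ 2 * (4 + 4 * Real.exp 50)

theorem one_le_atomConst : 1 ≤ atomConst := by
  unfold atomConst
  have := Real.exp_pos 50
  nlinarith

variable {f : ℝ → ℂ} {s α N : ℝ} {Q : Finset (ℝ × ℝ)} {ι : Type*} {J : Finset ι} {lam : ι → ℝ}

/-- The bad part on the interval `q`. -/
def czBad (f : ℝ → ℂ) (q : ℝ × ℝ) (y : ℝ) : ℂ := f y - czAvg f q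

/-- The coefficient function replacing the bad part in the compensator. -/
def czCoefFun (f : ℝ → ℂ) (Q : Finset (ℝ × ℝ)) (θ y : ℝ) : ℂ :=
  ∑ q ∈ Q, (czIco q).indicator (fun _ => (2 * q.2 : ℂ)⁻¹ * locCoef (czBad f q) q.1 q.2 θ) y

namespace IsCZFamily

theorem sum_sq_locCoef_le (h : IsCZFamily f s α Q) (hL : LacBound J lam N)
    (hαN : α ^ 2 * (N / (s - 1)) = 1) {q : ℝ × ℝ} (hq : q ∈ Q) :
    ∑ j ∈ J, (‖locCoef (czBad f q) q.1 q.2 (-lam j)‖ ^ 2 +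
      ‖locCoef (czBad f q) q.1 q.2 (lam j)‖ ^ 2) ≤ atomConst * q.2 ^ 2 := by
  refine (sum_sq_norm_locCoef_le hL h.one_lt h.lt_two (h.isLPAtom hq)).trans ?_
  have e : (2 + 4 * Real.exp 50) * (N / (s - 1)) * (132 * α) ^ 2 * q.2 ^ 2 =
      (2 + 4 * Real.exp 50) * 132 ^ 2 * q.2 ^ 2 * (α ^ 2 * (N / (s - 1))) := by ring
  rw [e, hαN, mul_one]
  refine mul_le_mul_of_nonneg_right ?_ (sq_nonneg _)
  unfold atomConst
  linarith

theorem sum_sq_dirErr_le (h : IsCZFamily f s α Q) (hL : LacBound J lam N)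
    (hαN : α ^ 2 * (N / (s - 1)) = 1) {q : ℝ × ℝ} (hq : q ∈ Q) {x : ℝ}
    (hx : 3 * q.2 ≤ |x - q.1|) :
    ∑ j ∈ J, ‖dirErr (czBad f q) q.1 q.2 (lam j) x‖ ^ 2 ≤ atomConst * (q.2 / |x - q.1|) ^ 3 := by
  refine (sum_sq_norm_dirErr_le hL h.one_lt h.lt_two (h.isLPAtom hq) hx).trans ?_
  have e : (4 + 2 * Real.exp 50) * (N / (s - 1)) * (132 * α) ^ 2 * (q.2 / |x - q.1|) ^ 3 =
      (4 + 2 * Real.exp 50) * 132 ^ 2 * (q.2 / |x - q.1|) ^ 3 * (α ^ 2 * (N / (s - 1))) := by ring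
  rw [e, hαN, mul_one]
  have := h.pos q hq
  refine mul_le_mul_of_nonneg_right ?_ (by positivity)
  unfold atomConst
  have := Real.exp_pos 50
  linarith

theorem sq_enorm_czCoefFun (h : IsCZFamily f s α Q) (θ y : ℝ) : ‖czCoefFun f Q θ y‖ₑ ^ 2 =
    ∑ q ∈ Q, (czIco q).indicator
      (fun _ => ENNReal.ofReal (‖locCoef (czBad f q) q.1 q.2 θ‖ ^ 2 / (2 * q.2) ^ 2)) y := by
  by_cases hy : ∃ q ∈ Q, y ∈ czIco q
  · obtain ⟨q, hq, hyq⟩ := hy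
    unfold czCoefFun
    rw [h.sum_indicator_eq (fun q _ => (2 * q.2 : ℂ)⁻¹ * locCoef (czBad f q) q.1 q.2 θ) hq hyq,
      Finset.sum_eq_single q, Set.indicator_of_mem hyq, ← ofReal_norm,
      ← ENNReal.ofReal_pow (norm_nonneg _), norm_mul]
    · congr 1
      have : ‖(2 * q.2 : ℂ)⁻¹‖ = (2 * q.2)⁻¹ := by simp [abs_of_pos (h.pos q hq)]
      rw [this, mul_pow, inv_pow, div_eq_inv_mul]
    · intro q' hq' hne
      exact Set.indicator_of_notMem (fun hx' => Set.disjoint_left.1 (h.disj hq' hq hne) hx' hyq) _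
    · exact fun hn => absurd hq hn
  · push Not at hy
    unfold czCoefFun
    rw [Finset.sum_eq_zero fun q hq => Set.indicator_of_notMem (hy q hq) _,
      Finset.sum_eq_zero fun q hq => Set.indicator_of_notMem (hy q hq) _]
    simp

theorem lintegral_sq_czCoefFun (h : IsCZFamily f s α Q) (θ : ℝ) :
    ∫⁻ y, ‖czCoefFun f Q θ y‖ₑ ^ 2 =
      ENNReal.ofReal (∑ q ∈ Q, ‖locCoef (czBad f q) q.1 q.2 θ‖ ^ 2 / (2 * q.2)) := by
  simp only [h.sq_enorm_czCoefFun]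
  rw [lintegral_finsetSum _ fun q _ => measurable_const.indicator (measurableSet_czIco q),
    ENNReal.ofReal_sum_of_nonneg fun q hq => by have := h.pos q hq; positivity]
  refine Finset.sum_congr rfl fun q hq => ?_
  have hq' := h.pos q hq
  rw [lintegral_indicator (measurableSet_czIco q), setLIntegral_const, czIco, Real.volume_Ico,
    ← ENNReal.ofReal_mul (by positivity)]
  congr 1
  field_simp
  ring

theorem integrable_czCoefFun (Q : Finset (ℝ × ℝ)) (f : ℝ → ℂ) (θ : ℝ) :
    Integrable (czCoefFun f Q θ) := by
  unfold czCoefFun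
  refine integrable_finsetSum _ fun q _ => ?_
  rw [integrable_indicator_iff (measurableSet_czIco q)]
  exact integrableOn_const (by simp [czIco])

theorem memLp_czCoefFun (h : IsCZFamily f s α Q) (θ : ℝ) : MemLp (czCoefFun f Q θ) 2 := by
  refine ⟨(integrable_czCoefFun Q f θ).aestronglyMeasurable, ?_⟩
  rw [eLpNorm_lt_top_iff_lintegral_rpow_enorm_lt_top (by norm_num) (by norm_num)]
  have := h.lintegral_sq_czCoefFun θ
  simp only [ENNReal.toReal_ofNat, ENNReal.rpow_ofNat]
  rw [this]
  exact ENNReal.ofReal_lt_top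

theorem integral_czCoefFun_mul (f : ℝ → ℂ) (Q : Finset (ℝ × ℝ)) {k : ℝ → ℂ}
    (hk : Continuous k) (θ : ℝ) :
    ∫ y, czCoefFun f Q θ y * k y = ∑ q ∈ Q, locCoef (czBad f q) q.1 q.2 θ *
      ((2 * q.2 : ℂ)⁻¹ * ∫ y in Set.Icc (q.1 - q.2) (q.1 + q.2), k y) := by
  unfold czCoefFun
  have e : ∀ (q : ℝ × ℝ) (z : ℂ) y, (czIco q).indicator (fun _ => z) y * k y =
      (czIco q).indicator (fun y => z * k y) y := fun q z y => by
    by_cases hy : y ∈ czIco q <;> simp [hy]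
  simp only [Finset.sum_mul, e]
  rw [integral_finsetSum _ fun q _ => by
    rw [integrable_indicator_iff (measurableSet_czIco q)]
    exact ((hk.integrableOn_Icc).mono_set Set.Ico_subset_Icc_self).const_mul _]
  refine Finset.sum_congr rfl fun q _ => ?_
  rw [integral_indicator (measurableSet_czIco q), integral_const_mul, integral_Icc_eq_integral_Ico]
  unfold czIco
  ring

theorem sum_dirComp_eq (f : ℝ → ℂ) (Q : Finset (ℝ × ℝ)) {l : ℝ} (hl : 0 < l) (x : ℝ) :
    ∑ q ∈ Q, dirComp (czBad f q) q.1 q.2 l x = (2 * π * I)⁻¹ *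
      (cexp (I * (l * x : ℝ)) *
          (∫ y, czCoefFun f Q (-l) y * (1 / (((x - y : ℝ) : ℂ) - I * (l⁻¹ : ℝ)))) -
        cexp (I * ((-l) * x : ℝ)) *
          (∫ y, czCoefFun f Q l y * (1 / (((x - y : ℝ) : ℂ) - I * (l⁻¹ : ℝ))))) := by
  have hk : Continuous fun y : ℝ => 1 / (((x - y : ℝ) : ℂ) - I * (l⁻¹ : ℝ)) := by
    refine Continuous.div continuous_const (by fun_prop) fun y hy => ?_
    have := (norm_sub_I_mul_ge (x - y) l⁻¹).2
    rw [hy, norm_zero, abs_of_pos (by positivity)] at this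
    have : 0 < l⁻¹ := by positivity
    linarith
  rw [integral_czCoefFun_mul f Q hk, integral_czCoefFun_mul f Q hk, Finset.mul_sum, Finset.mul_sum,
    ← Finset.sum_sub_distrib, Finset.mul_sum]
  refine Finset.sum_congr rfl fun q _ => ?_
  unfold dirComp cauchyAvg
  ring

theorem sq_enorm_sum_dirComp_le (f : ℝ → ℂ) (Q : Finset (ℝ × ℝ)) {l : ℝ} (hl : 0 < l) (x : ℝ) :
    ‖∑ q ∈ Q, dirComp (czBad f q) q.1 q.2 l x‖ₑ ^ 2 ≤
      ‖∫ y, czCoefFun f Q (-l) y * (1 / (((x - y : ℝ) : ℂ) - I * (l⁻¹ : ℝ)))‖ₑ ^ 2 +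
      ‖∫ y, czCoefFun f Q l y * (1 / (((x - y : ℝ) : ℂ) - I * (l⁻¹ : ℝ)))‖ₑ ^ 2 := by
  rw [sum_dirComp_eq f Q hl]
  have h1 := norm_exp_mul_sub_exp_mul_le l x
    (∫ y, czCoefFun f Q (-l) y * (1 / (((x - y : ℝ) : ℂ) - I * (l⁻¹ : ℝ))))
    (∫ y, czCoefFun f Q l y * (1 / (((x - y : ℝ) : ℂ) - I * (l⁻¹ : ℝ))))
  generalize (∫ y, czCoefFun f Q (-l) y * (1 / (((x - y : ℝ) : ℂ) - I * (l⁻¹ : ℝ)))) = u at *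
  generalize (∫ y, czCoefFun f Q l y * (1 / (((x - y : ℝ) : ℂ) - I * (l⁻¹ : ℝ)))) = v at *
  have hp : (2 * π)⁻¹ ≤ 1 / 2 := by
    rw [inv_le_comm₀ (by positivity) (by norm_num)]
    linarith [Real.pi_gt_three]
  simp only [← ofReal_norm]
  rw [← ENNReal.ofReal_pow (norm_nonneg _), ← ENNReal.ofReal_pow (norm_nonneg _),
    ← ENNReal.ofReal_pow (norm_nonneg _), ← ENNReal.ofReal_add (by positivity) (by positivity)]
  refine ENNReal.ofReal_le_ofReal ?_
  calc _ ≤ (1 / 2 * (‖u‖ + ‖v‖)) ^ 2 := by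
        gcongr
        exact h1.trans (by gcongr)
    _ ≤ _ := by nlinarith [sq_nonneg (‖u‖ - ‖v‖), sq_nonneg (‖u‖ + ‖v‖)]

theorem lintegral_sum_dirComp_le (h : IsCZFamily f s α Q) (hL : LacBound J lam N)
    (hαN : α ^ 2 * (N / (s - 1)) = 1) :
    ∑ j ∈ J, ∫⁻ x, ‖∑ q ∈ Q, dirComp (czBad f q) q.1 q.2 (lam j) x‖ₑ ^ 2 ≤
      ENNReal.ofReal ((2 * π) ^ 2 * atomConst * ∑ q ∈ Q, 2 * q.2) := by
  have hm : ∀ θ l : ℝ, Measurable fun x => ‖∫ y, czCoefFun f Q θ y *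
      (1 / (((x - y : ℝ) : ℂ) - I * (l⁻¹ : ℝ)))‖ₑ ^ 2 := fun θ l => by
    have h2 : Measurable (czCoefFun f Q θ) := by
      unfold czCoefFun
      exact Finset.measurable_sum _ fun q _ => measurable_const.indicator (measurableSet_czIco q)
    have h3 : Measurable fun z : ℝ × ℝ => czCoefFun f Q θ z.2 *
        (1 / (((z.1 - z.2 : ℝ) : ℂ) - I * (l⁻¹ : ℝ))) := by
      refine (h2.comp measurable_snd).mul ?_
      measurability
    have := h3.stronglyMeasurable.integral_prod_right' (ν := volume)
    exact this.measurable.enorm.pow_const 2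
  calc _ ≤ ∑ j ∈ J, (ENNReal.ofReal ((2 * π) ^ 2) * ENNReal.ofReal
          (∑ q ∈ Q, ‖locCoef (czBad f q) q.1 q.2 (-lam j)‖ ^ 2 / (2 * q.2)) +
        ENNReal.ofReal ((2 * π) ^ 2) * ENNReal.ofReal
          (∑ q ∈ Q, ‖locCoef (czBad f q) q.1 q.2 (lam j)‖ ^ 2 / (2 * q.2))) := by
        refine Finset.sum_le_sum fun j _ => ?_
        have hl := hL.pos j
        refine (lintegral_mono fun x => sq_enorm_sum_dirComp_le f Q hl x).trans ?_
        rw [lintegral_add_left (hm _ _)]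
        refine add_le_add ?_ ?_
        · rw [← h.lintegral_sq_czCoefFun]
          exact lintegral_enorm_cauchyKer_conv_le (integrable_czCoefFun Q f _) (h.memLp_czCoefFun _)
            (by positivity)
        · rw [← h.lintegral_sq_czCoefFun]
          exact lintegral_enorm_cauchyKer_conv_le (integrable_czCoefFun Q f _) (h.memLp_czCoefFun _)
            (by positivity)
    _ = ENNReal.ofReal ((2 * π) ^ 2 * ∑ q ∈ Q, (∑ j ∈ J,
          (‖locCoef (czBad f q) q.1 q.2 (-lam j)‖ ^ 2 +
            ‖locCoef (czBad f q) q.1 q.2 (lam j)‖ ^ 2)) / (2 * q.2)) := by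
        have nn : ∀ j θ : ℝ, ∀ q ∈ Q, 0 ≤ ‖locCoef (czBad f q) q.1 q.2 θ‖ ^ 2 / (2 * q.2) :=
          fun j θ q hq => by have := h.pos q hq; positivity
        simp only [← mul_add]
        rw [← Finset.mul_sum, ENNReal.ofReal_mul (by positivity)]
        congr 1
        simp only [Finset.sum_div]
        rw [Finset.sum_comm, ENNReal.ofReal_sum_of_nonneg]
        · refine Finset.sum_congr rfl fun j _ => ?_
          rw [← ENNReal.ofReal_add (Finset.sum_nonneg (nn 0 _)) (Finset.sum_nonneg (nn 0 _)),
            ← Finset.sum_add_distrib]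
          simp only [add_div]
        · intro j _
          exact Finset.sum_nonneg fun q hq => by have := h.pos q hq; positivity
    _ ≤ _ := by
        refine ENNReal.ofReal_le_ofReal ?_
        rw [mul_assoc, Finset.mul_sum Q _ atomConst]
        gcongr with q hq
        have hq' := h.pos q hq
        rw [div_le_iff₀ (by positivity)]
        refine (h.sum_sq_locCoef_le hL hαN hq).trans ?_
        have := one_le_atomConst
        nlinarith [sq_nonneg q.2, mul_pos (lt_of_lt_of_le one_pos this) (pow_pos hq' 2)]

end IsCZFamily

end

section

open scoped FourierTransform

/-- The kernel of the rough projection onto frequencies `l' < |ξ| ≤ l`. -/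
def lpKer (l' l u : ℝ) : ℂ := dirKer l u - dirKer l' u

/-- The rough projection of `f` onto frequencies `l' < |ξ| ≤ l`. -/
def lpPiece (l' l : ℝ) (f : ℝ → ℂ) (x : ℝ) : ℂ := ∫ y, f y * lpKer l' l (x - y)

/-- A finite family of disjoint frequency bands with lacunary end points. -/
structure LPFamily {ι : Type*} (J : Finset ι) (lo hi : ι → ℝ) (N : ℝ) : Prop where
  hlo : LacBound J lo N
  hhi : LacBound J hi N
  le : ∀ j, lo j ≤ hi j
  disj : (J : Set ι).PairwiseDisjoint fun j => Set.Ioc (lo j) (hi j)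

theorem continuous_lpKer {l' l : ℝ} (h' : 0 ≤ l') (h : 0 ≤ l) : Continuous (lpKer l' l) :=
  (continuous_dirKer h).sub (continuous_dirKer h')

theorem norm_lpKer_le {l' l : ℝ} (h' : 0 ≤ l') (h : 0 ≤ l) (u : ℝ) : ‖lpKer l' l u‖ ≤ l + l' :=
  (norm_sub_le _ _).trans (add_le_add (norm_dirKer_le h u) (norm_dirKer_le h' u))

theorem integrable_mul_lpKer {f : ℝ → ℂ} (hf : Integrable f) {l' l : ℝ} (h' : 0 ≤ l') (h : 0 ≤ l)
    (x : ℝ) : Integrable fun y => f y * lpKer l' l (x - y) :=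
  hf.mul_bdd (c := l + l') ((continuous_lpKer h' h).comp (by fun_prop)).aestronglyMeasurable
    (ae_of_all _ fun _ => norm_lpKer_le h' h _)

variable {ι : Type*} {J : Finset ι} {lo hi : ι → ℝ} {N : ℝ}

theorem fourierInv_indicator_sub {l' l : ℝ} (h' : 0 ≤ l') (h : 0 ≤ l) (u : ℝ) :
    𝓕⁻ (fun ξ => Set.indicator (Set.Icc (-(l / (2 * π))) (l / (2 * π))) (fun _ => (1 : ℂ)) ξ -
      Set.indicator (Set.Icc (-(l' / (2 * π))) (l' / (2 * π))) (fun _ => (1 : ℂ)) ξ) u =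
      lpKer l' l u := by
  unfold lpKer
  rw [← fourierInv_indicator_Icc h, ← fourierInv_indicator_Icc h']
  have hi : ∀ l : ℝ, Integrable (Set.indicator (Set.Icc (-(l / (2 * π))) (l / (2 * π)))
      (fun _ => (1 : ℂ))) := fun l => by
    rw [integrable_indicator_iff measurableSet_Icc]
    exact integrableOn_const (by simp)
  simp only [Real.fourierInv_eq, smul_sub]
  rw [integral_sub]
  · exact (Real.fourierIntegral_convergent_iff (V := ℝ) (E := ℂ) (-u)).2 (hi l) |>.congr
      (ae_of_all _ fun y => by simp)
  · exact (Real.fourierIntegral_convergent_iff (V := ℝ) (E := ℂ) (-u)).2 (hi l') |>.congr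
      (ae_of_all _ fun y => by simp)

theorem LPFamily.lintegral_sq_le (h : LPFamily J lo hi N) {g : ℝ → ℂ} (hg : Integrable g)
    (hg2 : MemLp g 2) :
    ∫⁻ x, ∑ j ∈ J, ‖lpPiece (lo j) (hi j) g x‖ₑ ^ 2 ≤ ∫⁻ x, ‖g x‖ₑ ^ 2 := by
  have key := lintegral_sum_enorm_multiplier_le J hg hg2
    (fun j ξ => Set.indicator (Set.Icc (-(hi j / (2 * π))) (hi j / (2 * π))) (fun _ => (1 : ℂ)) ξ -
      Set.indicator (Set.Icc (-(lo j / (2 * π))) (lo j / (2 * π))) (fun _ => (1 : ℂ)) ξ)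
    (fun j _ => by
      refine Integrable.sub ?_ ?_ <;> rw [integrable_indicator_iff measurableSet_Icc] <;>
      exact integrableOn_const (by simp)) 1 (fun ξ => by
      have hval : ∀ j, ‖Set.indicator (Set.Icc (-(hi j / (2 * π))) (hi j / (2 * π)))
          (fun _ => (1 : ℂ)) ξ - Set.indicator (Set.Icc (-(lo j / (2 * π))) (lo j / (2 * π)))
          (fun _ => (1 : ℂ)) ξ‖ ^ 2 = Set.indicator (Set.Ioc (lo j) (hi j)) (fun _ => (1 : ℝ))
            (2 * π * |ξ|) := by
        intro j
        have hmem : ∀ l : ℝ, ξ ∈ Set.Icc (-(l / (2 * π))) (l / (2 * π)) ↔ 2 * π * |ξ| ≤ l := by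
          intro l
          rw [Set.mem_Icc, ← abs_le, le_div_iff₀ (by positivity), mul_comm]
        have hle := h.le j
        by_cases h1 : 2 * π * |ξ| ≤ lo j
        · have h2 : 2 * π * |ξ| ≤ hi j := h1.trans hle
          rw [Set.indicator_of_mem ((hmem _).2 h1), Set.indicator_of_mem ((hmem _).2 h2),
            Set.indicator_of_notMem (fun hh => by linarith [hh.1])]
          simp
        · by_cases h2 : 2 * π * |ξ| ≤ hi j
          · rw [Set.indicator_of_notMem (fun hh => h1 ((hmem _).1 hh)),
              Set.indicator_of_mem ((hmem _).2 h2), Set.indicator_of_mem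
                (show 2 * π * |ξ| ∈ Set.Ioc (lo j) (hi j) from ⟨not_le.1 h1, h2⟩)]
            simp
          · rw [Set.indicator_of_notMem (fun hh => h1 ((hmem _).1 hh)),
              Set.indicator_of_notMem (fun hh => h2 ((hmem _).1 hh)),
              Set.indicator_of_notMem (fun hh => h2 hh.2)]
            simp
      simp only [hval]
      by_cases hx : ∃ j ∈ J, 2 * π * |ξ| ∈ Set.Ioc (lo j) (hi j)
      · obtain ⟨j, hj, hxj⟩ := hx
        rw [Finset.sum_eq_single j, Set.indicator_of_mem hxj]
        · intro j' hj' hne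
          exact Set.indicator_of_notMem
            (fun hx' => Set.disjoint_left.1 (h.disj hj' hj hne) hx' hxj) _
        · exact fun hn => absurd hj hn
      · push Not at hx
        rw [Finset.sum_eq_zero fun j hj => Set.indicator_of_notMem (hx j hj) _]
        norm_num)
  have e : ∀ j u, 𝓕⁻ (fun ξ => Set.indicator (Set.Icc (-(hi j / (2 * π))) (hi j / (2 * π)))
      (fun _ => (1 : ℂ)) ξ - Set.indicator (Set.Icc (-(lo j / (2 * π))) (lo j / (2 * π)))
      (fun _ => (1 : ℂ)) ξ) u = lpKer (lo j) (hi j) u := fun j u =>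
    fourierInv_indicator_sub (h.hlo.pos j).le (h.hhi.pos j).le u
  simp only [e, ENNReal.ofReal_one, one_mul] at key
  exact key

theorem lpPiece_eq_of_czFamily {f : ℝ → ℂ} {s α : ℝ} {Q : Finset (ℝ × ℝ)} (h : IsCZFamily f s α Q)
    {l' l : ℝ} (h' : 0 < l') (hl : 0 < l) (x : ℝ) :
    lpPiece l' l f x = lpPiece l' l (czGood f Q) x +
      (∑ q ∈ Q, dirComp (czBad f q) q.1 q.2 l x - ∑ q ∈ Q, dirComp (czBad f q) q.1 q.2 l' x) +
      (∑ q ∈ Q, dirErr (czBad f q) q.1 q.2 l x - ∑ q ∈ Q, dirErr (czBad f q) q.1 q.2 l' x) := by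
  have e1 : ∀ q, dirComp (czBad f q) q.1 q.2 l x - dirComp (czBad f q) q.1 q.2 l' x +
      (dirErr (czBad f q) q.1 q.2 l x - dirErr (czBad f q) q.1 q.2 l' x) =
      ∫ y, (czIco q).indicator (czBad f q) y * lpKer l' l (x - y) := by
    intro q
    have hcont : Continuous (czBad f q) := h.cont.sub continuous_const
    have e : ∀ y, (czIco q).indicator (czBad f q) y * lpKer l' l (x - y) =
        (czIco q).indicator (fun y => czBad f q y * lpKer l' l (x - y)) y := fun y => by
      by_cases hy : y ∈ czIco q <;> simp [hy]
    simp only [e]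
    rw [integral_indicator (measurableSet_czIco q)]
    have e3 : ∫ y in czIco q, czBad f q y * lpKer l' l (x - y) =
        (∫ y in czIco q, czBad f q y * dirKer l (x - y)) -
          ∫ y in czIco q, czBad f q y * dirKer l' (x - y) := by
      rw [← integral_sub]
      · refine integral_congr_ae (ae_of_all _ fun y => ?_)
        simp only [lpKer]; ring
      · exact ((hcont.mul ((continuous_dirKer hl.le).comp (by fun_prop))).integrableOn_Icc.mono_set
          Set.Ico_subset_Icc_self)
      · exact ((hcont.mul ((continuous_dirKer h'.le).comp (by fun_prop))).integrableOn_Icc.mono_set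
          Set.Ico_subset_Icc_self)
    rw [e3]
    unfold dirErr
    rw [integral_Icc_eq_integral_Ico, integral_Icc_eq_integral_Ico]
    unfold czIco
    ring
  have e2 : lpPiece l' l f x = lpPiece l' l (czGood f Q) x +
      ∑ q ∈ Q, ∫ y, (czIco q).indicator (czBad f q) y * lpKer l' l (x - y) := by
    unfold lpPiece
    have i1 : ∀ q ∈ Q, Integrable fun y => (czIco q).indicator (czBad f q) y * lpKer l' l (x - y) :=
      fun q _ => integrable_mul_lpKer (h.integrable_indicator_sub q _) h'.le hl.le x
    rw [← integral_finsetSum _ i1, ← integral_add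
      (integrable_mul_lpKer h.integrable_czGood h'.le hl.le x) (integrable_finsetSum _ i1)]
    refine integral_congr_ae (ae_of_all _ fun y => ?_)
    have eb : ∀ q, czBad f q = fun y => f y - czAvg f q := fun _ => rfl
    simp only [czGood, ← Finset.sum_mul, eb]
    ring
  rw [e2, ← Finset.sum_congr rfl fun q _ => e1 q]
  simp only [Finset.sum_add_distrib, Finset.sum_sub_distrib]
  ring

end

section

open scoped FourierTransform

theorem sqrt_sum_sq_norm_sum_le {ι κ : Type*} (J : Finset ι) (Q : Finset κ) (e : κ → ι → ℂ) :
    √(∑ j ∈ J, ‖∑ q ∈ Q, e q j‖ ^ 2) ≤ ∑ q ∈ Q, √(∑ j ∈ J, ‖e q j‖ ^ 2) := by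
  have := norm_sum_le Q fun q => (WithLp.toLp 2 fun j : J => e q j : EuclideanSpace ℂ J)
  simp only [EuclideanSpace.norm_eq] at this
  simp only [← Finset.sum_coe_sort J]
  simpa [WithLp.ofLp_sum] using this

/-- The integral of the majorant of the tails. -/
def tailConst : ℝ := ∫ u : ℝ, (1 + ‖u‖) ^ (-(3 / 2 : ℝ))

theorem integrable_tail : Integrable fun u : ℝ => (1 + ‖u‖) ^ (-(3 / 2 : ℝ)) :=
  integrable_one_add_norm (by simp; norm_num)

theorem tailConst_nonneg : 0 ≤ tailConst := integral_nonneg fun u => by positivity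

theorem lintegral_tail (K c : ℝ) (hK : 0 ≤ K) {r : ℝ} (hr : 0 < r) :
    ∫⁻ x, ENNReal.ofReal (K * (1 + ‖(x - c) / r‖) ^ (-(3 / 2 : ℝ))) =
      ENNReal.ofReal (K * (r * tailConst)) := by
  rw [← ofReal_integral_eq_lintegral_ofReal]
  · congr 1
    rw [integral_const_mul]
    congr 1
    rw [integral_sub_right_eq_self (fun x => (1 + ‖x / r‖) ^ (-(3 / 2 : ℝ))) c]
    rw [Measure.integral_comp_div (fun x => (1 + ‖x‖) ^ (-(3 / 2 : ℝ))) r, abs_of_pos hr,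
        smul_eq_mul]
    rfl
  · exact (((integrable_tail.comp_div hr.ne').comp_sub_right c).const_mul K)
  · exact ae_of_all _ fun x => by positivity

theorem sqrt_le_tail {K X r : ℝ} (hK : 0 ≤ K) (hr : 0 < r) (hX : 3 * r ≤ |X|) :
    √(K * (r / |X|) ^ 3) ≤ 2 * √K * (1 + ‖X / r‖) ^ (-(3 / 2 : ℝ)) := by
  have hX0 : 0 < |X| := by linarith
  rw [Real.norm_eq_abs, abs_div, abs_of_pos hr]
  set t := |X| / r with ht
  have ht3 : 3 ≤ t := by rw [ht, le_div_iff₀ hr]; exact hX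
  have e : r / |X| = t⁻¹ := by rw [ht, inv_div]
  rw [e]
  have h0 : 0 < 1 + t := by linarith
  refine Real.sqrt_le_iff.2 ⟨by positivity, ?_⟩
  have h1 : ((1 + t) ^ (-(3 / 2 : ℝ))) ^ 2 = ((1 + t) ^ 3)⁻¹ := by
    rw [← Real.rpow_natCast, ← Real.rpow_mul h0.le, ← Real.rpow_natCast, ← Real.rpow_neg h0.le]
    norm_num
  have h2 : (1 + t) ^ 3 ≤ 4 * t ^ 3 := by
    nlinarith [mul_nonneg (sub_nonneg.2 ht3) (sub_nonneg.2 ht3), pow_pos (by linarith : 0 < t) 3,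
      mul_nonneg (mul_nonneg (sub_nonneg.2 ht3) (sub_nonneg.2 ht3)) (by linarith : 0 ≤ t)]
  have h3 : (t ^ 3)⁻¹ ≤ 4 * ((1 + t) ^ 3)⁻¹ := by
    have : 0 < t ^ 3 := by positivity
    rw [← div_eq_mul_inv, inv_eq_one_div, div_le_div_iff₀ this (by positivity)]
    linarith
  rw [mul_pow, mul_pow, h1, Real.sq_sqrt hK, inv_pow]
  nlinarith [mul_le_mul_of_nonneg_left h3 hK]

variable {ι : Type*} {J : Finset ι} {lo hi : ι → ℝ} {N : ℝ} {f : ℝ → ℂ} {s α : ℝ}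
  {Q : Finset (ℝ × ℝ)}

theorem sum_sq_sum_dirErr_le {lam : ι → ℝ} (h : IsCZFamily f s α Q) (hL : LacBound J lam N)
    (hαN : α ^ 2 * (N / (s - 1)) = 1) {x : ℝ} (hx : ∀ q ∈ Q, 3 * q.2 ≤ |x - q.1|) :
    ∑ j ∈ J, ‖∑ q ∈ Q, dirErr (czBad f q) q.1 q.2 (lam j) x‖ ^ 2 ≤
      (∑ q ∈ Q, 2 * √atomConst * (1 + ‖(x - q.1) / q.2‖) ^ (-(3 / 2 : ℝ))) ^ 2 := by
  rw [← Real.sqrt_le_left (Finset.sum_nonneg fun q _ => by positivity)]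
  refine (sqrt_sum_sq_norm_sum_le J Q fun q j => dirErr (czBad f q) q.1 q.2 (lam j) x).trans ?_
  refine Finset.sum_le_sum fun q hq => ?_
  exact (Real.sqrt_le_sqrt (h.sum_sq_dirErr_le hL hαN hq (hx q hq))).trans
    (sqrt_le_tail (zero_le_one.trans one_le_atomConst) (h.pos q hq) (hx q hq))

theorem sq_norm_add_five_le (a b c d e : ℂ) : ‖a + (b - c) + (d - e)‖ ^ 2 ≤
    5 * (‖a‖ ^ 2 + ‖b‖ ^ 2 + ‖c‖ ^ 2) + 5 * (‖d‖ ^ 2 + ‖e‖ ^ 2) := by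
  have h : ‖a + (b - c) + (d - e)‖ ≤ ‖a‖ + ‖b‖ + ‖c‖ + ‖d‖ + ‖e‖ := by
    have h1 := norm_add_le (a + (b - c)) (d - e)
    have h2 := norm_add_le a (b - c)
    have h3 := norm_sub_le b c
    have h4 := norm_sub_le d e
    linarith
  calc _ ≤ (‖a‖ + ‖b‖ + ‖c‖ + ‖d‖ + ‖e‖) ^ 2 := by gcongr
    _ ≤ _ := by
      nlinarith [sq_nonneg (‖a‖ - ‖b‖), sq_nonneg (‖a‖ - ‖c‖), sq_nonneg (‖a‖ - ‖d‖),
        sq_nonneg (‖a‖ - ‖e‖), sq_nonneg (‖b‖ - ‖c‖), sq_nonneg (‖b‖ - ‖d‖),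
        sq_nonneg (‖b‖ - ‖e‖), sq_nonneg (‖c‖ - ‖d‖), sq_nonneg (‖c‖ - ‖e‖), sq_nonneg (‖d‖ - ‖e‖)]

theorem min_sum_sq_lpPiece_le_of_far (h : IsCZFamily f s α Q) (hF : LPFamily J lo hi N)
    (hαN : α ^ 2 * (N / (s - 1)) = 1) {x : ℝ} (hx : ∀ q ∈ Q, 3 * q.2 ≤ |x - q.1|) :
    min (∑ j ∈ J, ‖lpPiece (lo j) (hi j) f x‖ ^ 2) 1 ≤
      5 * (∑ j ∈ J, ‖lpPiece (lo j) (hi j) (czGood f Q) x‖ ^ 2 +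
        ∑ j ∈ J, ‖∑ q ∈ Q, dirComp (czBad f q) q.1 q.2 (hi j) x‖ ^ 2 +
        ∑ j ∈ J, ‖∑ q ∈ Q, dirComp (czBad f q) q.1 q.2 (lo j) x‖ ^ 2) +
      ∑ q ∈ Q, 20 * √atomConst * (1 + ‖(x - q.1) / q.2‖) ^ (-(3 / 2 : ℝ)) := by
  have e1 := sum_sq_sum_dirErr_le h hF.hhi hαN hx
  have e2 := sum_sq_sum_dirErr_le h hF.hlo hαN hx
  have e3 : ∑ q ∈ Q, 20 * √atomConst * (1 + ‖(x - q.1) / q.2‖) ^ (-(3 / 2 : ℝ)) =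
      10 * ∑ q ∈ Q, 2 * √atomConst * (1 + ‖(x - q.1) / q.2‖) ^ (-(3 / 2 : ℝ)) := by
    rw [Finset.mul_sum]
    refine Finset.sum_congr rfl fun q _ => by ring
  rw [e3]
  set D := ∑ q ∈ Q, 2 * √atomConst * (1 + ‖(x - q.1) / q.2‖) ^ (-(3 / 2 : ℝ)) with hD
  have hD0 : 0 ≤ D := Finset.sum_nonneg fun q _ => by positivity
  have hS : ∑ j ∈ J, ‖lpPiece (lo j) (hi j) f x‖ ^ 2 ≤
      5 * (∑ j ∈ J, ‖lpPiece (lo j) (hi j) (czGood f Q) x‖ ^ 2 +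
        ∑ j ∈ J, ‖∑ q ∈ Q, dirComp (czBad f q) q.1 q.2 (hi j) x‖ ^ 2 +
        ∑ j ∈ J, ‖∑ q ∈ Q, dirComp (czBad f q) q.1 q.2 (lo j) x‖ ^ 2) +
      5 * (∑ j ∈ J, ‖∑ q ∈ Q, dirErr (czBad f q) q.1 q.2 (hi j) x‖ ^ 2 +
        ∑ j ∈ J, ‖∑ q ∈ Q, dirErr (czBad f q) q.1 q.2 (lo j) x‖ ^ 2) := by
    simp only [← Finset.sum_add_distrib, Finset.mul_sum]
    refine Finset.sum_le_sum fun j _ => ?_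
    rw [lpPiece_eq_of_czFamily h (hF.hlo.pos j) (hF.hhi.pos j)]
    exact sq_norm_add_five_le _ _ _ _ _
  have hA : 0 ≤ ∑ j ∈ J, ‖lpPiece (lo j) (hi j) (czGood f Q) x‖ ^ 2 +
        ∑ j ∈ J, ‖∑ q ∈ Q, dirComp (czBad f q) q.1 q.2 (hi j) x‖ ^ 2 +
        ∑ j ∈ J, ‖∑ q ∈ Q, dirComp (czBad f q) q.1 q.2 (lo j) x‖ ^ 2 := by positivity
  rcases le_or_gt D 1 with h1 | h1
  · refine (min_le_left _ _).trans (hS.trans ?_)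
    nlinarith
  · refine (min_le_right _ _).trans ?_
    linarith

/-- The absolute constant of the truncated weak-type estimate. -/
def weakConst : ℝ := 55 + 10 * ((2 * π) ^ 2 * atomConst) + 3 + 10 * (√atomConst * tailConst)

theorem weakConst_pos : 0 < weakConst := by
  have := one_le_atomConst
  have := tailConst_nonneg
  unfold weakConst
  positivity

theorem ofReal_sum_sq_norm {κ : Type*} (J : Finset κ) (z : κ → ℂ) :
    ENNReal.ofReal (∑ j ∈ J, ‖z j‖ ^ 2) = ∑ j ∈ J, ‖z j‖ₑ ^ 2 := by
  rw [ENNReal.ofReal_sum_of_nonneg fun j _ => by positivity]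
  refine Finset.sum_congr rfl fun j _ => ?_
  rw [← ofReal_norm, ENNReal.ofReal_pow (norm_nonneg _)]

theorem min_sum_sq_lpPiece_le (h : IsCZFamily f s α Q) (hF : LPFamily J lo hi N)
    (hαN : α ^ 2 * (N / (s - 1)) = 1) (x : ℝ) :
    min (∑ j ∈ J, ‖lpPiece (lo j) (hi j) f x‖ₑ ^ 2) 1 ≤
      5 * (∑ j ∈ J, ‖lpPiece (lo j) (hi j) (czGood f Q) x‖ₑ ^ 2 +
        ∑ j ∈ J, ‖∑ q ∈ Q, dirComp (czBad f q) q.1 q.2 (hi j) x‖ₑ ^ 2 +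
        ∑ j ∈ J, ‖∑ q ∈ Q, dirComp (czBad f q) q.1 q.2 (lo j) x‖ₑ ^ 2) +
      ((∑ q ∈ Q, ENNReal.ofReal (20 * √atomConst * (1 + ‖(x - q.1) / q.2‖) ^ (-(3 / 2 : ℝ)))) +
      ∑ q ∈ Q, (Set.Ioo (q.1 - 3 * q.2) (q.1 + 3 * q.2)).indicator 1 x) := by
  by_cases hx : ∀ q ∈ Q, 3 * q.2 ≤ |x - q.1|
  · have key := ENNReal.ofReal_le_ofReal (min_sum_sq_lpPiece_le_of_far h hF hαN hx)
    rw [ENNReal.ofReal_min, ENNReal.ofReal_one, ofReal_sum_sq_norm, ENNReal.ofReal_add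
      (by positivity) (by positivity), ENNReal.ofReal_mul (by norm_num), ENNReal.ofReal_add
      (by positivity) (by positivity), ENNReal.ofReal_add (by positivity) (by positivity),
      ofReal_sum_sq_norm, ofReal_sum_sq_norm, ofReal_sum_sq_norm,
      ENNReal.ofReal_sum_of_nonneg fun q _ => by positivity, ENNReal.ofReal_ofNat] at key
    refine key.trans ?_
    gcongr
    exact le_self_add
  · push Not at hx
    obtain ⟨q, hq, hxq⟩ := hx
    rw [abs_lt] at hxq
    refine (min_le_right _ _).trans ?_
    refine le_trans ?_ (le_add_self.trans le_add_self)
    refine le_trans ?_ (Finset.single_le_sum (f := fun q : ℝ × ℝ =>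
      (Set.Ioo (q.1 - 3 * q.2) (q.1 + 3 * q.2)).indicator (1 : ℝ → ℝ≥0∞) x)
      (fun _ _ => bot_le) hq)
    rw [Set.indicator_of_mem (show x ∈ Set.Ioo (q.1 - 3 * q.2) (q.1 + 3 * q.2) from
      ⟨by linarith [hxq.1], by linarith [hxq.2]⟩)]
    rfl

theorem measurable_integral_mul_sub {g k : ℝ → ℂ} (hg : Measurable g) (hk : Measurable k) :
    Measurable fun x => ∫ y, g y * k (x - y) := by
  have h3 : Measurable fun z : ℝ × ℝ => g z.2 * k (z.1 - z.2) :=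
    (hg.comp measurable_snd).mul (hk.comp (measurable_fst.sub measurable_snd))
  exact h3.stronglyMeasurable.integral_prod_right' (ν := volume) |>.measurable

theorem measurable_lpPiece {g : ℝ → ℂ} (hg : Measurable g) {l' l : ℝ} (h' : 0 ≤ l') (h : 0 ≤ l) :
    Measurable (lpPiece l' l g) :=
  measurable_integral_mul_sub hg (continuous_lpKer h' h).measurable

theorem measurable_czGood (h : IsCZFamily f s α Q) : Measurable (czGood f Q) := by
  unfold czGood
  exact h.cont.measurable.sub (Finset.measurable_sum _ fun q _ =>
    (h.cont.measurable.sub_const _).indicator (measurableSet_czIco q))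

theorem measurable_sum_dirComp (f : ℝ → ℂ) (Q : Finset (ℝ × ℝ)) {l : ℝ} (hl : 0 < l) :
    Measurable fun x => ∑ q ∈ Q, dirComp (czBad f q) q.1 q.2 l x := by
  have h2 : ∀ θ, Measurable (czCoefFun f Q θ) := fun θ => by
    unfold czCoefFun
    exact Finset.measurable_sum _ fun q _ => measurable_const.indicator (measurableSet_czIco q)
  have h3 : ∀ θ, Measurable fun x : ℝ =>
      ∫ y, czCoefFun f Q θ y * (1 / (((x - y : ℝ) : ℂ) - I * (l⁻¹ : ℝ))) := fun θ =>
    measurable_integral_mul_sub (k := fun u => 1 / ((u : ℂ) - I * (l⁻¹ : ℝ))) (h2 θ)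
      (by measurability)
  simp only [IsCZFamily.sum_dirComp_eq f Q hl]
  exact (((by fun_prop : Measurable fun x : ℝ => cexp (I * (l * x : ℝ))).mul (h3 _)).sub
    ((by fun_prop : Measurable fun x : ℝ => cexp (I * ((-l) * x : ℝ))).mul (h3 _))).const_mul _

theorem lintegral_min_sum_sq_le_of_czFamily (h : IsCZFamily f s α Q) (hF : LPFamily J lo hi N)
    (hαN : α ^ 2 * (N / (s - 1)) = 1) (hα1 : α ≤ 1) :
    ∫⁻ x, min (∑ j ∈ J, ‖lpPiece (lo j) (hi j) f x‖ₑ ^ 2) 1 ≤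
      ENNReal.ofReal (weakConst * α ^ (-s) * ∫ y, ‖f y‖ ^ s) := by
  have hα := h.hα
  have hac : 0 < atomConst := one_pos.trans_le one_le_atomConst
  have hF0 : 0 ≤ ∫ y, ‖f y‖ ^ s := integral_nonneg fun y => by positivity
  have mG : Measurable fun x => ∑ j ∈ J, ‖lpPiece (lo j) (hi j) (czGood f Q) x‖ₑ ^ 2 :=
    Finset.measurable_sum _ fun j _ => ((measurable_lpPiece (measurable_czGood h)
      (hF.hlo.pos j).le (hF.hhi.pos j).le).enorm.pow_const 2)
  have mC : ∀ {lam : ι → ℝ}, LacBound J lam N → ∀ j,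
      Measurable fun x => ‖∑ q ∈ Q, dirComp (czBad f q) q.1 q.2 (lam j) x‖ₑ ^ 2 :=
    fun hL j => (measurable_sum_dirComp f Q (hL.pos j)).enorm.pow_const 2
  have iC : ∀ {lam : ι → ℝ}, LacBound J lam N →
      ∫⁻ x, ∑ j ∈ J, ‖∑ q ∈ Q, dirComp (czBad f q) q.1 q.2 (lam j) x‖ₑ ^ 2 ≤
      ENNReal.ofReal ((2 * π) ^ 2 * atomConst * ∑ q ∈ Q, 2 * q.2) := fun hL => by
    rw [lintegral_finsetSum _ fun j _ => mC hL j]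
    exact h.lintegral_sum_dirComp_le hL hαN
  have iG := (hF.lintegral_sq_le h.integrable_czGood h.memLp_czGood).trans h.lintegral_sq_czGood_le
  have mT : ∀ q : ℝ × ℝ, Measurable fun x =>
      ENNReal.ofReal (20 * √atomConst * (1 + ‖(x - q.1) / q.2‖) ^ (-(3 / 2 : ℝ))) := fun q =>
    ENNReal.measurable_ofReal.comp (measurable_const.mul
      ((by fun_prop : Measurable fun x => 1 + ‖(x - q.1) / q.2‖).pow_const _))
  have iT : ∫⁻ x, ∑ q ∈ Q,
      ENNReal.ofReal (20 * √atomConst * (1 + ‖(x - q.1) / q.2‖) ^ (-(3 / 2 : ℝ))) =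
      ENNReal.ofReal (10 * (√atomConst * tailConst) * ∑ q ∈ Q, 2 * q.2) := by
    rw [lintegral_finsetSum _ fun q _ => mT q, Finset.mul_sum, ENNReal.ofReal_sum_of_nonneg]
    · refine Finset.sum_congr rfl fun q hq => ?_
      rw [lintegral_tail _ _ (by positivity) (h.pos q hq)]
      congr 1; ring
    · intro q hq
      have := h.pos q hq
      have := tailConst_nonneg
      positivity
  have iI : ∫⁻ x, ∑ q ∈ Q, (Set.Ioo (q.1 - 3 * q.2) (q.1 + 3 * q.2)).indicator
      (1 : ℝ → ℝ≥0∞) x = ENNReal.ofReal (3 * ∑ q ∈ Q, 2 * q.2) := by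
    rw [lintegral_finsetSum _ fun q _ => measurable_one.indicator measurableSet_Ioo, Finset.mul_sum,
      ENNReal.ofReal_sum_of_nonneg fun q hq => by have := h.pos q hq; positivity]
    refine Finset.sum_congr rfl fun q hq => ?_
    rw [lintegral_indicator_one measurableSet_Ioo, Real.volume_Ioo]
    congr 1; ring
  have hsum : ∑ q ∈ Q, 2 * q.2 ≤ α ^ (-s) * ∫ y, ‖f y‖ ^ s := by
    rw [Real.rpow_neg hα.le, ← div_eq_inv_mul, le_div_iff₀ (by positivity), mul_comm]
    exact h.sum_le
  have hsum0 : 0 ≤ ∑ q ∈ Q, 2 * q.2 :=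
    Finset.sum_nonneg fun q hq => by have := h.pos q hq; positivity
  have ht0 := tailConst_nonneg
  calc _ ≤ ∫⁻ x, (5 * (∑ j ∈ J, ‖lpPiece (lo j) (hi j) (czGood f Q) x‖ₑ ^ 2 +
        ∑ j ∈ J, ‖∑ q ∈ Q, dirComp (czBad f q) q.1 q.2 (hi j) x‖ₑ ^ 2 +
        ∑ j ∈ J, ‖∑ q ∈ Q, dirComp (czBad f q) q.1 q.2 (lo j) x‖ₑ ^ 2) +
      ((∑ q ∈ Q, ENNReal.ofReal (20 * √atomConst * (1 + ‖(x - q.1) / q.2‖) ^ (-(3 / 2 : ℝ)))) +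
      ∑ q ∈ Q, (Set.Ioo (q.1 - 3 * q.2) (q.1 + 3 * q.2)).indicator 1 x)) :=
        lintegral_mono fun x => min_sum_sq_lpPiece_le h hF hαN x
    _ ≤ 5 * (ENNReal.ofReal (11 * α ^ (2 - s) * ∫ y, ‖f y‖ ^ s) +
          ENNReal.ofReal ((2 * π) ^ 2 * atomConst * ∑ q ∈ Q, 2 * q.2) +
          ENNReal.ofReal ((2 * π) ^ 2 * atomConst * ∑ q ∈ Q, 2 * q.2)) +
        (ENNReal.ofReal (10 * (√atomConst * tailConst) * ∑ q ∈ Q, 2 * q.2) +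
          ENNReal.ofReal (3 * ∑ q ∈ Q, 2 * q.2)) := by
        have mCh := Finset.measurable_sum J fun j _ => mC hF.hhi j
        have mCl := Finset.measurable_sum J fun j _ => mC hF.hlo j
        rw [lintegral_add_left, lintegral_const_mul, lintegral_add_left, lintegral_add_left,
          lintegral_add_left, iT, iI]
        · gcongr
          · exact iC hF.hhi
          · exact iC hF.hlo
        · exact Finset.measurable_sum _ fun q _ => mT q
        · exact mG
        · exact mG.add mCh
        · exact (mG.add mCh).add mCl
        · exact ((mG.add mCh).add mCl).const_mul 5
    _ = ENNReal.ofReal (5 * (11 * α ^ (2 - s) * (∫ y, ‖f y‖ ^ s) +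
          (2 * π) ^ 2 * atomConst * (∑ q ∈ Q, 2 * q.2) +
          (2 * π) ^ 2 * atomConst * (∑ q ∈ Q, 2 * q.2)) +
        (10 * (√atomConst * tailConst) * (∑ q ∈ Q, 2 * q.2) + 3 * ∑ q ∈ Q, 2 * q.2)) := by
        have hg : ∀ A B D E : ℝ, 0 ≤ A → 0 ≤ B → 0 ≤ D → 0 ≤ E →
            5 * (ENNReal.ofReal A + ENNReal.ofReal B + ENNReal.ofReal B) +
              (ENNReal.ofReal D + ENNReal.ofReal E) =
            ENNReal.ofReal (5 * (A + B + B) + (D + E)) := fun A B D E hA hB hD hE => by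
          rw [ENNReal.ofReal_add (by positivity) (by positivity), ENNReal.ofReal_mul (by norm_num),
            ENNReal.ofReal_add (by positivity) (by positivity),
            ENNReal.ofReal_add (by positivity) (by positivity),
            ENNReal.ofReal_add (by positivity) (by positivity), ENNReal.ofReal_ofNat]
        exact hg _ _ _ _ (by positivity) (by positivity) (by positivity) (by positivity)
    _ ≤ _ := by
        refine ENNReal.ofReal_le_ofReal ?_
        have hp : α ^ (2 - s) * (∫ y, ‖f y‖ ^ s) ≤ α ^ (-s) * ∫ y, ‖f y‖ ^ s := by
          refine mul_le_mul_of_nonneg_right ?_ hF0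
          exact Real.rpow_le_rpow_of_exponent_ge hα hα1 (by linarith)
        set W := α ^ (-s) * ∫ y, ‖f y‖ ^ s with hW
        set T := ∑ q ∈ Q, 2 * q.2 with hT
        calc _ = 55 * (α ^ (2 - s) * ∫ y, ‖f y‖ ^ s) + (10 * ((2 * π) ^ 2 * atomConst) + 3 +
              10 * (√atomConst * tailConst)) * T := by ring
          _ ≤ 55 * W + (10 * ((2 * π) ^ 2 * atomConst) + 3 +
              10 * (√atomConst * tailConst)) * W := by gcongr
          _ = _ := by rw [weakConst, mul_assoc, ← hW]; ring

end

section

variable {ι : Type*} {J : Finset ι} {lo hi : ι → ℝ} {N : ℝ} {f : ℝ → ℂ} {s : ℝ}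

theorem lintegral_min_sum_sq_le_one (hF : LPFamily J lo hi N) (hc : Continuous f)
    (hf : HasCompactSupport f) (hs : 1 < s) (hs2 : s < 2) :
    ∫⁻ x, min (∑ j ∈ J, ‖lpPiece (lo j) (hi j) f x‖ₑ ^ 2) 1 ≤
      ENNReal.ofReal (weakConst * (N / (s - 1)) ^ (s / 2) * ∫ y, ‖f y‖ ^ s) := by
  have hN := hF.hlo.one_le
  have hs1 : 0 < s - 1 := by linarith
  set M := N / (s - 1) with hM
  have hM1 : 1 ≤ M := by rw [hM, le_div_iff₀ hs1]; linarith
  have hM0 : 0 < M := by linarith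
  have hα : 0 < M ^ (-(1 / 2 : ℝ)) := by positivity
  obtain ⟨Q, hQ⟩ := exists_isCZFamily hc hf hs hs2 hα
  have h1 : (M ^ (-(1 / 2 : ℝ))) ^ 2 * M = 1 := by
    rw [← Real.rpow_natCast, ← Real.rpow_mul hM0.le]
    norm_num [Real.rpow_neg_one]
    field_simp
  have h2 : (M ^ (-(1 / 2 : ℝ))) ^ (-s) = M ^ (s / 2) := by
    rw [← Real.rpow_mul hM0.le]; congr 1; ring
  rw [← h2]
  exact lintegral_min_sum_sq_le_of_czFamily hQ hF h1
    (Real.rpow_le_one_of_one_le_of_nonpos hM1 (by norm_num))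

theorem lpPiece_const_mul (l' l : ℝ) (c : ℂ) (f : ℝ → ℂ) (x : ℝ) :
    lpPiece l' l (fun y => c * f y) x = c * lpPiece l' l f x := by
  simp only [lpPiece, mul_assoc, integral_const_mul]

theorem lpPiece_add {l' l : ℝ} (h' : 0 ≤ l') (h : 0 ≤ l) {f g : ℝ → ℂ} (hf : Integrable f)
    (hg : Integrable g) (x : ℝ) :
    lpPiece l' l (fun y => f y + g y) x = lpPiece l' l f x + lpPiece l' l g x := by
  simp only [lpPiece, add_mul]
  exact integral_add (integrable_mul_lpKer hf h' h x) (integrable_mul_lpKer hg h' h x)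

theorem lintegral_min_sum_sq_le (hF : LPFamily J lo hi N) (hc : Continuous f)
    (hf : HasCompactSupport f) (hs : 1 < s) (hs2 : s < 2) {t : ℝ} (ht : 0 < t) :
    ∫⁻ x, min (∑ j ∈ J, ‖lpPiece (lo j) (hi j) f x‖ₑ ^ 2) (ENNReal.ofReal t ^ 2) ≤
      ENNReal.ofReal (weakConst * (N / (s - 1)) ^ (s / 2) * t ^ (2 - s)) * ∫⁻ y, ‖f y‖ₑ ^ s := by
  have key := lintegral_min_sum_sq_le_one hF (f := fun y => ((t⁻¹ : ℝ) : ℂ) * f y) (by fun_prop)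
    (hf.mul_left) hs hs2
  have hN := hF.hlo.one_le
  have hM0 : 0 ≤ N / (s - 1) := div_nonneg (by linarith) (by linarith)
  have hw := weakConst_pos
  have ht0 : ENNReal.ofReal t ≠ 0 := by simpa using ht
  have e1 : ‖((t⁻¹ : ℝ) : ℂ)‖ₑ = (ENNReal.ofReal t)⁻¹ := by
    rw [← ofReal_norm, Complex.norm_real, Real.norm_of_nonneg (by positivity),
      ENNReal.ofReal_inv_of_pos ht]
  have e2 : ∀ x, min (∑ j ∈ J, ‖lpPiece (lo j) (hi j) f x‖ₑ ^ 2) (ENNReal.ofReal t ^ 2) =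
      ENNReal.ofReal t ^ 2 *
        min (∑ j ∈ J, ‖lpPiece (lo j) (hi j) (fun y => ((t⁻¹ : ℝ) : ℂ) * f y) x‖ₑ ^ 2) 1 := by
    intro x
    simp only [lpPiece_const_mul, enorm_mul, e1, mul_pow, ← Finset.mul_sum]
    rw [mul_min, ← mul_assoc, ← mul_pow, ENNReal.mul_inv_cancel ht0 ENNReal.ofReal_ne_top, one_pow,
      one_mul, mul_one]
  have e3 : ENNReal.ofReal (∫ y, ‖((t⁻¹ : ℝ) : ℂ) * f y‖ ^ s) =
      ENNReal.ofReal (t ^ (-s)) * ∫⁻ y, ‖f y‖ₑ ^ s := by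
    have e4 : ∀ y, ‖((t⁻¹ : ℝ) : ℂ) * f y‖ ^ s = t ^ (-s) * ‖f y‖ ^ s := fun y => by
      rw [norm_mul, Complex.norm_real, Real.norm_of_nonneg (by positivity),
        Real.mul_rpow (by positivity) (norm_nonneg _), Real.inv_rpow ht.le, Real.rpow_neg ht.le]
    simp only [e4, integral_const_mul]
    rw [ENNReal.ofReal_mul (by positivity), ofReal_integral_eq_lintegral_ofReal]
    · congr 1
      refine lintegral_congr fun y => ?_
      rw [← ofReal_norm, ENNReal.ofReal_rpow_of_nonneg (norm_nonneg _) (by linarith)]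
    · exact (hc.norm_rpow' (by linarith)).integrable_of_hasCompactSupport
        (HasCompactSupport.norm_rpow hf (by linarith))
    · exact ae_of_all _ fun y => by positivity
  simp only [e2]
  rw [lintegral_const_mul' _ _ (by finiteness)]
  refine (mul_le_mul_right key _).trans (le_of_eq ?_)
  rw [ENNReal.ofReal_mul (by positivity), e3, ← ENNReal.ofReal_pow ht.le, ← mul_assoc, ← mul_assoc,
    ← ENNReal.ofReal_mul (by positivity), ← ENNReal.ofReal_mul (by positivity)]
  congr 2
  have e5 : t ^ (2 - s) = t ^ 2 * t ^ (-s) := by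
    rw [sub_eq_add_neg, Real.rpow_add ht, Real.rpow_two]
  rw [e5]
  ring

theorem min_sum_sq_add_le (J : Finset ι) (a b : ι → ℂ) (τ : ℝ≥0∞) :
    min (∑ j ∈ J, ‖a j + b j‖ₑ ^ 2) τ ≤
      2 * ∑ j ∈ J, ‖a j‖ₑ ^ 2 + 2 * min (∑ j ∈ J, ‖b j‖ₑ ^ 2) τ := by
  have h1 : ∑ j ∈ J, ‖a j + b j‖ₑ ^ 2 ≤ 2 * ∑ j ∈ J, ‖a j‖ₑ ^ 2 + 2 * ∑ j ∈ J, ‖b j‖ₑ ^ 2 := by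
    rw [← ofReal_sum_sq_norm, ← ofReal_sum_sq_norm, ← ofReal_sum_sq_norm,
      ← ENNReal.ofReal_ofNat 2, ← ENNReal.ofReal_mul (by norm_num),
      ← ENNReal.ofReal_mul (by norm_num), ← ENNReal.ofReal_add (by positivity) (by positivity)]
    refine ENNReal.ofReal_le_ofReal ?_
    rw [Finset.mul_sum, Finset.mul_sum, ← Finset.sum_add_distrib]
    refine Finset.sum_le_sum fun j _ => ?_
    have := norm_add_le (a j) (b j)
    nlinarith [sq_nonneg (‖a j‖ - ‖b j‖), norm_nonneg (a j + b j), norm_nonneg (a j),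
      norm_nonneg (b j)]
  rcases le_total (∑ j ∈ J, ‖b j‖ₑ ^ 2) τ with h | h
  · rw [min_eq_left h]; exact (min_le_left _ _).trans h1
  · rw [min_eq_right h]
    refine (min_le_right _ _).trans (le_add_self.trans' ?_)
    rw [two_mul]; exact le_self_add

theorem lintegral_Ioi_rpow_mul_min {p a : ℝ} (hp : 1 < p) (hp2 : p < 2) (ha : 0 ≤ a) :
    ∫⁻ t in Set.Ioi (0 : ℝ), ENNReal.ofReal (t ^ (p - 3)) *
      min (ENNReal.ofReal a ^ 2) (ENNReal.ofReal t ^ 2) =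
      ENNReal.ofReal ((1 / p + 1 / (2 - p)) * a ^ p) := by
  rcases ha.eq_or_lt with rfl | ha
  · rw [Real.zero_rpow (by linarith)]; simp
  have hu : Set.Ioi (0 : ℝ) = Set.Ioc 0 a ∪ Set.Ioi a := by rw [Set.Ioc_union_Ioi_eq_Ioi ha.le]
  rw [hu, lintegral_union measurableSet_Ioi (Set.Ioc_disjoint_Ioi le_rfl)]
  have h1 : ∫⁻ t in Set.Ioc 0 a, ENNReal.ofReal (t ^ (p - 3)) *
      min (ENNReal.ofReal a ^ 2) (ENNReal.ofReal t ^ 2) = ENNReal.ofReal (a ^ p / p) := by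
    have e : ∫⁻ t in Set.Ioc 0 a, ENNReal.ofReal (t ^ (p - 3)) *
      min (ENNReal.ofReal a ^ 2) (ENNReal.ofReal t ^ 2) =
      ∫⁻ t in Set.Ioc 0 a, ENNReal.ofReal (t ^ (p - 1)) := by
      refine setLIntegral_congr_fun measurableSet_Ioc fun t ht => ?_
      have ht0 : 0 < t := ht.1
      rw [min_eq_right (by gcongr; exact ht.2), ← ENNReal.ofReal_pow ht0.le,
        ← ENNReal.ofReal_mul (by positivity), ← Real.rpow_natCast, ← Real.rpow_add ht0]
      congr 2; push_cast; ring
    rw [e, ← ofReal_integral_eq_lintegral_ofReal]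
    · rw [← intervalIntegral.integral_of_le ha.le, integral_rpow (Or.inl (by linarith))]
      simp only [sub_add_cancel]
      rw [Real.zero_rpow (by linarith), sub_zero]
    · exact (intervalIntegral.intervalIntegrable_rpow' (by linarith)).1
    · exact (ae_restrict_mem measurableSet_Ioc).mono fun t ht => Real.rpow_nonneg ht.1.le _
  have h2 : ∫⁻ t in Set.Ioi a, ENNReal.ofReal (t ^ (p - 3)) *
      min (ENNReal.ofReal a ^ 2) (ENNReal.ofReal t ^ 2) = ENNReal.ofReal (a ^ p / (2 - p)) := by
    have e : ∫⁻ t in Set.Ioi a, ENNReal.ofReal (t ^ (p - 3)) *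
      min (ENNReal.ofReal a ^ 2) (ENNReal.ofReal t ^ 2) =
      ∫⁻ t in Set.Ioi a, ENNReal.ofReal (a ^ 2 * t ^ (p - 3)) := by
      refine setLIntegral_congr_fun measurableSet_Ioi fun t ht => ?_
      have ht' : a < t := ht
      have ht0 : 0 < t := ha.trans ht
      rw [min_eq_left (by gcongr), ← ENNReal.ofReal_pow ha.le,
        ← ENNReal.ofReal_mul (by positivity), mul_comm]
    rw [e, ← ofReal_integral_eq_lintegral_ofReal]
    · rw [integral_const_mul, integral_Ioi_rpow_of_lt (by linarith) ha]
      congr 1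
      have e2 : a ^ p = a ^ 2 * a ^ (p - 3 + 1) := by
        rw [← Real.rpow_natCast, ← Real.rpow_add ha]; congr 1; push_cast; ring
      rw [e2]
      have : p - 3 + 1 ≠ 0 := by linarith
      have : 2 - p ≠ 0 := by linarith
      have e3 : p - 3 + 1 = -(2 - p) := by ring
      rw [e3]
      field_simp
    · exact (integrableOn_Ioi_rpow_of_lt (by linarith) ha).const_mul _
    · refine (ae_restrict_mem measurableSet_Ioi).mono fun t ht => ?_
      have ht0 : 0 < t := ha.trans ht
      simp only [Pi.zero_apply]
      positivity
  have : 0 < 2 - p := by linarith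
  rw [h1, h2, ← ENNReal.ofReal_add (by positivity) (by positivity)]
  congr 1; ring

theorem lintegral_Ioi_rpow_mul_sub_le {p s a : ℝ} (hs : 1 < s) (hp : s < p) (ha : 0 ≤ a) :
    ∫⁻ t in Set.Ioi (0 : ℝ), ENNReal.ofReal (t ^ (p - 1 - s)) * ENNReal.ofReal (a - t) ^ s ≤
      ENNReal.ofReal (a ^ p / (p - s)) := by
  have hps : 0 < p - s := by linarith
  have h0 : ∀ t ∈ Set.Ioi (0 : ℝ), ENNReal.ofReal (t ^ (p - 1 - s)) * ENNReal.ofReal (a - t) ^ s ≤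
      (Set.Ioc 0 a).indicator (fun t => ENNReal.ofReal (a ^ s * t ^ (p - 1 - s))) t := by
    intro t ht
    have ht0 : 0 < t := ht
    by_cases hta : t ≤ a
    · rw [Set.indicator_of_mem (show t ∈ Set.Ioc 0 a from ⟨ht, hta⟩), mul_comm (a ^ s),
        ENNReal.ofReal_mul (by positivity), ← ENNReal.ofReal_rpow_of_nonneg ha (by linarith)]
      gcongr
      linarith
    · rw [ENNReal.ofReal_of_nonpos (by linarith : a - t ≤ 0),
        ENNReal.zero_rpow_of_pos (by linarith)]
      simp
  refine (setLIntegral_mono' measurableSet_Ioi h0).trans ?_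
  refine (setLIntegral_le_lintegral _ _).trans ?_
  rw [lintegral_indicator measurableSet_Ioc, ← ofReal_integral_eq_lintegral_ofReal]
  · rw [integral_const_mul, ← intervalIntegral.integral_of_le ha,
      integral_rpow (Or.inl (by linarith))]
    have e : p - 1 - s + 1 = p - s := by ring
    rw [e, Real.zero_rpow (by linarith), sub_zero]
    rcases ha.eq_or_lt with rfl | ha
    · rw [Real.zero_rpow (by linarith), Real.zero_rpow (by linarith)]; simp
    rw [← mul_div_assoc, ← Real.rpow_add ha]
    refine le_of_eq ?_
    congr 3; ring
  · exact (intervalIntegral.intervalIntegrable_rpow' (by linarith)).1.const_mul _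
  · refine (ae_restrict_mem measurableSet_Ioc).mono fun t ht => ?_
    have ht0 : 0 < t := ht.1
    simp only [Pi.zero_apply]
    positivity
/-- The bounded part of the truncation of `z` at height `t`. -/
def truncLow (t : ℝ) (z : ℂ) : ℂ := ((t / max ‖z‖ t : ℝ) : ℂ) * z

/-- The unbounded part of the truncation of `z` at height `t`. -/
def truncHigh (t : ℝ) (z : ℂ) : ℂ := ((1 - t / max ‖z‖ t : ℝ) : ℂ) * z

theorem truncLow_add_truncHigh (t : ℝ) (z : ℂ) : truncLow t z + truncHigh t z = z := by
  simp only [truncLow, truncHigh]; push_cast; ring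

theorem continuous_truncLow {t : ℝ} (ht : 0 < t) : Continuous (truncLow t) := by
  have : ∀ z : ℂ, max ‖z‖ t ≠ 0 := fun z => (ht.trans_le (le_max_right _ _)).ne'
  unfold truncLow
  fun_prop (disch := exact this _)

theorem continuous_truncHigh {t : ℝ} (ht : 0 < t) : Continuous (truncHigh t) := by
  have : ∀ z : ℂ, max ‖z‖ t ≠ 0 := fun z => (ht.trans_le (le_max_right _ _)).ne'
  unfold truncHigh
  fun_prop (disch := exact this _)

theorem enorm_truncLow_sq {t : ℝ} (ht : 0 < t) (z : ℂ) :
    ‖truncLow t z‖ₑ ^ 2 = min (ENNReal.ofReal ‖z‖ ^ 2) (ENNReal.ofReal t ^ 2) := by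
  have h : ‖truncLow t z‖ = min ‖z‖ t := by
    rw [truncLow, norm_mul, Complex.norm_real, Real.norm_of_nonneg (by positivity)]
    rcases le_total ‖z‖ t with h | h
    · rw [max_eq_right h, min_eq_left h, div_self ht.ne', one_mul]
    · have : ‖z‖ ≠ 0 := by linarith
      rw [max_eq_left h, min_eq_right h]; field_simp
  rw [← ofReal_norm, h, ENNReal.ofReal_min]
  rcases le_total (ENNReal.ofReal ‖z‖) (ENNReal.ofReal t) with h | h
  · rw [min_eq_left h, min_eq_left (by gcongr)]
  · rw [min_eq_right h, min_eq_right (by gcongr)]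

theorem enorm_truncHigh {t : ℝ} (ht : 0 < t) (z : ℂ) :
    ‖truncHigh t z‖ₑ = ENNReal.ofReal (‖z‖ - t) := by
  have hd : t / max ‖z‖ t ≤ 1 := div_le_one_of_le₀ (le_max_right _ _) (by positivity)
  rw [← ofReal_norm, truncHigh, norm_mul, Complex.norm_real, Real.norm_of_nonneg (by linarith)]
  rcases le_total ‖z‖ t with h | h
  · rw [max_eq_right h, div_self ht.ne', sub_self, zero_mul, ENNReal.ofReal_zero,
      ENNReal.ofReal_of_nonpos (by linarith)]
  · have : ‖z‖ ≠ 0 := by linarith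
    rw [max_eq_left h]; congr 1; field_simp

set_option maxHeartbeats 1000000 in
theorem lintegral_rpow_sum_sq_le_of_lt (hF : LPFamily J lo hi N) (hc : Continuous f)
    (hf : HasCompactSupport f) {p : ℝ} (hs : 1 < s) (hsp : s < p) (hp2 : p < 2) :
    ∫⁻ x, (∑ j ∈ J, ‖lpPiece (lo j) (hi j) f x‖ₑ ^ 2) ^ (p / 2) ≤
      ENNReal.ofReal (2 + 2 * (weakConst * (N / (s - 1)) ^ (s / 2)) / (p - s)) *
        ∫⁻ y, ‖f y‖ₑ ^ p := by
  have hN := hF.hlo.one_le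
  have hp : 1 < p := hs.trans hsp
  have hM0 : 0 ≤ N / (s - 1) := div_nonneg (by linarith) (by linarith)
  have hps : 0 < p - s := by linarith
  have h2p : 0 < 2 - p := by linarith
  have hw := weakConst_pos
  set K := weakConst * (N / (s - 1)) ^ (s / 2) with hK
  have hK0 : 0 ≤ K := by positivity
  set c := 1 / p + 1 / (2 - p) with hcdef
  have hc1 : 1 ≤ c := by
    have h1 : 1 ≤ 1 / (2 - p) := by rw [le_div_iff₀ h2p]; linarith
    have h2 : 0 < 1 / p := by positivity
    linarith
  set S : ℝ → ℝ := fun x => √(∑ j ∈ J, ‖lpPiece (lo j) (hi j) f x‖ ^ 2) with hS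
  have hS2 : ∀ x, ENNReal.ofReal (S x) ^ 2 = ∑ j ∈ J, ‖lpPiece (lo j) (hi j) f x‖ₑ ^ 2 :=
      fun x => by
    rw [← ENNReal.ofReal_pow (Real.sqrt_nonneg _), Real.sq_sqrt (by positivity),
      ofReal_sum_sq_norm]
  have mS : Measurable fun x => ENNReal.ofReal (S x) := by
    refine ENNReal.measurable_ofReal.comp (Measurable.sqrt (Finset.measurable_sum _ fun j _ => ?_))
    exact (measurable_lpPiece hc.measurable (hF.hlo.pos j).le (hF.hhi.pos j).le).norm.pow_const 2
  have mf : Measurable fun x => ENNReal.ofReal ‖f x‖ :=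
    ENNReal.measurable_ofReal.comp hc.measurable.norm
  have mw : ∀ r : ℝ, Measurable fun t : ℝ => ENNReal.ofReal (t ^ r) := fun r =>
    ENNReal.measurable_ofReal.comp (measurable_id.pow_const r)
  have mMin : ∀ {g : ℝ → ℝ≥0∞}, Measurable g → Measurable fun z : ℝ × ℝ =>
      ENNReal.ofReal (z.1 ^ (p - 3)) * min (g z.2 ^ 2) (ENNReal.ofReal z.1 ^ 2) := fun hg =>
    ((mw _).comp measurable_fst).mul (((hg.comp measurable_snd).pow_const 2).min
      ((ENNReal.measurable_ofReal.comp measurable_fst).pow_const 2))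
  have mHigh : Measurable fun z : ℝ × ℝ =>
      ENNReal.ofReal (z.1 ^ (p - 1 - s)) * ENNReal.ofReal (‖f z.2‖ - z.1) ^ s :=
    ((mw _).comp measurable_fst).mul ((ENNReal.measurable_ofReal.comp
      ((hc.measurable.norm.comp measurable_snd).sub measurable_fst)).pow_const s)
  have hfp : ∀ y, ENNReal.ofReal (‖f y‖ ^ p) = ‖f y‖ₑ ^ p := fun y => by
    rw [← ofReal_norm, ENNReal.ofReal_rpow_of_nonneg (norm_nonneg _) (by linarith)]
  have hSp : ∀ x, ENNReal.ofReal (S x ^ p) =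
      (∑ j ∈ J, ‖lpPiece (lo j) (hi j) f x‖ₑ ^ 2) ^ (p / 2) := fun x => by
    rw [← hS2, ← ENNReal.rpow_natCast, ← ENNReal.rpow_mul,
      ← ENNReal.ofReal_rpow_of_nonneg (Real.sqrt_nonneg _) (by linarith)]
    congr 1; push_cast; ring
  have hlevel : ∀ t ∈ Set.Ioi (0 : ℝ),
      ∫⁻ x, ENNReal.ofReal (t ^ (p - 3)) * min (ENNReal.ofReal (S x) ^ 2) (ENNReal.ofReal t ^ 2) ≤
      2 * (∫⁻ x, ENNReal.ofReal (t ^ (p - 3)) *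
        min (ENNReal.ofReal ‖f x‖ ^ 2) (ENNReal.ofReal t ^ 2)) +
      ENNReal.ofReal (2 * K) *
        ∫⁻ x, ENNReal.ofReal (t ^ (p - 1 - s)) * ENNReal.ofReal (‖f x‖ - t) ^ s := by
    intro t ht
    have ht0 : 0 < t := ht
    have cL : Continuous fun y => truncLow t (f y) := (continuous_truncLow ht0).comp hc
    have cH : Continuous fun y => truncHigh t (f y) := (continuous_truncHigh ht0).comp hc
    have sL : HasCompactSupport fun y => truncLow t (f y) :=
      HasCompactSupport.comp_left (g := truncLow t) hf (by simp [truncLow])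
    have sH : HasCompactSupport fun y => truncHigh t (f y) :=
      HasCompactSupport.comp_left (g := truncHigh t) hf (by simp [truncHigh])
    have iL := cL.integrable_of_hasCompactSupport (μ := volume) sL
    have iH := cH.integrable_of_hasCompactSupport (μ := volume) sH
    have hdec : ∀ j x, lpPiece (lo j) (hi j) f x =
        lpPiece (lo j) (hi j) (fun y => truncLow t (f y)) x +
        lpPiece (lo j) (hi j) (fun y => truncHigh t (f y)) x := fun j x => by
      rw [← lpPiece_add (hF.hlo.pos j).le (hF.hhi.pos j).le iL iH]
      simp only [truncLow_add_truncHigh]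
    have hb := lintegral_min_sum_sq_le hF cH sH hs (hsp.trans hp2) ht0
    have hg := hF.lintegral_sq_le iL (cL.memLp_of_hasCompactSupport sL)
    simp only [enorm_truncLow_sq ht0] at hg
    simp only [enorm_truncHigh ht0] at hb
    have mL : Measurable fun x => ∑ j ∈ J,
        ‖lpPiece (lo j) (hi j) (fun y => truncLow t (f y)) x‖ₑ ^ 2 :=
      Finset.measurable_sum _ fun j _ => (measurable_lpPiece cL.measurable
        (hF.hlo.pos j).le (hF.hhi.pos j).le).enorm.pow_const 2
    rw [lintegral_const_mul' _ _ ENNReal.ofReal_ne_top,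
      lintegral_const_mul' _ _ ENNReal.ofReal_ne_top,
      lintegral_const_mul' _ _ ENNReal.ofReal_ne_top]
    have hmin : ∫⁻ x, min (ENNReal.ofReal (S x) ^ 2) (ENNReal.ofReal t ^ 2) ≤
        2 * (∫⁻ x, min (ENNReal.ofReal ‖f x‖ ^ 2) (ENNReal.ofReal t ^ 2)) +
        2 * (ENNReal.ofReal (K * t ^ (2 - s)) * ∫⁻ x, ENNReal.ofReal (‖f x‖ - t) ^ s) := by
      calc _ ≤ ∫⁻ x, (2 * ∑ j ∈ J,
              ‖lpPiece (lo j) (hi j) (fun y => truncLow t (f y)) x‖ₑ ^ 2 +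
            2 * min (∑ j ∈ J, ‖lpPiece (lo j) (hi j) (fun y => truncHigh t (f y)) x‖ₑ ^ 2)
              (ENNReal.ofReal t ^ 2)) := by
            refine lintegral_mono fun x => ?_
            simp only [hS2, hdec]
            exact min_sum_sq_add_le _ _ _ _
        _ ≤ _ := by
            rw [lintegral_add_left (mL.const_mul 2), lintegral_const_mul' _ _ (by simp),
              lintegral_const_mul' _ _ (by simp)]
            gcongr
    refine (mul_le_mul_right hmin _).trans (le_of_eq ?_)
    have e : t ^ (p - 1 - s) = t ^ (p - 3) * t ^ (2 - s) := by
      rw [← Real.rpow_add ht0]; congr 1; ring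
    rw [e, ENNReal.ofReal_mul (by positivity : 0 ≤ t ^ (p - 3)),
      ENNReal.ofReal_mul (p := K) hK0, ENNReal.ofReal_mul (p := 2) (by norm_num),
      ENNReal.ofReal_ofNat]
    ring
  have key : ENNReal.ofReal c * ∫⁻ x, (∑ j ∈ J, ‖lpPiece (lo j) (hi j) f x‖ₑ ^ 2) ^ (p / 2) ≤
      2 * (ENNReal.ofReal c * ∫⁻ y, ‖f y‖ₑ ^ p) +
        ENNReal.ofReal (2 * K) * (ENNReal.ofReal (p - s)⁻¹ * ∫⁻ y, ‖f y‖ₑ ^ p) := by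
    calc _ = ∫⁻ x, ∫⁻ t in Set.Ioi (0 : ℝ), ENNReal.ofReal (t ^ (p - 3)) *
          min (ENNReal.ofReal (S x) ^ 2) (ENNReal.ofReal t ^ 2) := by
          rw [← lintegral_const_mul' _ _ ENNReal.ofReal_ne_top]
          refine lintegral_congr fun x => ?_
          rw [lintegral_Ioi_rpow_mul_min hp hp2 (Real.sqrt_nonneg _),
            ENNReal.ofReal_mul (by linarith), hSp]
      _ = ∫⁻ t in Set.Ioi (0 : ℝ), ∫⁻ x, ENNReal.ofReal (t ^ (p - 3)) *
          min (ENNReal.ofReal (S x) ^ 2) (ENNReal.ofReal t ^ 2) :=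
          lintegral_lintegral_swap ((mMin mS).comp measurable_swap).aemeasurable
      _ ≤ ∫⁻ t in Set.Ioi (0 : ℝ), (2 * (∫⁻ x, ENNReal.ofReal (t ^ (p - 3)) *
            min (ENNReal.ofReal ‖f x‖ ^ 2) (ENNReal.ofReal t ^ 2)) +
          ENNReal.ofReal (2 * K) *
            ∫⁻ x, ENNReal.ofReal (t ^ (p - 1 - s)) * ENNReal.ofReal (‖f x‖ - t) ^ s) :=
          setLIntegral_mono' measurableSet_Ioi hlevel
      _ = 2 * (∫⁻ x, ∫⁻ t in Set.Ioi (0 : ℝ), ENNReal.ofReal (t ^ (p - 3)) *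
            min (ENNReal.ofReal ‖f x‖ ^ 2) (ENNReal.ofReal t ^ 2)) +
          ENNReal.ofReal (2 * K) * (∫⁻ x, ∫⁻ t in Set.Ioi (0 : ℝ),
            ENNReal.ofReal (t ^ (p - 1 - s)) * ENNReal.ofReal (‖f x‖ - t) ^ s) := by
          rw [lintegral_add_left (((mMin mf).lintegral_prod_right').const_mul 2),
            lintegral_const_mul' _ _ (by simp), lintegral_const_mul' _ _ ENNReal.ofReal_ne_top]
          congr 2
          · exact lintegral_lintegral_swap (mMin mf).aemeasurable
          · exact lintegral_lintegral_swap mHigh.aemeasurable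
      _ ≤ _ := by
          rw [← lintegral_const_mul' (ENNReal.ofReal c) _ ENNReal.ofReal_ne_top,
            ← lintegral_const_mul' (ENNReal.ofReal (p - s)⁻¹) _ ENNReal.ofReal_ne_top]
          refine add_le_add (mul_le_mul_right (lintegral_mono fun x => ?_) _)
            (mul_le_mul_right (lintegral_mono fun x => ?_) _)
          · rw [lintegral_Ioi_rpow_mul_min hp hp2 (norm_nonneg _),
              ENNReal.ofReal_mul (by linarith), hfp]
          · refine (lintegral_Ioi_rpow_mul_sub_le hs hsp (norm_nonneg _)).trans (le_of_eq ?_)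
            rw [div_eq_inv_mul, ENNReal.ofReal_mul (by positivity), hfp]
  clear_value c K
  have hc0 : ENNReal.ofReal c ≠ 0 := by simp; linarith
  rw [← ENNReal.mul_le_mul_iff_right hc0 ENNReal.ofReal_ne_top]
  refine key.trans ?_
  rw [ENNReal.ofReal_add (by norm_num) (by positivity), div_eq_mul_inv,
    ENNReal.ofReal_mul (by positivity : 0 ≤ 2 * K), add_mul, mul_add, ENNReal.ofReal_ofNat]
  have h1 : (1 : ℝ≥0∞) ≤ ENNReal.ofReal c := ENNReal.one_le_ofReal.2 hc1
  refine add_le_add (le_of_eq (by ring)) ?_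
  rw [← mul_assoc (ENNReal.ofReal (2 * K))]
  exact le_mul_of_one_le_left bot_le h1

end

section

/-- The absolute constant of the one-dimensional `L^p` estimate. -/
def lpConst : ℝ := 2 + 8 * weakConst

theorem one_le_lpConst : 1 ≤ lpConst := by
  have := weakConst_pos
  unfold lpConst
  linarith

/-- The bound for the norm of the one-dimensional square function on `L^p`. -/
def lpBound (N p : ℝ) : ℝ := lpConst * √N * (p - 1) ^ (-(3 / 2) : ℝ)

theorem lpBound_nonneg {N p : ℝ} (hp : 1 < p) : 0 ≤ lpBound N p := by
  have : 0 < p - 1 := by linarith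
  have := one_le_lpConst
  unfold lpBound
  positivity

theorem interpolation_const_le {N p : ℝ} (hN : 1 ≤ N) (hp : 1 < p) (hp2 : p < 2) :
    2 + 2 * (weakConst * (N / ((1 + p) / 2 - 1)) ^ ((1 + p) / 2 / 2)) / (p - (1 + p) / 2) ≤
      lpBound N p ^ p := by
  have hw := weakConst_pos
  have hN0 : 0 < N := by linarith
  obtain ⟨δ, hδ⟩ : ∃ δ, δ = p - 1 := ⟨_, rfl⟩
  have hδ0 : 0 < δ := by linarith
  have hδ1 : δ ≤ 1 := by linarith
  have e1 : N / ((1 + p) / 2 - 1) = 2 * N * δ⁻¹ := by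
    have : (1 + p) / 2 - 1 = δ / 2 := by rw [hδ]; ring
    rw [this]; field_simp
  have e2 : p - (1 + p) / 2 = δ / 2 := by rw [hδ]; ring
  have e3 : (2 * N * δ⁻¹) ^ ((1 + p) / 2 / 2) ≤ 2 * N ^ (p / 2) * (δ⁻¹) ^ ((1 + p) / 2 / 2) := by
    rw [Real.mul_rpow (by positivity) (by positivity), Real.mul_rpow (by positivity) hN0.le]
    gcongr
    · calc (2 : ℝ) ^ ((1 + p) / 2 / 2) ≤ 2 ^ (1 : ℝ) :=
          Real.rpow_le_rpow_of_exponent_le (by norm_num) (by linarith)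
        _ = 2 := Real.rpow_one _
    · linarith
  have e4 : (δ⁻¹) ^ ((1 + p) / 2 / 2) * δ⁻¹ ≤ δ⁻¹ ^ (3 / 2 * p) := by
    have h1 : 1 ≤ δ⁻¹ := (one_le_inv₀ hδ0).2 hδ1
    calc _ = δ⁻¹ ^ ((1 + p) / 2 / 2 + 1) := by
          rw [Real.rpow_add (by positivity), Real.rpow_one]
      _ ≤ _ := Real.rpow_le_rpow_of_exponent_le h1 (by linarith)
  have h5 : 1 ≤ N ^ (p / 2) * δ⁻¹ ^ (3 / 2 * p) := by
    have h1 : 1 ≤ δ⁻¹ := (one_le_inv₀ hδ0).2 hδ1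
    exact one_le_mul_of_one_le_of_one_le (Real.one_le_rpow hN (by linarith))
      (Real.one_le_rpow h1 (by linarith))
  have h6 : lpBound N p ^ p = lpConst ^ p * (N ^ (p / 2) * δ⁻¹ ^ (3 / 2 * p)) := by
    have hc := one_le_lpConst
    rw [lpBound, ← hδ, Real.mul_rpow (by positivity) (by positivity),
      Real.mul_rpow (by positivity) (by positivity), Real.sqrt_eq_rpow, ← Real.rpow_mul hN0.le,
      ← Real.rpow_mul hδ0.le, Real.inv_rpow hδ0.le, ← Real.rpow_neg hδ0.le, mul_assoc]
    rw [show 1 / 2 * p = p / 2 by ring, show -(3 / 2) * p = -(3 / 2 * p) by ring]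
  have h7 : lpConst ≤ lpConst ^ p := by
    conv_lhs => rw [← Real.rpow_one lpConst]
    exact Real.rpow_le_rpow_of_exponent_le one_le_lpConst hp.le
  rw [e1, e2, h6]
  calc _ ≤ 2 + 2 * (weakConst * (2 * N ^ (p / 2) * (δ⁻¹) ^ ((1 + p) / 2 / 2))) / (δ / 2) := by
        gcongr
    _ = 2 + 8 * weakConst * (N ^ (p / 2) * ((δ⁻¹) ^ ((1 + p) / 2 / 2) * δ⁻¹)) := by
        field_simp; ring
    _ ≤ 2 * (N ^ (p / 2) * δ⁻¹ ^ (3 / 2 * p)) +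
        8 * weakConst * (N ^ (p / 2) * δ⁻¹ ^ (3 / 2 * p)) := by
        gcongr
        linarith
    _ = lpConst * (N ^ (p / 2) * δ⁻¹ ^ (3 / 2 * p)) := by rw [lpConst]; ring
    _ ≤ _ := by gcongr

variable {ι : Type*} {J : Finset ι} {lo hi : ι → ℝ} {N : ℝ} {f : ℝ → ℂ} {p : ℝ}

theorem lintegral_rpow_sum_sq_le_of_compact (hF : LPFamily J lo hi N) (hc : Continuous f)
    (hf : HasCompactSupport f) (hp : 1 < p) (hp2 : p < 2) :
    ∫⁻ x, (∑ j ∈ J, ‖lpPiece (lo j) (hi j) f x‖ₑ ^ 2) ^ (p / 2) ≤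
      ENNReal.ofReal (lpBound N p ^ p) * ∫⁻ y, ‖f y‖ₑ ^ p := by
  refine (lintegral_rpow_sum_sq_le_of_lt hF hc hf (s := (1 + p) / 2) (by linarith) (by linarith)
    hp2).trans ?_
  gcongr
  exact interpolation_const_le hF.hlo.one_le hp hp2

/-- A continuous cutoff, equal to one on `[-n, n]`. -/
def cutoff (n : ℕ) (y : ℝ) : ℝ := max 0 (min 1 (n + 1 - |y|))

theorem continuous_cutoff (n : ℕ) : Continuous (cutoff n) := by
  unfold cutoff; fun_prop

theorem cutoff_nonneg (n : ℕ) (y : ℝ) : 0 ≤ cutoff n y := le_max_left _ _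

theorem cutoff_le_one (n : ℕ) (y : ℝ) : cutoff n y ≤ 1 := max_le zero_le_one (min_le_left _ _)

theorem cutoff_eq_one {n : ℕ} {y : ℝ} (h : |y| ≤ n) : cutoff n y = 1 := by
  rw [cutoff, min_eq_left (by linarith), max_eq_right zero_le_one]

theorem hasCompactSupport_cutoff (n : ℕ) : HasCompactSupport (cutoff n) :=
  HasCompactSupport.intro (isCompact_closedBall (0 : ℝ) (n + 1)) fun y hy => by
    simp only [Metric.mem_closedBall, dist_zero_right, Real.norm_eq_abs, not_le] at hy
    rw [cutoff, max_eq_left]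
    exact (min_le_right _ _).trans (by linarith)

theorem lintegral_rpow_sum_sq_le (hF : LPFamily J lo hi N) (hc : Continuous f)
    (hf : Integrable f) (hp : 1 < p) (hp2 : p < 2) :
    ∫⁻ x, (∑ j ∈ J, ‖lpPiece (lo j) (hi j) f x‖ₑ ^ 2) ^ (p / 2) ≤
      ENNReal.ofReal (lpBound N p ^ p) * ∫⁻ y, ‖f y‖ₑ ^ p := by
  set g : ℕ → ℝ → ℂ := fun n y => (cutoff n y : ℂ) * f y with hg
  have hgc : ∀ n, Continuous (g n) := fun n => by
    have := continuous_cutoff n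
    fun_prop
  have hgle : ∀ n y, ‖g n y‖ ≤ ‖f y‖ := fun n y => by
    rw [hg, norm_mul, Complex.norm_real, Real.norm_of_nonneg (cutoff_nonneg n y)]
    exact mul_le_of_le_one_left (norm_nonneg _) (cutoff_le_one n y)
  have hgs : ∀ n, HasCompactSupport (g n) := fun n =>
    (HasCompactSupport.comp_left (g := fun r : ℝ => (r : ℂ)) (hasCompactSupport_cutoff n)
      (by simp)).mul_right
  have hglim : ∀ y, ∀ᶠ n in atTop, g n y = f y := fun y => by
    filter_upwards [tendsto_natCast_atTop_atTop.eventually_ge_atTop |y|] with n hn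
    simp [hg, cutoff_eq_one hn]
  have hlim : ∀ j x, Tendsto (fun n => lpPiece (lo j) (hi j) (g n) x) atTop
      (𝓝 (lpPiece (lo j) (hi j) f x)) := fun j x => by
    have hlo := (hF.hlo.pos j).le
    have hhi := (hF.hhi.pos j).le
    refine tendsto_integral_of_dominated_convergence (fun y => ‖f y‖ * (hi j + lo j)) (fun n => ?_)
      (hf.norm.mul_const _) (fun n => ae_of_all _ fun y => ?_) (ae_of_all _ fun y => ?_)
    · exact ((hgc n).mul ((continuous_lpKer hlo hhi).comp (by fun_prop))).aestronglyMeasurable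
    · rw [norm_mul]
      gcongr
      · exact hgle n y
      · exact norm_lpKer_le hlo hhi _
    · exact tendsto_nhds_of_eventually_eq ((hglim y).mono fun n hn => by rw [hn])
  have hlim2 : ∀ x, Tendsto (fun n => (∑ j ∈ J, ‖lpPiece (lo j) (hi j)
      (g n) x‖ₑ ^ 2) ^ (p / 2)) atTop
      (𝓝 ((∑ j ∈ J, ‖lpPiece (lo j) (hi j) f x‖ₑ ^ 2) ^ (p / 2))) := fun x => by
    refine (ENNReal.continuous_rpow_const.tendsto _).comp (tendsto_finsetSum _ fun j _ => ?_)
    exact ((ENNReal.continuous_pow 2).tendsto _).comp (hlim j x).enorm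
  have hm : ∀ n, Measurable fun x =>
      (∑ j ∈ J, ‖lpPiece (lo j) (hi j) (g n) x‖ₑ ^ 2) ^ (p / 2) := fun n =>
    (Finset.measurable_sum _ fun j _ => ((measurable_lpPiece (hgc n).measurable
      (hF.hlo.pos j).le (hF.hhi.pos j).le).enorm.pow_const 2)).pow_const _
  calc _ = ∫⁻ x, liminf (fun n => (∑ j ∈ J, ‖lpPiece (lo j) (hi j)
      (g n) x‖ₑ ^ 2) ^ (p / 2)) atTop :=
        lintegral_congr fun x => (hlim2 x).liminf_eq.symm
    _ ≤ liminf (fun n => ∫⁻ x, (∑ j ∈ J, ‖lpPiece (lo j) (hi j) (g n) x‖ₑ ^ 2) ^ (p / 2)) atTop :=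
        lintegral_liminf_le hm
    _ ≤ liminf (fun _ : ℕ => ENNReal.ofReal (lpBound N p ^ p) * ∫⁻ y, ‖f y‖ₑ ^ p) atTop := by
        refine liminf_le_liminf (Eventually.of_forall fun n => ?_)
        refine (lintegral_rpow_sum_sq_le_of_compact hF (hgc n) (hgs n) hp hp2).trans ?_
        gcongr with y
        exact enorm_le_iff_norm_le.2 (hgle n y)
    _ = _ := liminf_const _

end

section

section signs

variable {κ V : Type*} [DecidableEq κ] [NormedAddCommGroup V] [InnerProductSpace ℂ V]

/-- The sign attached to `k` by the set `S`. -/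
def sgnOf (S : Finset κ) (k : κ) : ℂ := if k ∈ S then 1 else -1

theorem sum_powerset_insert_sgnOf {a : κ} {K : Finset κ} (ha : a ∉ K) (v : κ → V) (F : V → ℝ) :
    ∑ S ∈ (insert a K).powerset, F (∑ k ∈ insert a K, sgnOf S k • v k) =
      ∑ S ∈ K.powerset, (F (∑ k ∈ K, sgnOf S k • v k - v a) +
        F (∑ k ∈ K, sgnOf S k • v k + v a)) := by
  rw [Finset.sum_powerset_insert ha, ← Finset.sum_add_distrib]
  refine Finset.sum_congr rfl fun S hS => ?_
  have haS : a ∉ S := fun h => ha (Finset.mem_powerset.1 hS h)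
  rw [Finset.sum_insert ha, Finset.sum_insert ha]
  have e : ∑ k ∈ K, sgnOf (insert a S) k • v k = ∑ k ∈ K, sgnOf S k • v k := by
    refine Finset.sum_congr rfl fun k hk => ?_
    have : k ≠ a := fun h => ha (h ▸ hk)
    simp [sgnOf, Finset.mem_insert, this]
  rw [e]
  simp only [sgnOf, haS, Finset.mem_insert_self, if_true, if_false, one_smul, neg_smul]
  congr 2 <;> abel

theorem sum_powerset_norm_sq (K : Finset κ) (v : κ → V) :
    ∑ S ∈ K.powerset, ‖∑ k ∈ K, sgnOf S k • v k‖ ^ 2 = 2 ^ K.card * ∑ k ∈ K, ‖v k‖ ^ 2 := by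
  induction K using Finset.induction_on with
  | empty => simp
  | insert a K ha ih =>
    rw [sum_powerset_insert_sgnOf ha v fun x => ‖x‖ ^ 2, Finset.sum_insert ha,
      Finset.card_insert_of_notMem ha]
    have e : ∀ x : V, ‖x - v a‖ ^ 2 + ‖x + v a‖ ^ 2 = 2 * ‖x‖ ^ 2 + 2 * ‖v a‖ ^ 2 := fun x => by
      rw [norm_add_sq (𝕜 := ℂ), norm_sub_sq (𝕜 := ℂ)]; ring
    simp only [e, Finset.sum_add_distrib, ← Finset.mul_sum, ih, Finset.sum_const,
      Finset.card_powerset, nsmul_eq_mul]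
    push_cast
    ring

theorem sum_powerset_norm_pow_four_le (K : Finset κ) (v : κ → V) :
    ∑ S ∈ K.powerset, (‖∑ k ∈ K, sgnOf S k • v k‖ ^ 2) ^ 2 ≤
      2 ^ K.card * (3 * (∑ k ∈ K, ‖v k‖ ^ 2) ^ 2) := by
  induction K using Finset.induction_on with
  | empty => simp
  | insert a K ha ih =>
    rw [sum_powerset_insert_sgnOf ha v fun x => (‖x‖ ^ 2) ^ 2, Finset.sum_insert ha,
      Finset.card_insert_of_notMem ha]
    have e : ∀ x : V, (‖x - v a‖ ^ 2) ^ 2 + (‖x + v a‖ ^ 2) ^ 2 ≤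
        2 * (‖x‖ ^ 2) ^ 2 + 12 * ‖v a‖ ^ 2 * ‖x‖ ^ 2 + 2 * (‖v a‖ ^ 2) ^ 2 := fun x => by
      rw [norm_add_sq (𝕜 := ℂ), norm_sub_sq (𝕜 := ℂ)]
      have h := (RCLike.abs_re_le_norm (inner ℂ x (v a))).trans (norm_inner_le_norm x (v a))
      have h2 := sq_le_sq' (by linarith [abs_le.1 h |>.1] :
        -(‖x‖ * ‖v a‖) ≤ RCLike.re (inner ℂ x (v a))) (abs_le.1 h).2
      nlinarith
    refine (Finset.sum_le_sum fun S _ => e _).trans ?_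
    simp only [Finset.sum_add_distrib, ← Finset.mul_sum, Finset.sum_const, sum_powerset_norm_sq K v,
      Finset.card_powerset, nsmul_eq_mul]
    push_cast
    have h2 : (0 : ℝ) < 2 ^ K.card := by positivity
    rw [pow_succ (2 : ℝ) K.card]
    nlinarith [mul_nonneg h2.le (sq_nonneg (‖v a‖ ^ 2))]

theorem sum_powerset_rpow_le (K : Finset κ) (v : κ → V) {q : ℝ} (hq : 0 < q) (hq1 : q ≤ 1) :
    ∑ S ∈ K.powerset, (‖∑ k ∈ K, sgnOf S k • v k‖ ^ 2) ^ q ≤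
      2 ^ K.card * (∑ k ∈ K, ‖v k‖ ^ 2) ^ q := by
  set m := ∑ k ∈ K, ‖v k‖ ^ 2 with hm
  have hm0 : 0 ≤ m := by positivity
  have hsum := sum_powerset_norm_sq K v
  rw [← hm] at hsum
  rcases hm0.eq_or_lt with h0 | h0
  · rw [← h0, mul_zero, Finset.sum_eq_zero_iff_of_nonneg (fun _ _ => by positivity)] at hsum
    rw [← h0, Real.zero_rpow hq.ne', mul_zero]
    refine (Finset.sum_eq_zero fun S hS => ?_).le
    rw [hsum S hS, Real.zero_rpow hq.ne']
  have hpt : ∀ y : ℝ, 0 ≤ y → y ^ q ≤ m ^ q * (1 + q * (y / m - 1)) := fun y hy => by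
    have h1 := rpow_one_add_le_one_add_mul_self (s := y / m - 1) (by
      have : 0 ≤ y / m := by positivity
      linarith) hq.le hq1
    rw [add_sub_cancel, Real.div_rpow hy h0.le, div_le_iff₀ (by positivity)] at h1
    linarith
  refine (Finset.sum_le_sum fun S _ => hpt _ (by positivity)).trans (le_of_eq ?_)
  rw [← Finset.mul_sum]
  simp only [Finset.sum_add_distrib, ← Finset.mul_sum, Finset.sum_sub_distrib, ← Finset.sum_div,
    hsum, Finset.sum_const, Finset.card_powerset, nsmul_eq_mul]
  push_cast
  field_simp
  ring

theorem rpow_sum_le_sum_powerset (K : Finset κ) (v : κ → V) {q : ℝ} (hq : 0 < q) (hq1 : q ≤ 1) :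
    2 ^ K.card * (∑ k ∈ K, ‖v k‖ ^ 2) ^ q ≤
      4 * ∑ S ∈ K.powerset, (‖∑ k ∈ K, sgnOf S k • v k‖ ^ 2) ^ q := by
  set m := ∑ k ∈ K, ‖v k‖ ^ 2 with hm
  have hm0 : 0 ≤ m := by positivity
  have hsum := sum_powerset_norm_sq K v
  have hsum4 := sum_powerset_norm_pow_four_le K v
  rw [← hm] at hsum hsum4
  rcases hm0.eq_or_lt with h0 | h0
  · rw [← h0, Real.zero_rpow hq.ne', mul_zero]
    positivity
  have hpt : ∀ y : ℝ, 0 ≤ y → m ^ q * (y / m - (y / m) ^ 2 / 4) ≤ y ^ q := fun y hy => by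
    have hu : 0 ≤ y / m := by positivity
    have h1 : y / m - (y / m) ^ 2 / 4 ≤ (y / m) ^ q := by
      rcases le_total (y / m) 1 with h | h
      · have := Real.rpow_le_rpow_of_exponent_ge' hu h hq.le hq1
        rw [Real.rpow_one] at this
        nlinarith [sq_nonneg (y / m)]
      · have := Real.one_le_rpow h hq.le
        nlinarith [sq_nonneg (y / m / 2 - 1)]
    rw [Real.div_rpow hy h0.le, le_div_iff₀ (by positivity)] at h1
    linarith
  have h1 := Finset.sum_le_sum fun S (_ : S ∈ K.powerset) =>
    hpt (‖∑ k ∈ K, sgnOf S k • v k‖ ^ 2) (by positivity)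
  rw [← Finset.mul_sum] at h1
  simp only [Finset.sum_sub_distrib, ← Finset.sum_div, div_pow, hsum] at h1
  have h2 : 2 ^ K.card / 4 ≤ 2 ^ K.card * m / m -
      (∑ S ∈ K.powerset, (‖∑ k ∈ K, sgnOf S k • v k‖ ^ 2) ^ 2) / m ^ 2 / 4 := by
    have h3 : (∑ S ∈ K.powerset, (‖∑ k ∈ K, sgnOf S k • v k‖ ^ 2) ^ 2) / m ^ 2 ≤
        2 ^ K.card * 3 := by
      rw [div_le_iff₀ (by positivity)]; linarith
    rw [mul_div_cancel_right₀ _ h0.ne']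
    linarith
  have h3 := mul_le_mul_of_nonneg_left h2 (by positivity : 0 ≤ m ^ q)
  linarith

end signs

variable {ι : Type*} {J : Finset ι} {lo hi : ι → ℝ} {N p : ℝ}

theorem lpPiece_sum {κ : Type*} {l' l : ℝ} (h' : 0 ≤ l') (h : 0 ≤ l) (K : Finset κ) (c : κ → ℂ)
    {g : κ → ℝ → ℂ} (hg : ∀ k, Integrable (g k)) (x : ℝ) :
    lpPiece l' l (fun y => ∑ k ∈ K, c k * g k y) x = ∑ k ∈ K, c k * lpPiece l' l (g k) x := by
  simp only [← lpPiece_const_mul]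
  simp only [lpPiece, Finset.sum_mul]
  rw [integral_finsetSum _ fun k _ => integrable_mul_lpKer ((hg k).const_mul _) h' h x]

theorem ofReal_sum_sq_norm_rpow {κ : Type*} (J : Finset κ) (z : κ → ℂ) {q : ℝ} (hq : 0 ≤ q) :
    ENNReal.ofReal ((∑ j ∈ J, ‖z j‖ ^ 2) ^ q) = (∑ j ∈ J, ‖z j‖ₑ ^ 2) ^ q := by
  rw [← ENNReal.ofReal_rpow_of_nonneg (by positivity) hq, ofReal_sum_sq_norm]

theorem lintegral_rpow_sum_sum_sq_le {κ : Type*} [DecidableEq κ] (hF : LPFamily J lo hi N)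
    (K : Finset κ) {g : κ → ℝ → ℂ} (hc : ∀ k, Continuous (g k)) (hg : ∀ k, Integrable (g k))
    (hp : 1 < p) (hp2 : p < 2) :
    ∫⁻ x, (∑ z ∈ K ×ˢ J, ‖lpPiece (lo z.2) (hi z.2) (g z.1) x‖ₑ ^ 2) ^ (p / 2) ≤
      ENNReal.ofReal (4 * lpBound N p ^ p) * ∫⁻ y, (∑ k ∈ K, ‖g k y‖ₑ ^ 2) ^ (p / 2) := by
  have hq : 0 < p / 2 := by linarith
  have hq1 : p / 2 ≤ 1 := by linarith
  set G : Finset κ → ℝ → ℂ := fun S y => ∑ k ∈ K, sgnOf S k * g k y with hG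
  have hGc : ∀ S, Continuous (G S) := fun S => by fun_prop
  have hGi : ∀ S, Integrable (G S) := fun S =>
    integrable_finsetSum _ fun k _ => (hg k).const_mul _
  have hlow : ∀ x, 2 ^ K.card *
      (∑ z ∈ K ×ˢ J, ‖lpPiece (lo z.2) (hi z.2) (g z.1) x‖ₑ ^ 2) ^ (p / 2) ≤
      4 * ∑ S ∈ K.powerset, (∑ j ∈ J, ‖lpPiece (lo j) (hi j) (G S) x‖ₑ ^ 2) ^ (p / 2) := by
    intro x
    have h := rpow_sum_le_sum_powerset K (fun k => (WithLp.toLp 2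
      fun j : J => lpPiece (lo j) (hi j) (g k) x : EuclideanSpace ℂ J)) hq hq1
    simp only [EuclideanSpace.norm_sq_eq, WithLp.ofLp_sum, Finset.sum_apply, PiLp.smul_apply,
      smul_eq_mul] at h
    have e1 : ∀ k, ∑ j : J, ‖lpPiece (lo j) (hi j) (g k) x‖ ^ 2 =
        ∑ j ∈ J, ‖lpPiece (lo j) (hi j) (g k) x‖ ^ 2 := fun k =>
      Finset.sum_coe_sort J fun j => ‖lpPiece (lo j) (hi j) (g k) x‖ ^ 2
    have e2 : ∀ S, ∑ j : J, ‖∑ k ∈ K, sgnOf S k * lpPiece (lo j) (hi j) (g k) x‖ ^ 2 =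
        ∑ j ∈ J, ‖∑ k ∈ K, sgnOf S k * lpPiece (lo j) (hi j) (g k) x‖ ^ 2 := fun S =>
      Finset.sum_coe_sort J fun j => ‖∑ k ∈ K, sgnOf S k * lpPiece (lo j) (hi j) (g k) x‖ ^ 2
    simp only [e1, e2] at h
    have h' := ENNReal.ofReal_le_ofReal h
    rw [ENNReal.ofReal_mul (by positivity), ENNReal.ofReal_mul (by positivity),
      ENNReal.ofReal_sum_of_nonneg fun S _ => by positivity, ENNReal.ofReal_pow (by norm_num),
      ENNReal.ofReal_ofNat, ENNReal.ofReal_ofNat,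
      ← Finset.sum_product' K J fun k j => ‖lpPiece (lo j) (hi j) (g k) x‖ ^ 2,
      ofReal_sum_sq_norm_rpow _ (fun z : κ × ι => lpPiece (lo z.2) (hi z.2) (g z.1) x) hq.le] at h'
    refine h'.trans (le_of_eq ?_)
    congr 1
    refine Finset.sum_congr rfl fun S _ => ?_
    rw [ofReal_sum_sq_norm_rpow J _ hq.le]
    simp only [hG, lpPiece_sum (hF.hlo.pos _).le (hF.hhi.pos _).le K _ hg]
  have hup : ∀ y, ∑ S ∈ K.powerset, ‖G S y‖ₑ ^ p ≤
      2 ^ K.card * (∑ k ∈ K, ‖g k y‖ₑ ^ 2) ^ (p / 2) := by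
    intro y
    have h' := ENNReal.ofReal_le_ofReal (sum_powerset_rpow_le K (fun k => g k y) hq hq1)
    rw [ENNReal.ofReal_mul (by positivity), ENNReal.ofReal_sum_of_nonneg fun S _ => by positivity,
      ENNReal.ofReal_pow (by norm_num), ENNReal.ofReal_ofNat,
      ofReal_sum_sq_norm_rpow _ (fun k => g k y) hq.le] at h'
    refine le_trans (le_of_eq ?_) h'
    refine Finset.sum_congr rfl fun S _ => ?_
    rw [← Real.rpow_natCast, ← Real.rpow_mul (norm_nonneg _), ← ofReal_norm,
      ENNReal.ofReal_rpow_of_nonneg (norm_nonneg _) (by linarith)]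
    simp only [hG, smul_eq_mul]
    congr 2; push_cast; ring
  have hm : ∀ S, Measurable fun x =>
      (∑ j ∈ J, ‖lpPiece (lo j) (hi j) (G S) x‖ₑ ^ 2) ^ (p / 2) := fun S =>
    (Finset.measurable_sum _ fun j _ => ((measurable_lpPiece (hGc S).measurable
      (hF.hlo.pos j).le (hF.hhi.pos j).le).enorm.pow_const 2)).pow_const _
  have h2 : (2 : ℝ≥0∞) ^ K.card ≠ ∞ := by finiteness
  rw [← ENNReal.mul_le_mul_iff_right (by positivity : (2 : ℝ≥0∞) ^ K.card ≠ 0) h2]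
  calc _ = ∫⁻ x, 2 ^ K.card *
        (∑ z ∈ K ×ˢ J, ‖lpPiece (lo z.2) (hi z.2) (g z.1) x‖ₑ ^ 2) ^ (p / 2) :=
        (lintegral_const_mul' _ _ h2).symm
    _ ≤ ∫⁻ x, 4 * ∑ S ∈ K.powerset,
        (∑ j ∈ J, ‖lpPiece (lo j) (hi j) (G S) x‖ₑ ^ 2) ^ (p / 2) := lintegral_mono hlow
    _ = 4 * ∑ S ∈ K.powerset,
        ∫⁻ x, (∑ j ∈ J, ‖lpPiece (lo j) (hi j) (G S) x‖ₑ ^ 2) ^ (p / 2) := by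
        rw [lintegral_const_mul' _ _ (by simp), lintegral_finsetSum _ fun S _ => hm S]
    _ ≤ 4 * ∑ S ∈ K.powerset, ENNReal.ofReal (lpBound N p ^ p) * ∫⁻ y, ‖G S y‖ₑ ^ p := by
        gcongr with S _
        exact lintegral_rpow_sum_sq_le hF (hGc S) (hGi S) hp hp2
    _ = 4 * (ENNReal.ofReal (lpBound N p ^ p) * ∫⁻ y, ∑ S ∈ K.powerset, ‖G S y‖ₑ ^ p) := by
        rw [← Finset.mul_sum, lintegral_finsetSum _ fun S _ =>
          (hGc S).measurable.enorm.pow_const p]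
    _ ≤ 4 * (ENNReal.ofReal (lpBound N p ^ p) *
        ∫⁻ y, 2 ^ K.card * (∑ k ∈ K, ‖g k y‖ₑ ^ 2) ^ (p / 2)) := by
        gcongr with y
        exact hup y
    _ = _ := by
        rw [lintegral_const_mul' _ _ h2, ENNReal.ofReal_mul (by norm_num), ENNReal.ofReal_ofNat]
        ring

end

section finSucc

variable {d : ℕ}

theorem measurePreserving_finCons : MeasurePreserving
    (fun q : ℝ × (Fin d → ℝ) => (Fin.cons q.1 q.2 : Fin (d + 1) → ℝ)) volume volume := by
  have h := (volume_preserving_piFinSuccAbove (fun _ : Fin (d + 1) => ℝ) 0).symm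
  have e : (fun q : ℝ × (Fin d → ℝ) => (Fin.cons q.1 q.2 : Fin (d + 1) → ℝ)) =
      (MeasurableEquiv.piFinSuccAbove (fun _ : Fin (d + 1) => ℝ) 0).symm := by
    funext q
    exact (Fin.insertNth_zero' q.1 q.2).symm
  rw [e]
  exact h

theorem measurableEmbedding_finCons : MeasurableEmbedding
    (fun q : ℝ × (Fin d → ℝ) => (Fin.cons q.1 q.2 : Fin (d + 1) → ℝ)) := by
  have h := (MeasurableEquiv.piFinSuccAbove (fun _ : Fin (d + 1) => ℝ) 0).symm.measurableEmbedding
  have e : (fun q : ℝ × (Fin d → ℝ) => (Fin.cons q.1 q.2 : Fin (d + 1) → ℝ)) =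
      (MeasurableEquiv.piFinSuccAbove (fun _ : Fin (d + 1) => ℝ) 0).symm := by
    funext q
    exact (Fin.insertNth_zero' q.1 q.2).symm
  rw [e]
  exact h

theorem lintegral_fin_succ {F : (Fin (d + 1) → ℝ) → ℝ≥0∞} (hF : Measurable F) :
    ∫⁻ z, F z = ∫⁻ a : ℝ, ∫⁻ z : Fin d → ℝ, F (Fin.cons a z) := by
  rw [← measurePreserving_finCons.lintegral_comp hF, Measure.volume_eq_prod, lintegral_prod]
  exact (hF.comp measurableEmbedding_finCons.measurable).aemeasurable

theorem integral_fin_succ {F : (Fin (d + 1) → ℝ) → ℂ} (hF : Integrable F) :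
    ∫ z, F z = ∫ a : ℝ, ∫ z : Fin d → ℝ, F (Fin.cons a z) := by
  rw [← measurePreserving_finCons.integral_comp measurableEmbedding_finCons, Measure.volume_eq_prod,
    integral_prod]
  have := (measurePreserving_finCons (d := d)).integrable_comp_of_integrable hF
  exact this

end finSucc

/-- A continuous function with quadratic decay in every coordinate. -/
structure DecayFun {d : ℕ} (f : (Fin d → ℝ) → ℂ) : Prop where
  continuous : Continuous f
  bound : ∃ C, ∀ x, ‖f x‖ ≤ C * ∏ k, (1 + x k ^ 2)⁻¹

theorem integrable_prod_inv {d : ℕ} :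
    Integrable fun x : Fin d → ℝ => ∏ k, (1 + x k ^ 2)⁻¹ :=
  Integrable.fintype_prod (f := fun _ (y : ℝ) => (1 + y ^ 2)⁻¹) fun _ => integrable_inv_one_add_sq

theorem DecayFun.integrable {d : ℕ} {f : (Fin d → ℝ) → ℂ} (h : DecayFun f) : Integrable f := by
  obtain ⟨C, hC⟩ := h.bound
  exact (integrable_prod_inv.const_mul C).mono' h.continuous.aestronglyMeasurable (ae_of_all _ hC)

theorem DecayFun.slice {d : ℕ} {f : (Fin (d + 1) → ℝ) → ℂ} (h : DecayFun f) (a : ℝ) :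
    DecayFun fun z : Fin d → ℝ => f (Fin.cons a z) := by
  obtain ⟨C, hC⟩ := h.bound
  refine ⟨h.continuous.comp (Continuous.finCons continuous_const continuous_id),
    C * (1 + a ^ 2)⁻¹, fun x => (hC _).trans_eq ?_⟩
  rw [Fin.prod_univ_succ, mul_assoc]
  rfl

/-- The multiparameter rough projection, as a convolution with a product kernel. -/
def lpPieceD {d : ℕ} (a b : Fin d → ℝ) (f : (Fin d → ℝ) → ℂ) (x : Fin d → ℝ) : ℂ :=
  ∫ z, f z * ∏ k, lpKer (a k) (b k) (x k - z k)

section pieces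

variable {d : ℕ} {a b : Fin d → ℝ}

theorem norm_prod_lpKer_le (ha : ∀ k, 0 ≤ a k) (hb : ∀ k, 0 ≤ b k) (u : Fin d → ℝ) :
    ‖∏ k, lpKer (a k) (b k) (u k)‖ ≤ ∏ k, (b k + a k) := by
  rw [norm_prod]
  exact Finset.prod_le_prod (fun _ _ => norm_nonneg _) fun k _ => norm_lpKer_le (ha k) (hb k) _

theorem continuous_prod_lpKer (ha : ∀ k, 0 ≤ a k) (hb : ∀ k, 0 ≤ b k) :
    Continuous fun u : Fin d → ℝ => ∏ k, lpKer (a k) (b k) (u k) :=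
  continuous_finsetProd _ fun k _ => (continuous_lpKer (ha k) (hb k)).comp (continuous_apply k)

theorem integrable_mul_prod_lpKer {f : (Fin d → ℝ) → ℂ} (hf : Integrable f) (ha : ∀ k, 0 ≤ a k)
    (hb : ∀ k, 0 ≤ b k) (x : Fin d → ℝ) :
    Integrable fun z => f z * ∏ k, lpKer (a k) (b k) (x k - z k) :=
  hf.mul_bdd (c := ∏ k, (b k + a k))
    ((continuous_prod_lpKer ha hb).comp (g := _) (f := fun z => x - z)
      (by fun_prop)).aestronglyMeasurable
    (ae_of_all _ fun z => norm_prod_lpKer_le ha hb (x - z))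

theorem norm_lpPieceD_le {f : (Fin d → ℝ) → ℂ} {C : ℝ} (hC : ∀ x, ‖f x‖ ≤ C * ∏ k, (1 + x k ^ 2)⁻¹)
    (ha : ∀ k, 0 ≤ a k) (hb : ∀ k, 0 ≤ b k) (x : Fin d → ℝ) :
    ‖lpPieceD a b f x‖ ≤
      C * ((∏ k, (b k + a k)) * ∫ z : Fin d → ℝ, ∏ k, (1 + z k ^ 2)⁻¹) := by
  rw [← integral_const_mul, ← integral_const_mul]
  unfold lpPieceD
  refine norm_integral_le_of_norm_le ?_ (ae_of_all _ fun z => ?_)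
  · exact (integrable_prod_inv.const_mul _).const_mul _
  · rw [norm_mul]
    calc _ ≤ (C * ∏ k, (1 + z k ^ 2)⁻¹) * ∏ k, (b k + a k) :=
          mul_le_mul (hC z) (norm_prod_lpKer_le ha hb (x - z)) (norm_nonneg _)
            ((norm_nonneg _).trans (hC z))
      _ = _ := by ring

theorem continuous_lpPieceD_param {X : Type*} [TopologicalSpace X] [FirstCountableTopology X]
    {F : X → (Fin d → ℝ) → ℂ} (hF : Continuous (Function.uncurry F)) {C : ℝ}
    (hC : ∀ t x, ‖F t x‖ ≤ C * ∏ k, (1 + x k ^ 2)⁻¹)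
    (ha : ∀ k, 0 ≤ a k) (hb : ∀ k, 0 ≤ b k) :
    Continuous fun q : X × (Fin d → ℝ) => lpPieceD a b (F q.1) q.2 := by
  refine continuous_of_dominated (bound := fun z => (C * ∏ k, (1 + z k ^ 2)⁻¹) * ∏ k, (b k + a k))
    (fun q => ?_) (fun q => ae_of_all _ fun z => ?_) ((integrable_prod_inv.const_mul _).mul_const _)
    (ae_of_all _ fun z => ?_)
  · refine Continuous.aestronglyMeasurable (Continuous.mul ?_ ?_)
    · exact hF.comp (by fun_prop : Continuous fun z => (q.1, z))
    · exact (continuous_prod_lpKer ha hb).comp (by fun_prop : Continuous fun z => q.2 - z)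
  · rw [norm_mul]
    exact mul_le_mul (hC _ z) (norm_prod_lpKer_le ha hb (q.2 - z)) (norm_nonneg _)
            ((norm_nonneg _).trans (hC q.1 z))
  · refine Continuous.mul ?_ ?_
    · exact hF.comp (by fun_prop : Continuous fun q : X × (Fin d → ℝ) => (q.1, z))
    · exact (continuous_prod_lpKer ha hb).comp
        (by fun_prop : Continuous fun q : X × (Fin d → ℝ) => q.2 - z)

theorem DecayFun.continuous_lpPieceD {f : (Fin d → ℝ) → ℂ} (h : DecayFun f)
    (ha : ∀ k, 0 ≤ a k) (hb : ∀ k, 0 ≤ b k) : Continuous (lpPieceD a b f) := by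
  obtain ⟨C, hC⟩ := h.bound
  refine continuous_of_dominated (bound := fun z => (C * ∏ k, (1 + z k ^ 2)⁻¹) * ∏ k, (b k + a k))
    (fun x => (integrable_mul_prod_lpKer h.integrable ha hb x).aestronglyMeasurable)
    (fun x => ae_of_all _ fun z => ?_) ((integrable_prod_inv.const_mul _).mul_const _)
    (ae_of_all _ fun z => ?_)
  · rw [norm_mul]
    exact mul_le_mul (hC z) (norm_prod_lpKer_le ha hb (x - z)) (norm_nonneg _)
            ((norm_nonneg _).trans (hC z))
  · exact continuous_const.mul ((continuous_prod_lpKer ha hb).comp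
        (by fun_prop : Continuous fun x : Fin d → ℝ => x - z))

theorem DecayFun.continuous_lpPieceD_slice {f : (Fin (d + 1) → ℝ) → ℂ} (h : DecayFun f)
    (ha : ∀ k, 0 ≤ a k) (hb : ∀ k, 0 ≤ b k) :
    Continuous fun q : ℝ × (Fin d → ℝ) => lpPieceD a b (fun z => f (Fin.cons q.1 z)) q.2 := by
  obtain ⟨C, hC⟩ := h.bound
  have hC0 : 0 ≤ C := by
    have := (norm_nonneg _).trans (hC 0)
    simpa using this
  refine continuous_lpPieceD_param (F := fun t z => f (Fin.cons t z)) (C := C)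
    (h.continuous.comp (Continuous.finCons continuous_fst continuous_snd)) (fun t x => ?_) ha hb
  refine (hC _).trans ?_
  rw [Fin.prod_univ_succ]
  simp only [Fin.cons_zero, Fin.cons_succ]
  gcongr
  refine mul_le_of_le_one_left (Finset.prod_nonneg fun _ _ => by positivity) ?_
  exact inv_le_one_of_one_le₀ (by nlinarith [sq_nonneg t])

theorem DecayFun.integrable_lpPieceD_slice {f : (Fin (d + 1) → ℝ) → ℂ} (h : DecayFun f)
    (ha : ∀ k, 0 ≤ a k) (hb : ∀ k, 0 ≤ b k) (x : Fin d → ℝ) :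
    Integrable fun t : ℝ => lpPieceD a b (fun z => f (Fin.cons t z)) x := by
  obtain ⟨C, hC⟩ := h.bound
  have hc : Continuous fun t : ℝ => lpPieceD a b (fun z => f (Fin.cons t z)) x :=
    (h.continuous_lpPieceD_slice ha hb).comp (by fun_prop : Continuous fun t : ℝ => (t, x))
  refine ((integrable_inv_one_add_sq.const_mul C).mul_const
    ((∏ k, (b k + a k)) * ∫ z : Fin d → ℝ, ∏ k, (1 + z k ^ 2)⁻¹)).mono'
    hc.aestronglyMeasurable (ae_of_all _ fun t => ?_)
  refine norm_lpPieceD_le (fun z => (hC _).trans_eq ?_) ha hb x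
  rw [Fin.prod_univ_succ, mul_assoc]
  rfl

theorem DecayFun.lpPieceD_cons {f : (Fin (d + 1) → ℝ) → ℂ} (h : DecayFun f) {a₀ b₀ : ℝ}
    (ha₀ : 0 ≤ a₀) (hb₀ : 0 ≤ b₀) (ha : ∀ k, 0 ≤ a k) (hb : ∀ k, 0 ≤ b k) (t : ℝ)
    (x : Fin d → ℝ) :
    lpPieceD (Fin.cons a₀ a) (Fin.cons b₀ b) f (Fin.cons t x) =
      lpPiece a₀ b₀ (fun s => lpPieceD a b (fun z => f (Fin.cons s z)) x) t := by
  unfold lpPieceD lpPiece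
  rw [integral_fin_succ]
  · refine integral_congr_ae (ae_of_all _ fun s => ?_)
    simp only [Fin.prod_univ_succ, Fin.cons_zero, Fin.cons_succ]
    rw [← integral_mul_const]
    congr 1
    ext z
    ring
  · refine integrable_mul_prod_lpKer h.integrable ?_ ?_ _ <;> intro k <;>
      refine Fin.cases ?_ (fun i => ?_) k <;> simp [*]

end pieces

theorem sum_piFinset_succ {d : ℕ} {M : Type*} [AddCommMonoid M] {ι : Fin (d + 1) → Type*}
    (J : ∀ k, Finset (ι k)) (F : (∀ k, ι k) → M) :
    ∑ j ∈ Fintype.piFinset J, F j =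
      ∑ z ∈ Fintype.piFinset (fun k : Fin d => J k.succ) ×ˢ J 0, F (Fin.cons z.2 z.1) := by
  classical
  refine Finset.sum_nbij' (fun j => (fun k => j k.succ, j 0)) (fun z => Fin.cons z.2 z.1)
    ?_ ?_ ?_ ?_ ?_
  · intro j hj
    simp only [Fintype.mem_piFinset, Finset.mem_product] at hj ⊢
    exact ⟨fun k => hj _, hj 0⟩
  · intro z hz
    simp only [Fintype.mem_piFinset, Finset.mem_product] at hz ⊢
    intro k
    refine Fin.cases ?_ (fun i => ?_) k
    · exact hz.2
    · exact hz.1 i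
  · intro j _
    exact Fin.cons_self_tail j
  · intro z _
    rfl
  · intro j _
    exact congrArg F (Fin.cons_self_tail j).symm

theorem lintegral_rpow_sum_sq_lpPieceD_le {p : ℝ} (hp : 1 < p) (hp2 : p < 2) {ι : Type*} :
    ∀ {d : ℕ} {J : Fin d → Finset ι} {lo hi : Fin d → ι → ℝ} {N : Fin d → ℝ}
      (_ : ∀ k, LPFamily (J k) (lo k) (hi k) (N k)) {f : (Fin d → ℝ) → ℂ} (_ : DecayFun f),
      ∫⁻ x, (∑ j ∈ Fintype.piFinset J,
        ‖lpPieceD (fun k => lo k (j k)) (fun k => hi k (j k)) f x‖ₑ ^ 2) ^ (p / 2) ≤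
      (∏ k, ENNReal.ofReal (4 * lpBound (N k) p ^ p)) * ∫⁻ x, ‖f x‖ₑ ^ p
  | 0, J, lo, hi, N, hF, f, hf => by
    classical
    simp only [Finset.univ_eq_empty, Finset.prod_empty, one_mul]
    refine lintegral_mono fun x => ?_
    have h0 : Fintype.piFinset J = {default} := by
      ext j
      simp [Subsingleton.elim j default]
    have h1 : ∀ a b : Fin 0 → ℝ, lpPieceD a b f x = f x := fun a b => by
      unfold lpPieceD
      rw [volume_pi, Measure.pi_of_empty _ x, integral_dirac]
      simp
    have e : ((2 : ℕ) : ℝ) * (p / 2) = p := by push_cast; ring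
    rw [h0, Finset.sum_singleton, h1, ← ENNReal.rpow_natCast, ← ENNReal.rpow_mul, e]
  | d + 1, J, lo, hi, N, hF, f, hf => by
    classical
    have hlo : ∀ k i, 0 ≤ lo k i := fun k i => ((hF k).hlo.pos i).le
    have hhi : ∀ k i, 0 ≤ hi k i := fun k i => ((hF k).hhi.pos i).le
    set G : (Fin d → ι) → ℝ → (Fin d → ℝ) → ℂ := fun j s x =>
      lpPieceD (fun k => lo k.succ (j k)) (fun k => hi k.succ (j k)) (fun z => f (Fin.cons s z)) x
      with hG
    have hGc : ∀ j, Continuous fun q : ℝ × (Fin d → ℝ) => G j q.1 q.2 := fun j =>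
      hf.continuous_lpPieceD_slice (fun _ => hlo _ _) (fun _ => hhi _ _)
    have hmeasR : Measurable fun q : ℝ × (Fin d → ℝ) =>
        (∑ j ∈ Fintype.piFinset fun k : Fin d => J k.succ, ‖G j q.1 q.2‖ₑ ^ 2) ^ (p / 2) :=
      (Finset.measurable_fun_sum _ fun j _ => (hGc j).measurable.enorm.pow_const 2).pow_const _
    have hpc : ∀ j : Fin (d + 1) → ι,
        Continuous (lpPieceD (fun k => lo k (j k)) (fun k => hi k (j k)) f) := fun j =>
      hf.continuous_lpPieceD (fun _ => hlo _ _) (fun _ => hhi _ _)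
    have hmeasL : Measurable fun x : Fin (d + 1) → ℝ => (∑ j ∈ Fintype.piFinset J,
        ‖lpPieceD (fun k => lo k (j k)) (fun k => hi k (j k)) f x‖ₑ ^ 2) ^ (p / 2) :=
      (Finset.measurable_fun_sum _ fun j _ => (hpc j).measurable.enorm.pow_const 2).pow_const _
    have hstep : ∀ (t : ℝ) (x : Fin d → ℝ), (∑ j ∈ Fintype.piFinset J,
        ‖lpPieceD (fun k => lo k (j k)) (fun k => hi k (j k)) f (Fin.cons t x)‖ₑ ^ 2) =
        ∑ z ∈ (Fintype.piFinset fun k : Fin d => J k.succ) ×ˢ J 0,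
          ‖lpPiece (lo 0 z.2) (hi 0 z.2) (fun s => G z.1 s x) t‖ₑ ^ 2 := fun t x => by
      rw [sum_piFinset_succ (ι := fun _ => ι)]
      refine Finset.sum_congr rfl fun z _ => ?_
      rw [hG, ← hf.lpPieceD_cons (hlo _ _) (hhi _ _) (fun _ => hlo _ _) (fun _ => hhi _ _)]
      congr 4 <;> (ext k; refine Fin.cases ?_ (fun i => ?_) k <;> rfl)
    rw [lintegral_fin_succ hmeasL]
    simp only [hstep]
    rw [lintegral_lintegral_swap]
    swap
    · have := (hmeasL.comp measurableEmbedding_finCons.measurable).aemeasurable (μ := volume)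
      simp only [hstep, Function.comp_def] at this
      exact this
    calc _ ≤ ∫⁻ x : Fin d → ℝ, ENNReal.ofReal (4 * lpBound (N 0) p ^ p) *
          ∫⁻ s : ℝ, (∑ j ∈ Fintype.piFinset fun k : Fin d => J k.succ, ‖G j s x‖ₑ ^ 2) ^ (p / 2) :=
          lintegral_mono fun x => lintegral_rpow_sum_sum_sq_le (hF 0) _
            (fun j => (hGc j).comp (by fun_prop : Continuous fun s : ℝ => (s, x)))
            (fun j => hf.integrable_lpPieceD_slice (fun _ => hlo _ _) (fun _ => hhi _ _) x) hp hp2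
      _ = ENNReal.ofReal (4 * lpBound (N 0) p ^ p) * ∫⁻ s : ℝ, ∫⁻ x : Fin d → ℝ,
          (∑ j ∈ Fintype.piFinset fun k : Fin d => J k.succ, ‖G j s x‖ₑ ^ 2) ^ (p / 2) := by
          rw [lintegral_const_mul' _ _ ENNReal.ofReal_ne_top, lintegral_lintegral_swap]
          exact (hmeasR.comp measurable_swap).aemeasurable
      _ ≤ ENNReal.ofReal (4 * lpBound (N 0) p ^ p) * ∫⁻ s : ℝ,
          (∏ k : Fin d, ENNReal.ofReal (4 * lpBound (N k.succ) p ^ p)) *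
            ∫⁻ z : Fin d → ℝ, ‖f (Fin.cons s z)‖ₑ ^ p := by
          gcongr with s
          exact lintegral_rpow_sum_sq_lpPieceD_le hp hp2 (fun k => hF k.succ) (hf.slice s)
      _ = _ := by
          rw [lintegral_const_mul' _ _ (ENNReal.prod_ne_top fun _ _ => ENNReal.ofReal_ne_top),
            ← mul_assoc, Fin.prod_univ_succ,
            lintegral_fin_succ (hf.continuous.measurable.enorm.pow_const p)]

theorem symInd_ae_eq {Λ : ℤ → ℝ} {j : ℤ} (h0 : 0 < Λ (j - 1)) (h1 : Λ (j - 1) < Λ j) :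
    (fun ξ => (symInd Λ j ξ : ℂ)) =ᵐ[volume] fun ξ =>
      Set.indicator (Set.Ioc (-(Λ j)) (Λ j)) (fun _ => (1 : ℂ)) ξ -
        Set.indicator (Set.Ioc (-(Λ (j - 1))) (Λ (j - 1))) (fun _ => (1 : ℂ)) ξ := by
  have hne : ∀ c : ℝ, ∀ᵐ ξ : ℝ, ξ ≠ c := fun c => by
    simp [ae_iff, measure_singleton]
  filter_upwards [hne (Λ j), hne (Λ (j - 1)), hne (-(Λ (j - 1)))] with ξ n1 n2 n3
  unfold symInd
  simp only [Set.indicator_apply, Set.mem_Ioc]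
  split_ifs with c1 c2 c3 c3 c2 c3 c3 <;> simp <;> grind

theorem integrable_symInd {Λ : ℤ → ℝ} {j : ℤ} (h0 : 0 < Λ (j - 1)) (h1 : Λ (j - 1) < Λ j) :
    Integrable fun ξ => (symInd Λ j ξ : ℂ) := by
  have hi : ∀ l : ℝ, Integrable (Set.indicator (Set.Ioc (-l) l) (fun _ => (1 : ℂ))) := fun l => by
    rw [integrable_indicator_iff measurableSet_Ioc]
    exact integrableOn_const (by simp)
  exact ((hi _).sub (hi _)).congr (symInd_ae_eq h0 h1).symm

theorem integral_symInd_mul {Λ : ℤ → ℝ} {j : ℤ} (h0 : 0 < Λ (j - 1)) (h1 : Λ (j - 1) < Λ j)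
    (u : ℝ) : ∫ ξ, (symInd Λ j ξ : ℂ) * cexp (I * (ξ * u : ℝ)) =
      (2 * π : ℂ) * lpKer (Λ (j - 1)) (Λ j) u := by
  have hpi : (2 * π : ℂ) ≠ 0 := by
    exact_mod_cast (by positivity : (2 * π : ℝ) ≠ 0)
  have hind : ∀ l : ℝ, 0 ≤ l → ∫ ξ, Set.indicator (Set.Ioc (-l) l) (fun _ => (1 : ℂ)) ξ *
      cexp (I * (ξ * u : ℝ)) = (2 * π : ℂ) * dirKer l u := fun l hl => by
    unfold dirKer
    rw [mul_inv_cancel_left₀ hpi, intervalIntegral.integral_of_le (by linarith),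
      ← integral_indicator measurableSet_Ioc]
    congr 1
    ext ξ
    by_cases h : ξ ∈ Set.Ioc (-l) l <;> simp [h]
  have hintg : ∀ l : ℝ, Integrable fun ξ => Set.indicator (Set.Ioc (-l) l) (fun _ => (1 : ℂ)) ξ *
      cexp (I * (ξ * u : ℝ)) := fun l => by
    refine Integrable.mul_bdd (c := 1) ?_ (Continuous.aestronglyMeasurable (by fun_prop))
      (ae_of_all _ fun ξ => (norm_exp_I_mul_real _).le)
    rw [integrable_indicator_iff measurableSet_Ioc]
    exact integrableOn_const (by simp)
  unfold lpKer
  rw [mul_sub, ← hind _ (h0.trans h1).le, ← hind _ h0.le, ← integral_sub (hintg _) (hintg _)]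
  refine integral_congr_ae ?_
  filter_upwards [symInd_ae_eq h0 h1] with ξ h
  rw [h, sub_mul]

theorem PpiecePi_eq_lpPieceD {d : ℕ} {Λs : Fin d → ℤ → ℝ} (hpos : ∀ n j, 0 < Λs n j)
    (hmono : ∀ n, StrictMono (Λs n)) (j : Fin d → ℤ) {f : (Fin d → ℝ) → ℂ} (hf : Integrable f)
    (x : Fin d → ℝ) :
    PpiecePi Λs j f x =
      lpPieceD (fun k => Λs k (j k - 1)) (fun k => Λs k (j k)) f x := by
  have hlt : ∀ k, Λs k (j k - 1) < Λs k (j k) := fun k => hmono k (by omega)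
  set m : (Fin d → ℝ) → ℂ := fun ξ => ∏ k, (symInd (Λs k) (j k) (ξ k) : ℂ) with hm
  have hmi : Integrable m := Integrable.fintype_prod
    (f := fun k (t : ℝ) => (symInd (Λs k) (j k) t : ℂ)) fun k => integrable_symInd (hpos _ _)
        (hlt k)
  have hcexp : ∀ ξ y : Fin d → ℝ, cexp (-(I * ((∑ k, y k * ξ k : ℝ) : ℂ))) *
      cexp (I * ((∑ k, x k * ξ k : ℝ) : ℂ)) = ∏ k, cexp (I * (ξ k * (x k - y k) : ℝ)) := by
    intro ξ y
    rw [← Complex.exp_add, ← Complex.exp_sum]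
    congr 1
    push_cast
    rw [← Finset.mul_sum, ← mul_neg, ← mul_add, ← Finset.sum_neg_distrib, ← Finset.sum_add_distrib]
    congr 1
    refine Finset.sum_congr rfl fun k _ => ?_
    ring
  have hswap : ∫ ξ, m ξ * FTd f ξ * cexp (I * ((∑ k, x k * ξ k : ℝ) : ℂ)) =
      ∫ y, f y * ∫ ξ : Fin d → ℝ, ∏ k, ((symInd (Λs k) (j k) (ξ k) : ℂ) *
        cexp (I * (ξ k * (x k - y k) : ℝ))) := by
    have e1 : ∀ ξ, m ξ * FTd f ξ * cexp (I * ((∑ k, x k * ξ k : ℝ) : ℂ)) =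
        ∫ y, (m ξ * f y) * ∏ k, cexp (I * (ξ k * (x k - y k) : ℝ)) := fun ξ => by
      unfold FTd
      rw [← integral_const_mul, ← integral_mul_const]
      congr 1
      ext y
      rw [← hcexp ξ y]
      ring
    simp only [e1, ← integral_const_mul]
    rw [integral_integral_swap]
    · congr 1
      ext y
      congr 1
      ext ξ
      rw [Finset.prod_mul_distrib, hm]
      ring
    · refine Integrable.mul_bdd (c := 1) (hmi.mul_prod hf)
        (Continuous.aestronglyMeasurable (by fun_prop)) (ae_of_all _ fun q => ?_)
      simp only [norm_prod, norm_exp_I_mul_real, Finset.prod_const_one, le_refl]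
  unfold PpiecePi lpPieceD
  simp only [Complex.ofReal_prod]
  rw [hswap, ← integral_smul]
  congr 1
  ext y
  have hprod : ∫ ξ : Fin d → ℝ, ∏ k, ((symInd (Λs k) (j k) (ξ k) : ℂ) *
      cexp (I * (ξ k * (x k - y k) : ℝ))) =
      ∏ k, ((2 * π : ℂ) * lpKer (Λs k (j k - 1)) (Λs k (j k)) (x k - y k)) := by
    rw [integral_fintype_prod_volume_eq_prod
      (fun k (t : ℝ) => (symInd (Λs k) (j k) t : ℂ) * cexp (I * (t * (x k - y k) : ℝ)))]
    exact Finset.prod_congr rfl fun k _ => integral_symInd_mul (hpos _ _) (hlt k) _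
  have hpi : (2 * π : ℂ) ≠ 0 := by
    exact_mod_cast (by positivity : (2 * π : ℝ) ≠ 0)
  rw [hprod, Finset.prod_mul_distrib, Finset.prod_const, Finset.card_univ, Fintype.card_fin,
    Complex.real_smul]
  push_cast
  field_simp

theorem SchwartzMap.decayFun {d : ℕ} (f : SchwartzMap (Fin d → ℝ) ℂ) : DecayFun f := by
  refine ⟨f.continuous, 2 ^ (2 * d) *
    (Finset.Iic (2 * d, 0)).sup (fun m => SchwartzMap.seminorm ℝ m.1 m.2) f, fun x => ?_⟩
  have h := SchwartzMap.one_add_le_sup_seminorm_apply (𝕜 := ℝ) (m := (2 * d, 0)) le_rfl le_rfl f x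
  rw [norm_iteratedFDeriv_zero] at h
  have h2 : ∏ k, (1 + x k ^ 2) ≤ (1 + ‖x‖) ^ (2 * d) := by
    rw [pow_mul]
    calc ∏ k, (1 + x k ^ 2) ≤ ∏ _k : Fin d, (1 + ‖x‖) ^ 2 := by
          refine Finset.prod_le_prod (fun _ _ => by positivity) fun k _ => ?_
          have := norm_le_pi_norm x k
          rw [Real.norm_eq_abs] at this
          have h3 : x k ^ 2 ≤ ‖x‖ ^ 2 := by
            rw [← sq_abs]
            gcongr
          nlinarith [norm_nonneg x]
      _ = _ := by simp
  have hp : 0 < ∏ k, (1 + x k ^ 2) := Finset.prod_pos fun _ _ => by positivity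
  rw [Finset.prod_inv_distrib, ← div_eq_mul_inv, le_div_iff₀ hp]
  exact (mul_le_mul_of_nonneg_left h2 (norm_nonneg _)).trans ((mul_comm _ _).trans_le h)

theorem sum_zpow_two_le (S : Finset ℤ) : ∀ B : ℤ, (∀ b ∈ S, b ≤ B) →
    ∑ b ∈ S, (2 : ℝ) ^ b ≤ 2 ^ (B + 1) := by
  induction S using Finset.induction_on_max with
  | empty => exact fun B _ => by simpa using zpow_nonneg (by norm_num : (0 : ℝ) ≤ 2) _
  | insert a S ha ih =>
    intro B hB
    have h1 := ih (a - 1) fun b hb => by have := ha b hb; omega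
    rw [sub_add_cancel] at h1
    rw [Finset.sum_insert fun h => lt_irrefl _ (ha a h)]
    calc (2 : ℝ) ^ a + ∑ b ∈ S, (2 : ℝ) ^ b ≤ 2 ^ a + 2 ^ a := by gcongr
      _ = 2 ^ (a + 1) := by rw [zpow_add_one₀ (by norm_num)]; ring
      _ ≤ 2 ^ (B + 1) := zpow_le_zpow_right₀ (by norm_num)
          (by have := hB a (Finset.mem_insert_self _ _); omega)

theorem sum_le_of_card_block_le {ι : Type*} {lam : ι → ℝ} {s : ℕ}
    (hblock : ∀ (b : ℤ) (S : Finset ι), (∀ j ∈ S, Int.log 2 (lam j) = b) → S.card ≤ s)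
    (J : Finset ι) (g : ι → ℝ) (c : ℤ → ℤ) (hc : Function.Injective c) (B : ℤ)
    (hg : ∀ j ∈ J, g j ≤ 2 ^ c (Int.log 2 (lam j))) (hB : ∀ j ∈ J, c (Int.log 2 (lam j)) ≤ B) :
    ∑ j ∈ J, g j ≤ s * 2 ^ (B + 1) := by
  classical
  have hmaps : ∀ j ∈ J, c (Int.log 2 (lam j)) ∈ J.image fun j => c (Int.log 2 (lam j)) :=
    fun j hj => Finset.mem_image_of_mem _ hj
  rw [← Finset.sum_fiberwise_of_maps_to hmaps]
  calc _ ≤ ∑ b ∈ J.image fun j => c (Int.log 2 (lam j)), (s : ℝ) * 2 ^ b := by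
        refine Finset.sum_le_sum fun b _ => ?_
        calc ∑ j ∈ J with c (Int.log 2 (lam j)) = b, g j
            ≤ ∑ j ∈ J with c (Int.log 2 (lam j)) = b, (2 : ℝ) ^ b :=
              Finset.sum_le_sum fun j hj => by
                have h := Finset.mem_filter.1 hj
                exact h.2 ▸ hg j h.1
          _ ≤ (s : ℝ) * 2 ^ b := by
              rw [Finset.sum_const, nsmul_eq_mul]
              gcongr
              obtain hE | ⟨j₀, hj₀⟩ :=
                (J.filter fun j => c (Int.log 2 (lam j)) = b).eq_empty_or_nonempty
              · simp [hE]
              · refine hblock (Int.log 2 (lam j₀)) _ fun j hj => hc ?_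
                rw [(Finset.mem_filter.1 hj).2, (Finset.mem_filter.1 hj₀).2]
    _ ≤ s * 2 ^ (B + 1) := by
        rw [← Finset.mul_sum]
        gcongr
        refine sum_zpow_two_le _ B fun b hb => ?_
        obtain ⟨j, hj, rfl⟩ := Finset.mem_image.1 hb
        exact hB j hj

theorem LacBound.of_card_block_le {ι : Type*} {lam : ι → ℝ} {s : ℕ} (hs : 1 ≤ s)
    (hpos : ∀ j, 0 < lam j)
    (hblock : ∀ (b : ℤ) (S : Finset ι), (∀ j ∈ S, Int.log 2 (lam j) = b) → S.card ≤ s)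
    (J : Finset ι) : LacBound J lam (4 * s) where
  one_le := by
    have : (1 : ℝ) ≤ s := by exact_mod_cast hs
    linarith
  pos := hpos
  low R hR := by
    have hR1 : (2 : ℝ) ^ Int.log 2 R ≤ R := by
      exact_mod_cast Int.zpow_log_le_self (b := 2) (by norm_num) hR
    calc _ ≤ (s : ℝ) * 2 ^ (Int.log 2 R + 1 + 1) := by
          refine sum_le_of_card_block_le hblock _ lam (fun b => b + 1) (add_left_injective 1) _
            (fun j _ => ?_) fun j hj => ?_
          · exact_mod_cast (Int.lt_zpow_succ_log_self (b := 2) (by norm_num) (lam j)).le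
          · have := Int.log_mono_right (b := 2) (hpos j) (Finset.mem_filter.1 hj).2
            omega
      _ = 4 * s * 2 ^ Int.log 2 R := by
          rw [zpow_add_one₀ (by norm_num), zpow_add_one₀ (by norm_num)]; ring
      _ ≤ 4 * s * R := by gcongr
  high R hR := by
    have hR1 : R ≤ (2 : ℝ) ^ (Int.log 2 R + 1) := by
      exact_mod_cast (Int.lt_zpow_succ_log_self (b := 2) (by norm_num) R).le
    calc _ ≤ (s : ℝ) * 2 ^ (-Int.log 2 R + 1) := by
          refine sum_le_of_card_block_le hblock _ _ (fun b => -b) neg_injective _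
            (fun j _ => ?_) fun j hj => ?_
          · rw [zpow_neg]
            refine inv_anti₀ (by positivity) ?_
            exact_mod_cast Int.zpow_log_le_self (b := 2) (by norm_num) (hpos j)
          · have := Int.log_mono_right (b := 2) hR (Finset.mem_filter.1 hj).2
            omega
      _ = 4 * s * (2 ^ (Int.log 2 R + 1))⁻¹ := by
          rw [← zpow_neg, show -Int.log 2 R + 1 = -(Int.log 2 R + 1) + 1 + 1 by ring,
            zpow_add_one₀ (by norm_num), zpow_add_one₀ (by norm_num)]
          ring
      _ ≤ 4 * s * (2 * R / 2)⁻¹ := by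
          have : R / 2 > 0 := by positivity
          have : 2 * R / 2 ≤ (2 : ℝ) ^ (Int.log 2 R + 1) := by linarith
          gcongr
      _ = 4 * s / R := by field_simp

section sigma

variable {Λ : ℤ → ℝ}

theorem finite_range_inter_Ico (hbot : Tendsto Λ atBot (𝓝 0))
    (htop : Tendsto Λ atTop atTop) {a b : ℝ} (ha : 0 < a) :
    (Set.range Λ ∩ Set.Ico a b).Finite := by
  obtain ⟨m, hm⟩ := eventually_atBot.1 (hbot.eventually_lt_const ha)
  obtain ⟨n, hn⟩ := eventually_atTop.1 (htop.eventually_ge_atTop b)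
  refine ((Set.finite_Icc m n).image Λ).subset ?_
  rintro _ ⟨⟨j, rfl⟩, hj⟩
  refine ⟨j, ⟨?_, ?_⟩, rfl⟩
  · by_contra h
    exact absurd (hm j (by omega)) (not_lt.2 hj.1)
  · by_contra h
    exact absurd (hn j (by omega)) (not_le.2 hj.2)

theorem card_block_le_sigmaE (hpos : ∀ j, 0 < Λ j) (hbot : Tendsto Λ atBot (𝓝 0))
    (htop : Tendsto Λ atTop atTop)
    (hbdd : BddAbove {m : ℕ | ∃ j : ℤ,
      m = (Set.range Λ ∩ Set.Ico ((2 : ℝ) ^ (j - 1)) ((2 : ℝ) ^ j)).ncard})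
    {lam : ℤ → ℝ} (hinj : Function.Injective lam) (hr : Set.range lam ⊆ Set.range Λ)
    (b : ℤ) (S : Finset ℤ) (hS : ∀ j ∈ S, Int.log 2 (lam j) = b) : S.card ≤ sigmaE Λ := by
  classical
  have hle : (Set.range Λ ∩ Set.Ico ((2 : ℝ) ^ (b + 1 - 1)) ((2 : ℝ) ^ (b + 1))).ncard ≤ sigmaE Λ :=
    le_csSup hbdd ⟨b + 1, rfl⟩
  refine le_trans ?_ hle
  rw [← Finset.card_image_of_injective S hinj, ← Set.ncard_coe_finset]
  refine Set.ncard_le_ncard ?_ (finite_range_inter_Ico hbot htop (by positivity))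
  intro y hy
  obtain ⟨j, hj, rfl⟩ := Finset.mem_image.1 hy
  refine ⟨hr ⟨j, rfl⟩, ?_⟩
  have h0 : 0 < lam j := by
    obtain ⟨i, hi⟩ := hr ⟨j, rfl⟩
    exact hi ▸ hpos i
  rw [add_sub_cancel_right, ← hS j hj]
  constructor
  · exact_mod_cast Int.zpow_log_le_self (b := 2) (by norm_num) h0
  · exact_mod_cast Int.lt_zpow_succ_log_self (b := 2) (by norm_num) (lam j)

theorem LPFamily.of_sigmaE (hpos : ∀ j, 0 < Λ j) (hmono : StrictMono Λ)
    (hbot : Tendsto Λ atBot (𝓝 0)) (htop : Tendsto Λ atTop atTop)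
    (hbdd : BddAbove {m : ℕ | ∃ j : ℤ,
      m = (Set.range Λ ∩ Set.Ico ((2 : ℝ) ^ (j - 1)) ((2 : ℝ) ^ j)).ncard}) (J : Finset ℤ) :
    LPFamily J (fun j => Λ (j - 1)) Λ (4 * sigmaE Λ) := by
  have hs : 1 ≤ sigmaE Λ := by
    simpa using card_block_le_sigmaE hpos hbot htop hbdd hmono.injective le_rfl
      (Int.log 2 (Λ 0)) {0} (by simp)
  refine ⟨LacBound.of_card_block_le hs (fun j => hpos _) ?_ J,
    LacBound.of_card_block_le hs hpos ?_ J, fun j => hmono.monotone (by omega), ?_⟩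
  · refine card_block_le_sigmaE hpos hbot htop hbdd
      (hmono.injective.comp (sub_left_injective (b := (1 : ℤ)))) ?_
    rintro _ ⟨j, rfl⟩
    exact ⟨_, rfl⟩
  · exact card_block_le_sigmaE hpos hbot htop hbdd hmono.injective le_rfl
  · exact fun i _ j _ hij => hmono.monotone.pairwise_disjoint_on_Ioc_pred hij

end sigma

theorem lintegral_tsum_rpow_le {α ι : Type*} [MeasurableSpace α] {μ : Measure α}
    {F : ι → α → ℝ≥0∞} (hF : ∀ j, Measurable (F j)) {q : ℝ} {B : ℝ≥0∞}
    {S : ℕ → Finset ι} (hS : Tendsto S atTop atTop)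
    (hB : ∀ n, ∫⁻ x, (∑ j ∈ S n, F j x) ^ q ∂μ ≤ B) :
    ∫⁻ x, (∑' j, F j x) ^ q ∂μ ≤ B := by
  have hlim : ∀ x, Tendsto (fun n => (∑ j ∈ S n, F j x) ^ q) atTop (𝓝 ((∑' j, F j x) ^ q)) :=
    fun x => (ENNReal.continuous_rpow_const.tendsto _).comp
      ((ENNReal.summable (f := fun j => F j x)).hasSum.comp hS)
  calc ∫⁻ x, (∑' j, F j x) ^ q ∂μ
      = ∫⁻ x, liminf (fun n => (∑ j ∈ S n, F j x) ^ q) atTop ∂μ :=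
        lintegral_congr fun x => (hlim x).liminf_eq.symm
    _ ≤ liminf (fun n => ∫⁻ x, (∑ j ∈ S n, F j x) ^ q ∂μ) atTop :=
        lintegral_liminf_le fun n => (Finset.measurable_fun_sum _ fun j _ => hF j).pow_const q
    _ ≤ liminf (fun _ : ℕ => B) atTop := liminf_le_liminf (Eventually.of_forall hB)
    _ = B := liminf_const B

theorem tendsto_piFinset_Icc (d : ℕ) :
    Tendsto (fun n : ℕ => Fintype.piFinset fun _ : Fin d => Finset.Icc (-(n : ℤ)) n)
      atTop atTop := by
  refine tendsto_atTop_finset_of_monotone (fun m n hmn => ?_) fun j => ?_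
  · refine Fintype.piFinset_subset _ _ fun _ => Finset.Icc_subset_Icc ?_ ?_ <;> simpa using hmn
  · refine ⟨∑ k, (j k).natAbs, ?_⟩
    simp only [Fintype.mem_piFinset, Finset.mem_Icc]
    intro k
    have : (j k).natAbs ≤ ∑ k, (j k).natAbs :=
      Finset.single_le_sum (f := fun k => (j k).natAbs) (fun _ _ => Nat.zero_le _)
        (Finset.mem_univ k)
    omega

theorem enorm_LPsqE_rpow_le {d : ℕ} (Λs : Fin d → ℤ → ℝ) (f : (Fin d → ℝ) → ℂ) (x : Fin d → ℝ)
    {p : ℝ} (hp : 0 ≤ p) :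
    ‖LPsqE Λs f x‖ₑ ^ p ≤ (∑' j : Fin d → ℤ, ‖PpiecePi Λs j f x‖ₑ ^ 2) ^ (p / 2) := by
  unfold LPsqE
  rw [Real.enorm_of_nonneg (Real.sqrt_nonneg _), Real.sqrt_eq_rpow,
    ← ENNReal.ofReal_rpow_of_nonneg (tsum_nonneg fun _ => by positivity) (by norm_num),
    ← ENNReal.rpow_mul, one_div_mul_eq_div]
  refine ENNReal.rpow_le_rpow ?_ (by positivity)
  by_cases hs : Summable fun j : Fin d → ℤ => ‖PpiecePi Λs j f x‖ ^ 2
  · rw [ENNReal.ofReal_tsum_of_nonneg (fun _ => by positivity) hs]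
    refine le_of_eq (tsum_congr fun j => ?_)
    rw [ENNReal.ofReal_pow (norm_nonneg _), ofReal_norm]
  · rw [tsum_eq_zero_of_not_summable hs, ENNReal.ofReal_zero]
    exact bot_le

theorem ofReal_four_mul_rpow_le {x p : ℝ} (hx : 0 ≤ x) (hp : 1 < p) :
    ENNReal.ofReal (4 * x ^ p) ^ (1 / p) ≤ ENNReal.ofReal (4 * x) := by
  rw [ENNReal.ofReal_rpow_of_nonneg (by positivity) (by positivity)]
  refine ENNReal.ofReal_le_ofReal ?_
  calc (4 * x ^ p) ^ (1 / p) ≤ ((4 * x) ^ p) ^ (1 / p) := by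
        refine Real.rpow_le_rpow (by positivity) ?_ (by positivity)
        rw [Real.mul_rpow (by norm_num) hx]
        gcongr
        calc (4 : ℝ) = 4 ^ (1 : ℝ) := (Real.rpow_one 4).symm
          _ ≤ 4 ^ p := Real.rpow_le_rpow_of_exponent_le (by norm_num) hp.le
    _ = 4 * x := by
        rw [← Real.rpow_mul (by positivity), mul_one_div_cancel (by linarith), Real.rpow_one]

theorem prod_lpBound_eq {d : ℕ} (s : Fin d → ℕ) {p : ℝ} (hp : 1 < p) :
    ∏ k, (4 * lpBound (4 * s k) p) =
      (8 * lpConst) ^ d * (p - 1) ^ (-(3 * (d : ℝ)) / 2) * ∏ n, √(s n) := by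
  have h : ∀ k, 4 * lpBound (4 * s k) p = 8 * lpConst * (p - 1) ^ (-(3 / 2) : ℝ) * √(s k) := by
    intro k
    unfold lpBound
    rw [Real.sqrt_mul (by norm_num), show √(4 : ℝ) = 2 by
      rw [show (4 : ℝ) = 2 ^ 2 by norm_num]; exact Real.sqrt_sq (by norm_num)]
    ring
  simp only [h]
  rw [Finset.prod_mul_distrib, Finset.prod_const, Finset.card_univ, Fintype.card_fin, mul_pow,
    ← Real.rpow_mul_natCast (by linarith)]
  congr 3
  ring

/-- For every `d ≥ 1` there is `C_d > 0` such that for all Littlewood–Paley sequences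
`Λ₁,…,Λ_d` on `ℝ` with `σ_{Λ_n} < ∞`, every `1 < p < 2` and every Schwartz function `f`
on `ℝ^d`,
`‖S^{(Λ₁,…,Λ_d)}_{ℝ^d} f‖_p ≤ C_d (p-1)^{-3d/2} (Π_n σ_{Λ_n}^{1/2}) ‖f‖_p`. -/
theorem statement18 (d : ℕ) (hd : 0 < d) :
    ∃ C : ℝ, 0 < C ∧
      ∀ Λs : Fin d → ℤ → ℝ,
        (∀ n, ∀ j : ℤ, 0 < Λs n j) →
        (∀ n, StrictMono (Λs n)) →
        (∀ n, Tendsto (Λs n) atBot (𝓝 0)) →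
        (∀ n, Tendsto (Λs n) atTop atTop) →
        (∀ n, BddAbove {m : ℕ | ∃ j : ℤ,
          m = (Set.range (Λs n) ∩ Set.Ico ((2:ℝ) ^ (j - 1)) ((2:ℝ) ^ j)).ncard}) →
        ∀ (p : ℝ), 1 < p → p < 2 →
        ∀ f : SchwartzMap (Fin d → ℝ) ℂ,
          eLpNorm (LPsqE Λs (⇑f)) (ENNReal.ofReal p) volume ≤
            ENNReal.ofReal (C * (p - 1) ^ (-(3 * (d:ℝ))/2) * ∏ n, Real.sqrt (sigmaE (Λs n))) *
              eLpNorm (⇑f) (ENNReal.ofReal p) volume := by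
  have hL : 0 < lpConst := zero_lt_one.trans_le one_le_lpConst
  refine ⟨(8 * lpConst) ^ d, by positivity, fun Λs hpos hmono hbot htop hbdd p hp hp2 f => ?_⟩
  have hp0 : 0 < p := by linarith
  have hf := f.decayFun
  have hpieces := fun j => funext fun x =>
    PpiecePi_eq_lpPieceD hpos hmono j hf.integrable x
  have hcont : ∀ j, Continuous (PpiecePi Λs j f) := fun j => by
    rw [hpieces]
    exact hf.continuous_lpPieceD (fun _ => (hpos _ _).le) fun _ => (hpos _ _).le
  have hmain : ∫⁻ x, ‖LPsqE Λs f x‖ₑ ^ p ≤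
      (∏ k, ENNReal.ofReal (4 * lpBound (4 * sigmaE (Λs k)) p ^ p)) * ∫⁻ x, ‖f x‖ₑ ^ p := by
    refine (lintegral_mono fun x => enorm_LPsqE_rpow_le Λs f x hp0.le).trans ?_
    refine lintegral_tsum_rpow_le (fun j => (hcont j).measurable.enorm.pow_const 2)
      (tendsto_piFinset_Icc d) fun n => ?_
    simp only [hpieces]
    exact lintegral_rpow_sum_sq_lpPieceD_le hp hp2
      (fun k => LPFamily.of_sigmaE (hpos k) (hmono k) (hbot k) (htop k) (hbdd k) _) hf
  have hpne : ENNReal.ofReal p ≠ 0 := by simpa using hp0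
  rw [eLpNorm_eq_lintegral_rpow_enorm_toReal hpne ENNReal.ofReal_ne_top,
    eLpNorm_eq_lintegral_rpow_enorm_toReal hpne ENNReal.ofReal_ne_top,
    ENNReal.toReal_ofReal hp0.le, ← prod_lpBound_eq _ hp,
    ENNReal.ofReal_prod_of_nonneg fun k _ => mul_nonneg (by norm_num) (lpBound_nonneg hp)]
  calc _ ≤ ((∏ k, ENNReal.ofReal (4 * lpBound (4 * sigmaE (Λs k)) p ^ p)) *
          ∫⁻ x, ‖f x‖ₑ ^ p) ^ (1 / p) := ENNReal.rpow_le_rpow hmain (by positivity)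
    _ ≤ _ := by
        rw [ENNReal.mul_rpow_of_nonneg _ _ (by positivity),
          ← ENNReal.prod_rpow_of_nonneg (by positivity)]
        gcongr with k
        exact ofReal_four_mul_rpow_le (lpBound_nonneg hp) hp

end
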